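/- arXiv:2101.00366 — 14 statements merged into one kernel-verified Lean document; each statement's English description precedes it below -/
import Mathlib

section
/- Let X ∈ ℝ^{n×p} admit a factorization X = U D Vᵀ, where D ∈ ℝ^{r×r} is diagonal with positive diagonal entries d₁,…,d_r and U ∈ ℝ^{n×r}, V ∈ ℝ^{p×r} satisfy UᵀU = I_r and VᵀV = I_r (the singular value decomposition of X). Let Λ ∈ ℝ^{p×p} be diagonal with positive diagonal entries λ₁,…,λ_p, and let λ > 0 satisfy λ ≤ min{λ₁,…,λ_p}. Then for every y ∈ ℝⁿ, yᵀ X (XᵀX + Λ)⁻¹ Xᵀ y ≤ yᵀy − ‖(I_n − UUᵀ)y‖² − Σ_{i=1}^r λ ũ_i²/(d_i² + λ), where ũ_i is the i-th component of ũ = Uᵀy. -/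
open Matrix

lemma aux_proj {m r : ℕ} (W : Matrix (Fin m) (Fin r) ℝ) (hW : W.transpose * W = 1)
    (b : Fin m → ℝ) :
    ((1 - W * W.transpose).mulVec b) ⬝ᵥ ((1 - W * W.transpose).mulVec b)
      = b ⬝ᵥ b - (W.transpose.mulVec b) ⬝ᵥ (W.transpose.mulVec b) := by
  have h1 : (1 - W * W.transpose).mulVec b = b - W.mulVec (W.transpose.mulVec b) := by
    rw [Matrix.sub_mulVec, Matrix.one_mulVec, Matrix.mulVec_mulVec]
  have h2 : ∀ c : Fin r → ℝ, b ⬝ᵥ W.mulVec c = (W.transpose.mulVec b) ⬝ᵥ c := by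
    intro c
    rw [Matrix.dotProduct_mulVec, Matrix.mulVec_transpose]
  have h3 : ∀ c : Fin r → ℝ, W.mulVec c ⬝ᵥ W.mulVec c = c ⬝ᵥ c := by
    intro c
    rw [Matrix.dotProduct_mulVec, ← Matrix.mulVec_transpose, Matrix.mulVec_mulVec, hW,
      Matrix.one_mulVec]
  rw [h1, sub_dotProduct, dotProduct_sub, dotProduct_sub, h3,
    dotProduct_comm (W.mulVec _) b, h2]
  ring

/-- Let `X = U D Vᵀ` be a singular value decomposition of
`X ∈ ℝ^{n×p}` (with `D` diagonal with positive diagonal entries and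
`UᵀU = I`, `VᵀV = I`), let `Λ` be diagonal with positive diagonal entries,
and let `0 < λ ≤ min λᵢ`.  Then for every `y ∈ ℝⁿ`,
`yᵀ X (XᵀX + Λ)⁻¹ Xᵀ y ≤ yᵀy − ‖(I − UUᵀ)y‖² − ∑ᵢ λ ũᵢ²/(dᵢ² + λ)`
where `ũ = Uᵀy`. -/
theorem stmt0 (n p r : ℕ)
    (X : Matrix (Fin n) (Fin p) ℝ)
    (U : Matrix (Fin n) (Fin r) ℝ) (D : Matrix (Fin r) (Fin r) ℝ)
    (V : Matrix (Fin p) (Fin r) ℝ)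
    (d : Fin r → ℝ) (hd : ∀ i, 0 < d i) (hD : D = Matrix.diagonal d)
    (hX : X = U * D * V.transpose)
    (hU : U.transpose * U = 1) (hV : V.transpose * V = 1)
    (lam : Fin p → ℝ) (hlam : ∀ j, 0 < lam j)
    (Λ : Matrix (Fin p) (Fin p) ℝ) (hΛ : Λ = Matrix.diagonal lam)
    (l : ℝ) (hl : 0 < l) (hll : ∀ j, l ≤ lam j)
    (y : Fin n → ℝ) :
    y ⬝ᵥ (X * (X.transpose * X + Λ)⁻¹ * X.transpose).mulVec y ≤
      y ⬝ᵥ y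
        - ((1 - U * U.transpose).mulVec y) ⬝ᵥ ((1 - U * U.transpose).mulVec y)
        - ∑ i, l * (U.transpose.mulVec y i) ^ 2 / ((d i) ^ 2 + l) := by
  have hA : (X.transpose * X + Λ).PosDef := by
    apply Matrix.PosDef.posSemidef_add
    · simpa using Matrix.posSemidef_conjTranspose_mul_self X
    · rw [hΛ]; exact Matrix.PosDef.diagonal hlam
  have hdet : IsUnit (X.transpose * X + Λ).det := hA.det_pos.ne'.isUnit
  obtain ⟨b, hb⟩ : ∃ b, b = (X.transpose * X + Λ)⁻¹.mulVec (X.transpose.mulVec y) := ⟨_, rfl⟩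
  have hAb : (X.transpose * X + Λ).mulVec b = X.transpose.mulVec y := by
    rw [hb, Matrix.mulVec_mulVec, Matrix.mul_nonsing_inv _ hdet, Matrix.one_mulVec]
  have hL : (X * (X.transpose * X + Λ)⁻¹ * X.transpose).mulVec y = X.mulVec b := by
    rw [hb, Matrix.mulVec_mulVec, Matrix.mulVec_mulVec, Matrix.mul_assoc]
  obtain ⟨w, hw⟩ : ∃ w, w = V.transpose.mulVec b := ⟨_, rfl⟩
  obtain ⟨u, hu⟩ : ∃ u, u = U.transpose.mulVec y := ⟨_, rfl⟩
  have hXb : X.mulVec b = U.mulVec (D.mulVec w) := by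
    rw [hX, hw, Matrix.mulVec_mulVec, Matrix.mulVec_mulVec, Matrix.mul_assoc]
  have hDw : D.mulVec w = fun i => d i * w i := by
    ext i; rw [hD, Matrix.mulVec_diagonal]
  have e1 : y ⬝ᵥ X.mulVec b = ∑ i, u i * (d i * w i) := by
    rw [hXb, Matrix.dotProduct_mulVec, ← Matrix.mulVec_transpose, ← hu, hDw]; rfl
  have e2 : X.mulVec b ⬝ᵥ X.mulVec b = ∑ i, (d i * w i) * (d i * w i) := by
    rw [hXb, Matrix.dotProduct_mulVec, ← Matrix.mulVec_transpose, Matrix.mulVec_mulVec, hU,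
      Matrix.one_mulVec, hDw]; rfl
  have e3 : y ⬝ᵥ X.mulVec b = X.mulVec b ⬝ᵥ X.mulVec b + ∑ j, lam j * (b j * b j) := by
    have : y ⬝ᵥ X.mulVec b = b ⬝ᵥ (X.transpose * X + Λ).mulVec b := by
      rw [hAb, Matrix.dotProduct_mulVec, ← Matrix.mulVec_transpose, dotProduct_comm]
    rw [this, Matrix.add_mulVec, dotProduct_add, ← Matrix.mulVec_mulVec,
      Matrix.dotProduct_mulVec b, Matrix.vecMul_transpose]
    congr 1
    rw [hΛ]
    simp only [dotProduct, Matrix.mulVec_diagonal]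
    exact Finset.sum_congr rfl fun j _ => by ring
  have e4 : l * ∑ i, w i * w i ≤ ∑ j, lam j * (b j * b j) := by
    have h0 := aux_proj V hV b
    have h1 : 0 ≤ b ⬝ᵥ b - w ⬝ᵥ w := by
      rw [hw, ← h0]
      exact Finset.sum_nonneg fun i _ => mul_self_nonneg _
    have h2 : l * ∑ j, b j * b j ≤ ∑ j, lam j * (b j * b j) := by
      rw [Finset.mul_sum]
      exact Finset.sum_le_sum fun j _ => mul_le_mul_of_nonneg_right (hll j) (mul_self_nonneg _)
    have h3 : ∑ i, w i * w i ≤ ∑ j, b j * b j := by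
      simp only [dotProduct] at h1
      linarith
    exact (mul_le_mul_of_nonneg_left h3 hl.le).trans h2
  rw [hL, aux_proj U hU y, ← hu]
  have key : ∑ i, (2 * (u i * (d i * w i)) - (d i * w i) * (d i * w i) - l * (w i * w i))
      ≤ ∑ i, (u i * u i - l * (u i) ^ 2 / ((d i) ^ 2 + l)) := by
    refine Finset.sum_le_sum fun i _ => ?_
    have hp : 0 < d i ^ 2 + l := by positivity
    have : u i * u i - l * (u i) ^ 2 / ((d i) ^ 2 + l)
        - (2 * (u i * (d i * w i)) - (d i * w i) * (d i * w i) - l * (w i * w i))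
        = (d i * u i - (d i ^ 2 + l) * w i) ^ 2 / (d i ^ 2 + l) := by
      field_simp
      ring
    have h' : 0 ≤ (d i * u i - (d i ^ 2 + l) * w i) ^ 2 / (d i ^ 2 + l) := by positivity
    linarith
  simp only [Finset.sum_sub_distrib, ← Finset.mul_sum] at key
  have e5 : u ⬝ᵥ u = ∑ i, u i * u i := rfl
  have e6 : y ⬝ᵥ X.mulVec b = 2 * (y ⬝ᵥ X.mulVec b) - X.mulVec b ⬝ᵥ X.mulVec b
      - ∑ j, lam j * (b j * b j) := by linarith
  linarith
end

section
/- Let x₁ ∈ ℝⁿ and X₂ ∈ ℝ^{n×(p−1)}, and suppose X₂ = U D Vᵀ, where D ∈ ℝ^{r×r} is diagonal with positive diagonal entries d₁,…,d_r and UᵀU = I_r, VᵀV = I_r. Let δ₁ > 0 and let Δ_{p−1} ∈ ℝ^{(p−1)×(p−1)} be diagonal with positive diagonal entries δ₂,…,δ_p. Define T := (‖x₁‖² + δ₁) − x₁ᵀ X₂ (X₂ᵀX₂ + Δ_{p−1})⁻¹ X₂ᵀ x₁. Then for every δ with 0 < δ ≤ min{δ₁, δ₂, …, δ_p}, T ≥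 δ₁ + ‖(I_n − UUᵀ)x₁‖² + Σ_{i=1}^r δ ũ_i²/(d_i² + δ), where ũ_i is the i-th component of ũ = Uᵀx₁. -/
open Matrix

lemma proj_aux {n r : ℕ} (U : Matrix (Fin n) (Fin r) ℝ) (hU : U.transpose * U = 1)
    (x : Fin n → ℝ) :
    ((1 - U * U.transpose).mulVec x) ⬝ᵥ ((1 - U * U.transpose).mulVec x)
      = x ⬝ᵥ x - (U.transpose.mulVec x) ⬝ᵥ (U.transpose.mulVec x) := by
  have h1 : ∀ y : Fin n → ℝ, y ⬝ᵥ U *ᵥ (Uᵀ *ᵥ x) = (Uᵀ *ᵥ y) ⬝ᵥ (Uᵀ *ᵥ x) := by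
    intro y
    rw [dotProduct_mulVec, ← mulVec_transpose]
  have h2 : Uᵀ *ᵥ (U *ᵥ (Uᵀ *ᵥ x)) = Uᵀ *ᵥ x := by
    rw [mulVec_mulVec, hU, one_mulVec]
  rw [sub_mulVec, one_mulVec, ← mulVec_mulVec, sub_dotProduct, dotProduct_sub, dotProduct_sub,
    h1, h1, h2, dotProduct_comm (U *ᵥ (Uᵀ *ᵥ x)) x, h1]
  ring

/-- Let `x₁ ∈ ℝⁿ` and `X₂ ∈ ℝ^{n×(p−1)}` with singular value
decomposition `X₂ = U D Vᵀ` (`D` diagonal with positive diagonal entries,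
`UᵀU = I`, `VᵀV = I`).  Let `δ₁ > 0` and `Δ_{p−1}` diagonal with positive
diagonal entries `δ₂, …, δ_p`, and set
`T := (‖x₁‖² + δ₁) − x₁ᵀ X₂ (X₂ᵀX₂ + Δ_{p−1})⁻¹ X₂ᵀ x₁`.  Then for
`0 < δ ≤ min{δ₁, …, δ_p}`,
`T ≥ δ₁ + ‖(I − UUᵀ)x₁‖² + ∑ᵢ δ ũᵢ²/(dᵢ² + δ)` where `ũ = Uᵀx₁`. -/
theorem stmt1 (n q r : ℕ)
    (x1 : Fin n → ℝ) (X2 : Matrix (Fin n) (Fin q) ℝ)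
    (U : Matrix (Fin n) (Fin r) ℝ) (D : Matrix (Fin r) (Fin r) ℝ)
    (V : Matrix (Fin q) (Fin r) ℝ)
    (d : Fin r → ℝ) (hd : ∀ i, 0 < d i) (hD : D = Matrix.diagonal d)
    (hX : X2 = U * D * V.transpose)
    (hU : U.transpose * U = 1) (hV : V.transpose * V = 1)
    (δ1 : ℝ) (hδ1 : 0 < δ1)
    (δs : Fin q → ℝ) (hδs : ∀ j, 0 < δs j)
    (Δ : Matrix (Fin q) (Fin q) ℝ) (hΔ : Δ = Matrix.diagonal δs)
    (δ : ℝ) (hδ : 0 < δ) (hδδ1 : δ ≤ δ1) (hδδs : ∀ j, δ ≤ δs j) :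
    δ1 + ((1 - U * U.transpose).mulVec x1) ⬝ᵥ ((1 - U * U.transpose).mulVec x1)
        + ∑ i, δ * (U.transpose.mulVec x1 i) ^ 2 / ((d i) ^ 2 + δ)
      ≤ (x1 ⬝ᵥ x1 + δ1)
          - x1 ⬝ᵥ (X2 * (X2.transpose * X2 + Δ)⁻¹ * X2.transpose).mulVec x1 := by
  have hM : (X2ᵀ * X2 + Δ).PosDef := by
    have h1 : (X2ᵀ * X2).PosSemidef := by
      simpa using Matrix.posSemidef_conjTranspose_mul_self X2
    have h2 : Δ.PosDef := by
      rw [hΔ]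
      exact Matrix.PosDef.diagonal hδs
    exact Matrix.PosDef.posSemidef_add h1 h2
  have hdet : IsUnit (X2ᵀ * X2 + Δ).det := hM.det_pos.ne'.isUnit
  obtain ⟨b, hb⟩ : ∃ b, b = (X2ᵀ * X2 + Δ)⁻¹ *ᵥ (X2ᵀ *ᵥ x1) := ⟨_, rfl⟩
  have hMb : (X2ᵀ * X2 + Δ) *ᵥ b = X2ᵀ *ᵥ x1 := by
    rw [hb, mulVec_mulVec, Matrix.mul_nonsing_inv _ hdet, one_mulVec]
  have hQ : x1 ⬝ᵥ (X2 * (X2ᵀ * X2 + Δ)⁻¹ * X2ᵀ) *ᵥ x1 = x1 ⬝ᵥ X2 *ᵥ b := by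
    rw [hb, mulVec_mulVec, mulVec_mulVec, Matrix.mul_assoc]
  have hXb : X2 *ᵥ b = U *ᵥ (D *ᵥ (Vᵀ *ᵥ b)) := by
    rw [hX, mulVec_mulVec, mulVec_mulVec, Matrix.mul_assoc]
  obtain ⟨s, hs⟩ : ∃ s, s = Vᵀ *ᵥ b := ⟨_, rfl⟩
  obtain ⟨u, hu⟩ : ∃ u, u = Uᵀ *ᵥ x1 := ⟨_, rfl⟩
  have hQ1 : x1 ⬝ᵥ X2 *ᵥ b = ∑ i, d i * u i * s i := by
    rw [hXb, dotProduct_mulVec, ← mulVec_transpose, ← hs, ← hu, hD]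
    simp only [dotProduct, mulVec_diagonal]
    exact Finset.sum_congr rfl fun i _ => by ring
  have hXX : (X2 *ᵥ b) ⬝ᵥ (X2 *ᵥ b) = ∑ i, (d i)^2 * (s i)^2 := by
    rw [hXb, dotProduct_mulVec, ← mulVec_transpose, mulVec_mulVec, hU, one_mulVec, ← hs, hD]
    simp only [dotProduct, mulVec_diagonal]
    exact Finset.sum_congr rfl fun i _ => by ring
  have hQ2 : x1 ⬝ᵥ X2 *ᵥ b = ∑ i, (d i)^2 * (s i)^2 + ∑ j, δs j * (b j)^2 := by
    rw [dotProduct_mulVec, ← mulVec_transpose, ← hMb, ← hXX, add_mulVec, add_dotProduct,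
      ← mulVec_mulVec, mulVec_transpose, ← dotProduct_mulVec, hΔ]
    congr 1
    simp only [dotProduct, mulVec_diagonal]
    exact Finset.sum_congr rfl fun i _ => by ring
  have hB : ∑ i, (s i)^2 ≤ ∑ j, (b j)^2 := by
    have h := proj_aux V hV b
    have h0 : 0 ≤ ((1 - V * Vᵀ) *ᵥ b) ⬝ᵥ ((1 - V * Vᵀ) *ᵥ b) :=
      Finset.sum_nonneg fun i _ => mul_self_nonneg _
    rw [h, ← hs] at h0
    simp only [dotProduct, ← pow_two] at h0
    linarith
  have hB2 : δ * ∑ j, (b j)^2 ≤ ∑ j, δs j * (b j)^2 := by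
    rw [Finset.mul_sum]
    exact Finset.sum_le_sum fun j _ => mul_le_mul_of_nonneg_right (hδδs j) (sq_nonneg _)
  have hB3 : δ * ∑ i, (s i)^2 ≤ δ * ∑ j, (b j)^2 := mul_le_mul_of_nonneg_left hB hδ.le
  have hT : ∑ i, δ * (u i)^2 / ((d i)^2 + δ) + (2 * ∑ i, d i * u i * s i
      - ∑ i, (d i)^2 * (s i)^2 - δ * ∑ i, (s i)^2) ≤ ∑ i, u i * u i := by
    rw [Finset.mul_sum, Finset.mul_sum, ← Finset.sum_sub_distrib, ← Finset.sum_sub_distrib,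
      ← Finset.sum_add_distrib]
    refine Finset.sum_le_sum fun i _ => ?_
    have hp : 0 < (d i)^2 + δ := by positivity
    have key : u i * u i - (δ * (u i)^2 / ((d i)^2 + δ) + (2 * (d i * u i * s i)
      - (d i)^2 * (s i)^2 - δ * (s i)^2))
      = (d i * u i - ((d i)^2 + δ) * s i)^2 / ((d i)^2 + δ) := by
      field_simp
      ring
    have : 0 ≤ (d i * u i - ((d i)^2 + δ) * s i)^2 / ((d i)^2 + δ) := by positivity
    linarith
  rw [hQ, proj_aux U hU x1, ← hu]
  have huu : u ⬝ᵥ u = ∑ i, u i * u i := rfl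
  rw [huu]
  linarith
end

section
/- Let X = [x₁, X₂] ∈ ℝ^{n×p}, where x₁ ∈ ℝⁿ is the first column of X and X₂ ∈ ℝ^{n×(p−1)} consists of the remaining columns. Suppose there exists a finite constant C′ such that for every diagonal matrix Δ_{p−1} ∈ ℝ^{(p−1)×(p−1)} with positive diagonal entries, every entry of (X₂ᵀX₂ + Δ_{p−1})⁻¹ Δ_{p−1} is at most C′ in absolute value. Then there exists a finite constant C such that for every diagonal matrix Δ_p ∈ ℝ^{p×p} with positive diagonal entries, every entry of the first column of (XᵀX + Δ_p)⁻¹ Δ_p is at most C in absolute value. -/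
open Matrix

theorem normal_eq_aux {n q : ℕ} (Y : Matrix (Fin n) (Fin q) ℝ) (x : Fin n → ℝ) :
    ∃ u : Fin q → ℝ, (Yᵀ * Y) *ᵥ u = Yᵀ *ᵥ x := by
  have hle : LinearMap.range (Yᵀ * Y).mulVecLin ≤ LinearMap.range Yᵀ.mulVecLin := by
    rintro _ ⟨u, rfl⟩
    exact ⟨Y *ᵥ u, by simp [Matrix.mulVec_mulVec]⟩
  have hrk : (Yᵀ * Y).rank = Yᵀ.rank := by
    rw [Matrix.rank_transpose_mul_self, Matrix.rank_transpose]
  have heq := Submodule.eq_of_le_of_finrank_eq hle hrk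
  have hx : Yᵀ *ᵥ x ∈ LinearMap.range Yᵀ.mulVecLin := ⟨x, rfl⟩
  rw [← heq] at hx
  obtain ⟨u, hu⟩ := hx
  exact ⟨u, hu⟩

theorem posdef_aux {n q : ℕ} (Y : Matrix (Fin n) (Fin q) ℝ) (d : Fin q → ℝ)
    (hd : ∀ j, 0 < d j) : IsUnit (Yᵀ * Y + Matrix.diagonal d).det := by
  have h1 : (Yᵀ * Y).PosSemidef := by
    simpa using Matrix.posSemidef_conjTranspose_mul_self Y
  have h2 : (Matrix.diagonal d).PosDef := Matrix.PosDef.diagonal hd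
  exact (Matrix.isUnit_iff_isUnit_det _).1 (Matrix.PosDef.posSemidef_add h1 h2).isUnit


/-- Let `X = [x₁, X₂] ∈ ℝ^{n×p}` where `x₁` is the first
column and `X₂` consists of the remaining `p − 1` columns.  If every entry of
`(X₂ᵀX₂ + Δ_{p−1})⁻¹ Δ_{p−1}` is bounded in absolute value by a constant `C′`
uniformly over all diagonal `Δ_{p−1}` with positive diagonal entries, then
there exists a finite constant `C` such that every entry of the first column
of `(XᵀX + Δ_p)⁻¹ Δ_p` is at most `C` in absolute value, uniformly over all
diagonal `Δ_p` with positive diagonal entries. -/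
theorem stmt2 (n q : ℕ) (X : Matrix (Fin n) (Fin (q + 1)) ℝ)
    (C' : ℝ)
    (hC' : ∀ δs : Fin q → ℝ, (∀ j, 0 < δs j) →
      ∀ i j, |(((X.submatrix id Fin.succ).transpose * (X.submatrix id Fin.succ)
        + Matrix.diagonal δs)⁻¹ * Matrix.diagonal δs) i j| ≤ C') :
    ∃ C : ℝ, ∀ ds : Fin (q + 1) → ℝ, (∀ j, 0 < ds j) →
      ∀ i, |((X.transpose * X + Matrix.diagonal ds)⁻¹ * Matrix.diagonal ds) i 0| ≤ C := by
  set Y := X.submatrix id Fin.succ with hY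
  obtain ⟨u, hu⟩ := normal_eq_aux Y (fun k => X k 0)
  refine ⟨1 + ∑ i, (|u i| + ∑ j, C' * |u j|), fun ds hds => ?_⟩
  set A := Xᵀ * X + Matrix.diagonal ds with hA
  have hAu : IsUnit A.det := posdef_aux X ds hds
  set v : Fin (q + 1) → ℝ := A⁻¹ *ᵥ (Pi.single 0 (ds 0)) with hv
  have hentry : ∀ i, (A⁻¹ * Matrix.diagonal ds) i 0 = v i := by
    intro i
    simp [hv, Matrix.mul_diagonal, mul_comm]
  have hAv : A *ᵥ v = Pi.single 0 (ds 0) := by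
    rw [hv, Matrix.mulVec_mulVec, Matrix.mul_nonsing_inv _ hAu, Matrix.one_mulVec]
  have hAv' : Xᵀ *ᵥ (X *ᵥ v) + Matrix.diagonal ds *ᵥ v = Pi.single 0 (ds 0) := by
    rw [← hAv, hA, Matrix.add_mulVec, Matrix.mulVec_mulVec]
  have hv0 : |v 0| ≤ 1 := by
    have h1 := congrArg (fun z => v ⬝ᵥ z) hAv'
    simp only [dotProduct_add, dotProduct_single] at h1
    have h2 : v ⬝ᵥ (Xᵀ *ᵥ (X *ᵥ v)) = (X *ᵥ v) ⬝ᵥ (X *ᵥ v) := by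
      rw [Matrix.dotProduct_mulVec, Matrix.vecMul_transpose]
    have h3 : 0 ≤ (X *ᵥ v) ⬝ᵥ (X *ᵥ v) :=
      Finset.sum_nonneg fun i _ => mul_self_nonneg _
    have h4 : v 0 * (ds 0 * v 0) ≤ v ⬝ᵥ (Matrix.diagonal ds *ᵥ v) := by
      have h5 : v ⬝ᵥ (Matrix.diagonal ds *ᵥ v) = ∑ i, v i * (ds i * v i) := by
        simp [dotProduct, Matrix.mulVec_diagonal]
      rw [h5]
      refine Finset.single_le_sum (f := fun i => v i * (ds i * v i)) (fun i _ => ?_)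
        (Finset.mem_univ 0)
      have := mul_nonneg (hds i).le (mul_self_nonneg (v i))
      show 0 ≤ v i * (ds i * v i)
      linarith
    have h6 : ds 0 * (v 0 * v 0) ≤ ds 0 * v 0 := by linarith
    have h7 := le_of_mul_le_mul_left h6 (hds 0)
    rw [abs_le]
    constructor <;> nlinarith
  set d2 : Fin q → ℝ := fun j => ds j.succ with hd2
  have hd2p : ∀ j, 0 < d2 j := fun j => hds _
  set B := Yᵀ * Y + Matrix.diagonal d2 with hB
  have hBu : IsUnit B.det := posdef_aux Y d2 hd2p
  set w : Fin q → ℝ := fun j => v j.succ with hw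
  have hXv : X *ᵥ v = v 0 • (fun k => X k 0) + Y *ᵥ w := by
    ext k
    simp [Matrix.mulVec, dotProduct, Fin.sum_univ_succ, hY, hw, mul_comm]
  have hrow : Yᵀ *ᵥ (X *ᵥ v) + Matrix.diagonal d2 *ᵥ w = 0 := by
    ext j
    have := congrFun hAv' j.succ
    rw [Pi.add_apply, Matrix.mulVec_diagonal, Pi.single_eq_of_ne (Fin.succ_ne_zero j)] at this
    rw [Pi.add_apply, Matrix.mulVec_diagonal]
    exact this
  have hBw : B *ᵥ w = -(v 0 • ((Yᵀ * Y) *ᵥ u)) := by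
    rw [hXv, Matrix.mulVec_add, Matrix.mulVec_smul, ← hu] at hrow
    rw [hB, Matrix.add_mulVec, ← Matrix.mulVec_mulVec w]
    rw [add_assoc] at hrow
    exact (neg_eq_of_add_eq_zero_right hrow).symm
  set M := B⁻¹ * Matrix.diagonal d2 with hM
  have hBG : (Yᵀ * Y) *ᵥ u = B *ᵥ u - Matrix.diagonal d2 *ᵥ u := by
    rw [hB, Matrix.add_mulVec, add_sub_cancel_right]
  have hwu : w = -(v 0 • (u - M *ᵥ u)) := by
    have h := congrArg (fun z => B⁻¹ *ᵥ z) hBw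
    simpa [hBG, Matrix.mulVec_neg, Matrix.mulVec_smul, Matrix.mulVec_sub,
      Matrix.mulVec_mulVec, Matrix.nonsing_inv_mul _ hBu, ← hM] using h
  have hMb : ∀ i j, |M i j| ≤ C' := hC' d2 hd2p
  have hterm : ∀ i, |w i| ≤ |u i| + ∑ j, C' * |u j| := by
    intro i
    have h1 : |w i| = |v 0| * |u i - (M *ᵥ u) i| := by
      rw [hwu]; simp [abs_mul]
    have h2 : |(M *ᵥ u) i| ≤ ∑ j, C' * |u j| := by
      show |∑ j, M i j * u j| ≤ _
      refine (Finset.abs_sum_le_sum_abs _ _).trans (Finset.sum_le_sum fun j _ => ?_)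
      rw [abs_mul]
      exact mul_le_mul_of_nonneg_right (hMb i j) (abs_nonneg _)
    rw [h1]
    calc |v 0| * |u i - (M *ᵥ u) i| ≤ 1 * |u i - (M *ᵥ u) i| :=
          mul_le_mul_of_nonneg_right hv0 (abs_nonneg _)
      _ ≤ |u i| + |(M *ᵥ u) i| := by rw [one_mul]; exact abs_sub _ _
      _ ≤ _ := by linarith
  have hnn : ∀ i ∈ Finset.univ, 0 ≤ |u i| + ∑ j, C' * |u j| :=
    fun i _ => (abs_nonneg _).trans (hterm i)
  intro i
  rw [hentry]
  refine Fin.cases ?_ (fun j => ?_) i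
  · linarith [Finset.sum_nonneg hnn]
  · have h1 := Finset.single_le_sum hnn (Finset.mem_univ j)
    have h2 : |v j.succ| ≤ _ := hterm j
    linarith
end

section
/- Let n and p be arbitrary positive integers and let X ∈ ℝ^{n×p} be an arbitrary matrix. Then there exists a finite constant C, depending only on X, such that for every diagonal matrix Δ ∈ ℝ^{p×p} with positive diagonal entries and all indices 1 ≤ i, j ≤ p, |e_iᵀ (XᵀX + Δ)⁻¹ Δ e_j| < C, where e_i denotes the i-th standard basis vector of ℝ^p. -/
open Matrix

lemma dot_le_half {m : ℕ} (a b : Fin m → ℝ) : a ⬝ᵥ b ≤ (a ⬝ᵥ a + b ⬝ᵥ b) / 2 := by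
  simp only [dotProduct]
  rw [← Finset.sum_add_distrib, Finset.sum_div]
  exact Finset.sum_le_sum fun i _ => by nlinarith [sq_nonneg (a i - b i)]

/-- Bound for a fixed right-hand side and a fixed sign pattern of `w = b - x`. -/
lemma bound_sign {n p : ℕ} (X : Matrix (Fin n) (Fin p) ℝ) (b : Fin p → ℝ)
    (σ : Fin p → SignType) :
    ∃ C : ℝ, 0 ≤ C ∧ ∀ w : Fin p → ℝ, (∀ k, SignType.sign (w k) = σ k) →
      (∀ k, SignType.sign ((Xᵀ *ᵥ (X *ᵥ (b - w))) k) = σ k) → ∀ i, |w i| ≤ C := by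
  by_cases h : ∃ z : Fin n → ℝ, ∀ k, SignType.sign ((Xᵀ *ᵥ z) k) = σ k
  · obtain ⟨z, hz⟩ := h
    have hnn : ∀ v : Fin n → ℝ, 0 ≤ v ⬝ᵥ v := fun v =>
      Finset.sum_nonneg fun i _ => mul_self_nonneg _
    have key : ∀ a c : ℝ, SignType.sign a = SignType.sign c → 0 ≤ a * c := by
      intro a c hac
      rcases lt_trichotomy c 0 with h | h | h
      · rw [sign_neg h, sign_eq_neg_one_iff] at hac
        exact (mul_pos_of_neg_of_neg hac h).le
      · simp [h]
      · rw [sign_pos h, sign_eq_one_iff] at hac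
        positivity
    set K : ℝ := (z ⬝ᵥ z + (X *ᵥ b) ⬝ᵥ (X *ᵥ b)) / 2 with hK
    have hK0 : 0 ≤ K := by have := hnn z; have := hnn (X *ᵥ b); positivity
    have hterm : ∀ i, 0 ≤ K / |(Xᵀ *ᵥ z) i| := fun i => by positivity
    refine ⟨∑ i, K / |(Xᵀ *ᵥ z) i|, Finset.sum_nonneg fun i _ => hterm i, ?_⟩
    intro w hw hu i
    have tr : ∀ y : Fin n → ℝ, (Xᵀ *ᵥ y) ⬝ᵥ w = y ⬝ᵥ (X *ᵥ w) := by
      intro y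
      rw [mulVec_transpose, dotProduct_mulVec]
    have h1 : 0 ≤ (X *ᵥ (b - w)) ⬝ᵥ (X *ᵥ w) := by
      rw [← tr]
      exact Finset.sum_nonneg fun k _ => key _ _ ((hu k).trans (hw k).symm)
    rw [mulVec_sub, sub_dotProduct] at h1
    have h2 := dot_le_half (X *ᵥ b) (X *ᵥ w)
    have h3 := dot_le_half z (X *ᵥ w)
    have h4 : (Xᵀ *ᵥ z) ⬝ᵥ w ≤ K := by rw [tr, hK]; linarith
    have h5 : (Xᵀ *ᵥ z) i * w i ≤ (Xᵀ *ᵥ z) ⬝ᵥ w :=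
      Finset.single_le_sum (f := fun k => (Xᵀ *ᵥ z) k * w k)
        (fun k _ => key _ _ ((hz k).trans (hw k).symm)) (Finset.mem_univ i)
    have h6 : |w i| ≤ K / |(Xᵀ *ᵥ z) i| := by
      by_cases h0 : (Xᵀ *ᵥ z) i = 0
      · have : w i = 0 := by
          rw [← sign_eq_zero_iff, hw, ← hz, h0, sign_zero]
        simp [this, h0]
      · rw [le_div_iff₀ (abs_pos.2 h0), ← abs_mul, mul_comm,
          abs_of_nonneg (key _ _ ((hz i).trans (hw i).symm))]
        linarith
    exact h6.trans (Finset.single_le_sum (f := fun i => K / |(Xᵀ *ᵥ z) i|)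
      (fun i _ => hterm i) (Finset.mem_univ i))
  · exact ⟨0, le_rfl, fun w _ hu => (h ⟨_, hu⟩).elim⟩

lemma bound_rhs {n p : ℕ} (X : Matrix (Fin n) (Fin p) ℝ) (b : Fin p → ℝ) :
    ∃ C : ℝ, 0 ≤ C ∧ ∀ ds : Fin p → ℝ, (∀ j, 0 < ds j) → ∀ x : Fin p → ℝ,
      (Xᵀ * X + diagonal ds) *ᵥ x = diagonal ds *ᵥ b → ∀ i, |x i| ≤ C := by
  choose C hC0 hC using bound_sign X b
  refine ⟨∑ σ, C σ + ∑ i, |b i|, add_nonneg (Finset.sum_nonneg fun σ _ => hC0 σ)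
    (Finset.sum_nonneg fun i _ => abs_nonneg _), ?_⟩
  intro ds hds x hx i
  have hw := hC (fun k => SignType.sign ((b - x) k)) (b - x) (fun k => rfl) (by
    intro k
    have := congrFun hx k
    rw [add_mulVec, Pi.add_apply, mulVec_diagonal, mulVec_diagonal, ← mulVec_mulVec] at this
    have e : (Xᵀ *ᵥ (X *ᵥ x)) k = ds k * (b - x) k := by
      rw [Pi.sub_apply]; linarith
    rw [sub_sub_cancel, e, sign_mul, sign_pos (hds k), one_mul]) i
  have h1 := Finset.single_le_sum (f := C) (fun σ _ => hC0 σ)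
    (Finset.mem_univ (fun k => SignType.sign ((b - x) k)))
  have h2 := Finset.single_le_sum (f := fun i => |b i|) (fun i _ => abs_nonneg _)
    (Finset.mem_univ i)
  have h3 : |x i| ≤ |b i| + |(b - x) i| := by
    have := abs_sub (b i) ((b - x) i)
    simpa using this
  linarith

/-- For arbitrary positive integers `n, p` and an arbitrary
matrix `X ∈ ℝ^{n×p}` there is a finite constant `C`, depending only on `X`,
such that for every diagonal matrix `Δ` with positive diagonal entries and all
indices `i, j`, `|eᵢᵀ (XᵀX + Δ)⁻¹ Δ eⱼ| < C`. -/
theorem stmt3 (n p : ℕ) (hn : 0 < n) (hp : 0 < p)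
    (X : Matrix (Fin n) (Fin p) ℝ) :
    ∃ C : ℝ, ∀ ds : Fin p → ℝ, (∀ j, 0 < ds j) →
      ∀ i j, |((X.transpose * X + Matrix.diagonal ds)⁻¹ * Matrix.diagonal ds) i j| < C := by
  choose C hC0 hC using fun j : Fin p => bound_rhs X (Pi.single j 1)
  refine ⟨∑ j, C j + 1, ?_⟩
  intro ds hds i j
  have hpd : (Xᵀ * X + diagonal ds).PosDef := by
    have h1 : (Xᵀ * X).PosSemidef := by
      simpa using Matrix.posSemidef_conjTranspose_mul_self X
    exact Matrix.PosDef.posSemidef_add h1 (Matrix.PosDef.diagonal hds)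
  have hu : IsUnit (Xᵀ * X + diagonal ds).det := (Matrix.isUnit_iff_isUnit_det _).1 hpd.isUnit
  have := hC j ds hds (((Xᵀ * X + diagonal ds)⁻¹ * diagonal ds) *ᵥ Pi.single j 1) (by
    rw [mulVec_mulVec, ← Matrix.mul_assoc, Matrix.mul_nonsing_inv _ hu, Matrix.one_mul]) i
  rw [mulVec_single_one] at this
  have h1 := Finset.single_le_sum (f := C) (fun σ _ => hC0 σ) (Finset.mem_univ j)
  simp only [col_apply] at this
  linarith
end

section
/- Let n and p be arbitrary positive integers and let X ∈ ℝ^{n×p} be an arbitrary matrix. Then there exists a finite constant C, depending only on X, such that for every diagonal matrix Δ ∈ ℝ^{p×p} with positive diagonal entries and all indices 1 ≤ i, j ≤ p, |e_iᵀ (XᵀX + Δ)⁻¹ XᵀX e_j| < C, where e_i denotes the i-th standard basis vector of ℝ^p. -/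
open Matrix

lemma aux_bound {n p : ℕ} (X : Matrix (Fin n) (Fin p) ℝ) (y : Fin p → ℝ) :
    ∃ C : ℝ, ∀ ds : Fin p → ℝ, (∀ j, 0 < ds j) → ∀ b : Fin p → ℝ,
      (Xᵀ * X + Matrix.diagonal ds) *ᵥ b = (Xᵀ * X) *ᵥ y → ‖b‖ ≤ C := by
  by_contra! hcon
  choose ds hds b hb hlt using fun m : ℕ => hcon (m : ℝ)
  have hpos : ∀ m, 0 < ‖b m‖ := fun m => lt_of_le_of_lt (Nat.cast_nonneg m) (hlt m)
  have hu : ∀ m, ‖b m‖⁻¹ • b m ∈ Metric.sphere (0 : Fin p → ℝ) 1 := by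
    intro m
    rw [mem_sphere_zero_iff_norm, norm_smul, norm_inv, norm_norm]
    exact inv_mul_cancel₀ (hpos m).ne'
  obtain ⟨d, hd, φ, hφ, hlim⟩ := (isCompact_sphere (0 : Fin p → ℝ) 1).tendsto_subseq hu
  have hd0 : d ≠ 0 := by
    rintro rfl
    simp at hd
  have ht : Filter.Tendsto (fun m => ‖b (φ m)‖⁻¹) Filter.atTop (nhds 0) := by
    apply Filter.Tendsto.inv_tendsto_atTop
    have h1 : Filter.Tendsto (fun m => ‖b m‖) Filter.atTop Filter.atTop :=
      Filter.tendsto_atTop_mono (fun m => (hlt m).le) tendsto_natCast_atTop_atTop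
    exact h1.comp hφ.tendsto_atTop
  have hev : ∀ᶠ m in Filter.atTop, ∀ k, d k ≠ 0 → 0 < d k * (‖b (φ m)‖⁻¹ • b (φ m)) k := by
    rw [Filter.eventually_all]
    intro k
    by_cases hk : d k = 0
    · simp [hk]
    have h1 : Filter.Tendsto (fun m => d k * (‖b (φ m)‖⁻¹ • b (φ m)) k) Filter.atTop
        (nhds (d k * d k)) := ((tendsto_pi_nhds.1 hlim) k).const_mul (d k)
    filter_upwards [h1.eventually_const_lt (mul_self_pos.2 hk)] with m hm _ using hm
  have heq : ∀ m, d ⬝ᵥ ((Xᵀ * X) *ᵥ (‖b m‖⁻¹ • y - ‖b m‖⁻¹ • b m))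
      = ∑ k, ds m k * (d k * (‖b m‖⁻¹ • b m) k) := by
    intro m
    have h1 : (Xᵀ * X) *ᵥ (‖b m‖⁻¹ • y - ‖b m‖⁻¹ • b m)
        = Matrix.diagonal (ds m) *ᵥ (‖b m‖⁻¹ • b m) := by
      rw [mulVec_sub, mulVec_smul, ← hb m, add_mulVec, mulVec_smul, mulVec_smul, smul_add]
      abel
    rw [h1]
    simp only [dotProduct, mulVec_diagonal]
    exact Finset.sum_congr rfl fun k _ => by ring
  have hgt : ∀ᶠ m in Filter.atTop,
      0 < d ⬝ᵥ ((Xᵀ * X) *ᵥ (‖b (φ m)‖⁻¹ • y - ‖b (φ m)‖⁻¹ • b (φ m))) := by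
    filter_upwards [hev] with m hm
    rw [heq]
    obtain ⟨k, hk⟩ := Function.ne_iff.1 hd0
    apply Finset.sum_pos'
    · intro i _
      by_cases hi : d i = 0
      · simp [hi]
      · exact (mul_pos (hds _ i) (hm i hi)).le
    · exact ⟨k, Finset.mem_univ _, mul_pos (hds _ k) (hm k hk)⟩
  have hquad : ∀ v, d ⬝ᵥ ((Xᵀ * X) *ᵥ v) = (X *ᵥ d) ⬝ᵥ (X *ᵥ v) := by
    intro v
    rw [← mulVec_mulVec, dotProduct_mulVec, vecMul_transpose]
  have hl : Filter.Tendsto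
      (fun m => d ⬝ᵥ ((Xᵀ * X) *ᵥ (‖b (φ m)‖⁻¹ • y - ‖b (φ m)‖⁻¹ • b (φ m)))) Filter.atTop
      (nhds (d ⬝ᵥ ((Xᵀ * X) *ᵥ ((0 : ℝ) • y - d)))) := by
    have hc : Continuous fun v : Fin p → ℝ => d ⬝ᵥ ((Xᵀ * X) *ᵥ v) := by fun_prop
    exact (hc.tendsto _).comp ((ht.smul_const y).sub hlim)
  have hge := ge_of_tendsto hl (hgt.mono fun m hm => hm.le)
  have hX : X *ᵥ d = 0 := by
    rw [hquad, zero_smul, zero_sub, mulVec_neg, dotProduct_neg] at hge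
    have h2 : 0 ≤ (X *ᵥ d) ⬝ᵥ (X *ᵥ d) := Finset.sum_nonneg fun i _ => mul_self_nonneg _
    exact dotProduct_self_eq_zero.1 (by linarith)
  obtain ⟨m, hm⟩ := hgt.exists
  rw [hquad, hX, zero_dotProduct] at hm
  exact lt_irrefl _ hm

/-- For arbitrary positive integers `n, p` and an arbitrary
matrix `X ∈ ℝ^{n×p}` there is a finite constant `C`, depending only on `X`,
such that for every diagonal matrix `Δ` with positive diagonal entries and all
indices `i, j`, `|eᵢᵀ (XᵀX + Δ)⁻¹ XᵀX eⱼ| < C`. -/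
theorem stmt4 (n p : ℕ) (hn : 0 < n) (hp : 0 < p)
    (X : Matrix (Fin n) (Fin p) ℝ) :
    ∃ C : ℝ, ∀ ds : Fin p → ℝ, (∀ j, 0 < ds j) →
      ∀ i j, |((X.transpose * X + Matrix.diagonal ds)⁻¹ * (X.transpose * X)) i j| < C := by
  choose C hC using fun j : Fin p => aux_bound X (Pi.single j 1)
  refine ⟨∑ j, |C j| + 1, fun ds hds i j => ?_⟩
  have hpd : (Xᵀ * X + Matrix.diagonal ds).PosDef := by
    have h1 : (Xᵀ * X).PosSemidef := by
      simpa using Matrix.posSemidef_conjTranspose_mul_self X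
    exact Matrix.PosDef.posSemidef_add h1 (Matrix.PosDef.diagonal hds)
  have hdet : IsUnit (Xᵀ * X + Matrix.diagonal ds).det := hpd.det_pos.ne'.isUnit
  have h := hC j ds hds
    (((Xᵀ * X + Matrix.diagonal ds)⁻¹ * (Xᵀ * X)) *ᵥ Pi.single j 1) (by
      rw [mulVec_mulVec, Matrix.mul_nonsing_inv_cancel_left _ _ hdet])
  have h2 := (norm_le_pi_norm _ i).trans h
  rw [mulVec_single_one, Real.norm_eq_abs] at h2
  have h3 : |C j| ≤ ∑ j, |C j| :=
    Finset.single_le_sum (f := fun j => |C j|) (fun _ _ => abs_nonneg _) (Finset.mem_univ j)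
  have h4 := le_abs_self (C j)
  simp only [Matrix.col_apply] at h2
  linarith
end

section
/- Let n and p be arbitrary positive integers, let X ∈ ℝ^{n×p} be an arbitrary matrix and let y ∈ ℝⁿ. Then there exists a finite constant C, depending only on X and y, such that for every diagonal matrix Δ ∈ ℝ^{p×p} with positive diagonal entries and every index 1 ≤ i ≤ p, |e_iᵀ (XᵀX + Δ)⁻¹ Xᵀ y| ≤ C, where e_i denotes the i-th standard basis vector of ℝ^p. -/
open Matrix

lemma bdd_preimage {p : ℕ} {F : Type*} [NormedAddCommGroup F] [NormedSpace ℝ F]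
    [FiniteDimensional ℝ F] (f : (Fin p → ℝ) →ₗ[ℝ] F) :
    ∃ K : ℝ, 0 ≤ K ∧ ∀ b, ∃ v, f v = f b ∧ ‖v‖ ≤ K * ‖f b‖ := by
  obtain ⟨g, hg⟩ := f.rangeRestrict.exists_rightInverse_of_surjective f.range_rangeRestrict
  refine ⟨‖LinearMap.toContinuousLinearMap g‖, ContinuousLinearMap.opNorm_nonneg _, fun b => ?_⟩
  refine ⟨g (f.rangeRestrict b), ?_, ?_⟩
  · have := LinearMap.congr_fun hg (f.rangeRestrict b)
    exact congrArg Subtype.val this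
  · exact (LinearMap.toContinuousLinearMap g).le_opNorm (f.rangeRestrict b)

/-- Vectors with bounded image whose positive rescaling is orthogonal to the kernel. -/
lemma bdd_coords {n p : ℕ} (X : Matrix (Fin n) (Fin p) ℝ) (R : ℝ) (m : ℕ) (hm : m ≤ p) :
    ∃ M : ℝ, ∀ b : Fin p → ℝ, ‖X *ᵥ b‖ ≤ R →
      (∃ d : Fin p → ℝ, (∀ j, 0 < d j) ∧ ∀ u, X *ᵥ u = 0 → ∑ j, d j * b j * u j = 0) →
      ∃ S : Finset (Fin p), S.card = m ∧ ∀ j ∈ S, |b j| ≤ M := by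
  induction m with
  | zero => exact ⟨0, fun b _ _ => ⟨∅, by simp, by simp⟩⟩
  | succ m ih =>
    obtain ⟨M, hM⟩ := ih (by omega)
    let f : Finset (Fin p) → (Fin p → ℝ) →ₗ[ℝ] ((Fin n → ℝ) × (Fin p → ℝ)) := fun S =>
      (Matrix.mulVecLin X).prod
        (Matrix.mulVecLin (Matrix.diagonal (fun j => if j ∈ S then (1 : ℝ) else 0)))
    choose K hK0 hK using fun S => bdd_preimage (f S)
    let L : ℝ := ∑ S, K S
    have hL0 : 0 ≤ L := Finset.sum_nonneg fun S _ => hK0 S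
    have hKL : ∀ S, K S ≤ L := fun S =>
      Finset.single_le_sum (f := K) (fun S _ => hK0 S) (Finset.mem_univ S)
    refine ⟨max M (L * max R (max M 0)), fun b hb hd => ?_⟩
    obtain ⟨S, hS, hSM⟩ := hM b hb hd
    obtain ⟨d, hd, hort⟩ := hd
    obtain ⟨v, hv, hvn⟩ := hK S b
    have h1 : X *ᵥ v = X *ᵥ b := congrArg Prod.fst hv
    have h2 : ∀ j ∈ S, v j = b j := by
      intro j hj
      have := congrFun (congrArg Prod.snd hv) j
      simpa [f, Matrix.mulVec_diagonal, hj] using this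
    have h3 : ‖f S b‖ ≤ max R (max M 0) := by
      rw [Prod.norm_def]
      refine max_le_max hb ?_
      rw [pi_norm_le_iff_of_nonneg (le_max_right _ _)]
      intro j
      by_cases hj : j ∈ S
      · simpa [f, Matrix.mulVec_diagonal, hj] using Or.inl (hSM j hj)
      · simp [f, Matrix.mulVec_diagonal, hj]
    have h4 : ‖v‖ ≤ L * max R (max M 0) :=
      hvn.trans (mul_le_mul (hKL S) h3 (norm_nonneg _) hL0)
    have h5 : ∃ j, j ∉ S ∧ |b j| ≤ L * max R (max M 0) := by
      by_contra! hcon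
      have hz := hort (b - v) (by rw [Matrix.mulVec_sub, h1, sub_self])
      have hpos : 0 < ∑ j, d j * b j * (b - v) j := by
        have key : ∀ j, j ∉ S → 0 < d j * b j * (b - v) j := by
          intro j hj
          have hb' : |v j| < |b j| := ((norm_le_pi_norm v j).trans h4).trans_lt (hcon j hj)
          have : 0 < b j * (b j - v j) := by
            have e1 : b j * v j ≤ |b j| * |v j| := by rw [← abs_mul]; exact le_abs_self _
            have e2 : |b j| * |b j| = b j * b j := abs_mul_abs_self _
            have e3 := abs_nonneg (v j)
            nlinarith
          rw [mul_assoc]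
          exact mul_pos (hd j) this
        obtain ⟨j, hj⟩ : ∃ j, j ∉ S := by
          by_contra! hall
          have : S = Finset.univ := Finset.eq_univ_iff_forall.2 hall
          rw [this, Finset.card_univ, Fintype.card_fin] at hS
          omega
        refine Finset.sum_pos' (fun i _ => ?_) ⟨j, Finset.mem_univ j, key j hj⟩
        by_cases hi : i ∈ S
        · simp [h2 i hi]
        · exact (key i hi).le
      exact hpos.ne' hz
    obtain ⟨j, hj, hjb⟩ := h5
    refine ⟨insert j S, by rw [Finset.card_insert_of_notMem hj, hS], fun i hi => ?_⟩
    rcases Finset.mem_insert.1 hi with rfl | hi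
    · exact hjb.trans (le_max_right _ _)
    · exact (hSM i hi).trans (le_max_left _ _)

/-- For arbitrary positive integers `n, p`, an arbitrary
matrix `X ∈ ℝ^{n×p}` and `y ∈ ℝⁿ`, there is a finite constant `C`, depending
only on `X` and `y`, such that for every diagonal matrix `Δ` with positive
diagonal entries and every index `i`, `|eᵢᵀ (XᵀX + Δ)⁻¹ Xᵀ y| ≤ C`. -/
theorem stmt5 (n p : ℕ) (hn : 0 < n) (hp : 0 < p)
    (X : Matrix (Fin n) (Fin p) ℝ) (y : Fin n → ℝ) :
    ∃ C : ℝ, ∀ ds : Fin p → ℝ, (∀ j, 0 < ds j) →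
      ∀ i, |((X.transpose * X + Matrix.diagonal ds)⁻¹.mulVec (X.transpose.mulVec y)) i| ≤ C := by
  have hy0 : 0 ≤ y ⬝ᵥ y := Finset.sum_nonneg fun i _ => mul_self_nonneg (y i)
  obtain ⟨M, hM⟩ := bdd_coords X (y ⬝ᵥ y + 1) p le_rfl
  refine ⟨M, fun ds hds i => ?_⟩
  have hpd : (Xᵀ * X + Matrix.diagonal ds).PosDef := by
    have h1 : (Xᵀ * X).PosSemidef := by
      simpa [Matrix.conjTranspose_eq_transpose_of_trivial] using
        Matrix.posSemidef_conjTranspose_mul_self X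
    exact Matrix.PosDef.posSemidef_add h1 (Matrix.PosDef.diagonal hds)
  set b := (Xᵀ * X + Matrix.diagonal ds)⁻¹ *ᵥ (Xᵀ *ᵥ y) with hb
  have hN : (Xᵀ * X + Matrix.diagonal ds) *ᵥ b = Xᵀ *ᵥ y := by
    rw [hb, Matrix.mulVec_mulVec, Matrix.mul_nonsing_inv _
      ((Matrix.isUnit_iff_isUnit_det _).1 hpd.isUnit), Matrix.one_mulVec]
  have hU : ∀ u, (X *ᵥ u) ⬝ᵥ (X *ᵥ b) + ∑ j, ds j * b j * u j = (X *ᵥ u) ⬝ᵥ y := by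
    intro u
    have := congrArg (fun w => u ⬝ᵥ w) hN
    simp only [Matrix.add_mulVec, dotProduct_add, ← Matrix.mulVec_mulVec] at this
    rw [Matrix.dotProduct_mulVec, Matrix.dotProduct_mulVec u Xᵀ y, Matrix.vecMul_transpose] at this
    rw [← this]
    congr 1
    simp only [dotProduct, Matrix.mulVec_diagonal]
    exact Finset.sum_congr rfl fun j _ => by ring
  obtain ⟨S, hS, hSM⟩ := hM b (by
    have h := hU b
    have hnn : 0 ≤ ∑ j, ds j * b j * b j := Finset.sum_nonneg fun j _ => by
      rw [mul_assoc]; exact mul_nonneg (hds j).le (mul_self_nonneg _)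
    have h2 : 0 ≤ (X *ᵥ b - y) ⬝ᵥ (X *ᵥ b - y) := Finset.sum_nonneg fun i _ => mul_self_nonneg _
    simp only [sub_dotProduct, dotProduct_sub, dotProduct_comm y (X *ᵥ b)] at h2
    rw [pi_norm_le_iff_of_nonneg (by linarith)]
    intro k
    have h3 : (X *ᵥ b) k * (X *ᵥ b) k ≤ (X *ᵥ b) ⬝ᵥ (X *ᵥ b) :=
      Finset.single_le_sum (f := fun i => (X *ᵥ b) i * (X *ᵥ b) i)
        (fun i _ => mul_self_nonneg _) (Finset.mem_univ k)
    have h4 : (X *ᵥ b) ⬝ᵥ (X *ᵥ b) ≤ y ⬝ᵥ y := by linarith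
    rw [Real.norm_eq_abs, abs_le]
    constructor <;> nlinarith [sq_nonneg ((X *ᵥ b) k - 1), sq_nonneg ((X *ᵥ b) k + 1)])
    ⟨ds, hds, fun u hu => by simpa [hu] using hU u⟩
  have : S = Finset.univ := by
    rw [← Finset.card_eq_iff_eq_univ, hS, Fintype.card_fin]
  exact hSM i (this ▸ Finset.mem_univ i)
end

section
/- Let X ∈ ℝ^{n×p}, y ∈ ℝⁿ, a > 0, b > 0 and δ > 0. Let π_τ be a probability density on (0,∞) with ∫₀^∞ t^{δ/2} π_τ(t) dt < ∞, and let ε > 0 satisfy ∫₀^ε π_τ(t) dt > 0. For a diagonal matrix Λ ∈ ℝ^{p×p} with positive diagonal entries and t > 0, set A(t,Λ) = XᵀX + (tΛ)⁻¹ and f_Λ(t) = (yᵀ(I_n − X A(t,Λ)⁻¹ Xᵀ)y/2 + b)^{−(a+n/2)} · det(I_p + t XᵀX Λ)^{−1/2} · π_τ(t). Then there exists a finite constant C₁, not depending on Λ, such that for every diagonal Λ with positive diagonal entries, ∫₀^∞ t^{δ/2} f_Λ(t) dt ≤ C₁ ∫₀^∞ f_Λ(t) dt. In fact one may take C₁ =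 ε^{δ/2} + (1 + yᵀy/b)^{a+n/2} · (∫₀^ε π_τ(t) dt)⁻¹ · ∫₀^∞ t^{δ/2} π_τ(t) dt. -/
open Matrix MeasureTheory

/-- The unnormalized conditional posterior density of the global shrinkage
parameter `τ² = t` given the squared local shrinkage parameters `lam` in the
Horseshoe model:
`f_Λ(t) = (yᵀ(I − X A(t,Λ)⁻¹ Xᵀ)y/2 + b)^{−(a+n/2)} det(I + t XᵀX Λ)^{−1/2} π_τ(t)`
with `A(t,Λ) = XᵀX + (tΛ)⁻¹`. -/
noncomputable def hsTauDens (n p : ℕ) (X : Matrix (Fin n) (Fin p) ℝ)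
    (y : Fin n → ℝ) (a b : ℝ) (πτ : ℝ → ℝ) (lam : Fin p → ℝ) (t : ℝ) : ℝ :=
  (y ⬝ᵥ ((1 - X * (X.transpose * X + (t • Matrix.diagonal lam)⁻¹)⁻¹
      * X.transpose).mulVec y) / 2 + b) ^ (-(a + (n : ℝ) / 2)) *
    ((1 + t • (X.transpose * X * Matrix.diagonal lam)).det) ^ (-(1 / 2 : ℝ)) *
    πτ t

/-- `det (1 + t S)` as a product over eigenvalues. -/
lemma hs_det_eq {n : ℕ} (S : Matrix (Fin n) (Fin n) ℝ) (hS : S.PosSemidef) (t : ℝ) :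
    (1 + t • S).det = ∏ i, (1 + t * hS.isHermitian.eigenvalues i) := by
  have h1 : (1 + t • S) = (hS.isHermitian.eigenvectorUnitary : Matrix (Fin n) (Fin n) ℝ) *
      (diagonal (fun i => 1 + t * hS.isHermitian.eigenvalues i)) *
      (star (hS.isHermitian.eigenvectorUnitary : Matrix (Fin n) (Fin n) ℝ)) := by
    have h2 : (diagonal (fun i => 1 + t * hS.isHermitian.eigenvalues i)) =
        1 + t • diagonal (hS.isHermitian.eigenvalues) := by
      rw [← diagonal_one, ← diagonal_smul, diagonal_add]
      rfl
    have h3 := hS.isHermitian.spectral_theorem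
    rw [Unitary.conjStarAlgAut_apply] at h3
    rw [h2, mul_add, add_mul, mul_one, mul_smul_comm, smul_mul_assoc,
      Unitary.mul_star_self_of_mem (SetLike.coe_mem _)]
    congr 2
  rw [h1, det_mul_right_comm, Unitary.mul_star_self_of_mem (SetLike.coe_mem _), one_mul, det_diagonal]

lemma hs_det_mono {n : ℕ} (S : Matrix (Fin n) (Fin n) ℝ) (hS : S.PosSemidef) {s t : ℝ}
    (hs : 0 ≤ s) (hst : s ≤ t) : (1 + s • S).det ≤ (1 + t • S).det := by
  rw [hs_det_eq S hS, hs_det_eq S hS]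
  apply Finset.prod_le_prod
  · intro i _
    have := hS.eigenvalues_nonneg i
    positivity
  · intro i _
    have := hS.eigenvalues_nonneg i
    gcongr

lemma hs_one_le_det {n : ℕ} (S : Matrix (Fin n) (Fin n) ℝ) (hS : S.PosSemidef) {t : ℝ}
    (ht : 0 ≤ t) : 1 ≤ (1 + t • S).det := by
  simpa using hs_det_mono S hS le_rfl ht

lemma hs_psd {n p : ℕ} (X : Matrix (Fin n) (Fin p) ℝ) (lam : Fin p → ℝ)
    (hl : ∀ j, 0 < lam j) : (X * diagonal lam * Xᵀ).PosSemidef := by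
  have := (PosSemidef.diagonal (d := lam) (fun j => (hl j).le)).mul_mul_conjTranspose_same X
  simpa using this

lemma hs_det_swap {n p : ℕ} (X : Matrix (Fin n) (Fin p) ℝ) (lam : Fin p → ℝ) (t : ℝ) :
    (1 + t • (Xᵀ * X * diagonal lam)).det = (1 + t • (X * diagonal lam * Xᵀ)).det := by
  have h := det_one_add_mul_comm (t • Xᵀ) (X * diagonal lam)
  simpa [Matrix.mul_assoc] using h

lemma hs_A_posDef {n p : ℕ} (X : Matrix (Fin n) (Fin p) ℝ) (lam : Fin p → ℝ)
    (hl : ∀ j, 0 < lam j) {t : ℝ} (ht : 0 < t) :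
    (Xᵀ * X + (t • diagonal lam)⁻¹).PosDef := by
  have h1 : (t • diagonal lam).PosDef := (PosDef.diagonal hl).smul ht
  have h2 : (Xᵀ * X).PosSemidef := by simpa using posSemidef_conjTranspose_mul_self X
  exact h1.inv.posSemidef_add h2

lemma hs_woodbury {n p : ℕ} (X : Matrix (Fin n) (Fin p) ℝ) (lam : Fin p → ℝ)
    (hl : ∀ j, 0 < lam j) {t : ℝ} (ht : 0 < t) :
    1 - X * (Xᵀ * X + (t • diagonal lam)⁻¹)⁻¹ * Xᵀ = (1 + t • (X * diagonal lam * Xᵀ))⁻¹ := by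
  have h1 : (t • diagonal lam).PosDef := (PosDef.diagonal hl).smul ht
  have hA := hs_A_posDef X lam hl ht
  have h := add_mul_mul_inv_eq_sub (1 : Matrix (Fin n) (Fin n) ℝ) X (t • diagonal lam) Xᵀ
    isUnit_one h1.isUnit (by simpa [add_comm] using hA.isUnit)
  simp only [inv_one, Matrix.mul_one, Matrix.one_mul] at h
  rw [add_comm (Xᵀ * X), ← h]
  simp

/-- The quadratic form. -/
noncomputable def hsQ {n p : ℕ} (X : Matrix (Fin n) (Fin p) ℝ) (y : Fin n → ℝ)
    (lam : Fin p → ℝ) (t : ℝ) : ℝ :=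
  y ⬝ᵥ ((1 - X * (Xᵀ * X + (t • Matrix.diagonal lam)⁻¹)⁻¹ * Xᵀ).mulVec y)

lemma hsQ_nonneg {n p : ℕ} (X : Matrix (Fin n) (Fin p) ℝ) (y : Fin n → ℝ) (lam : Fin p → ℝ)
    (hl : ∀ j, 0 < lam j) {t : ℝ} (ht : 0 < t) : 0 ≤ hsQ X y lam t := by
  rw [hsQ, hs_woodbury X lam hl ht]
  have h : (1 + t • (X * diagonal lam * Xᵀ)).PosSemidef :=
    PosSemidef.one.add ((hs_psd X lam hl).smul ht.le)
  simpa using h.inv.dotProduct_mulVec_nonneg y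

lemma hsQ_le {n p : ℕ} (X : Matrix (Fin n) (Fin p) ℝ) (y : Fin n → ℝ) (lam : Fin p → ℝ)
    (hl : ∀ j, 0 < lam j) {t : ℝ} (ht : 0 < t) : hsQ X y lam t ≤ y ⬝ᵥ y := by
  have h := ((hs_A_posDef X lam hl ht).inv.posSemidef.mul_mul_conjTranspose_same
    X).dotProduct_mulVec_nonneg y
  rw [hsQ, sub_mulVec, dotProduct_sub, one_mulVec]
  simpa using h

lemma hsQ_cont {n p : ℕ} (X : Matrix (Fin n) (Fin p) ℝ) (y : Fin n → ℝ) (lam : Fin p → ℝ)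
    (hl : ∀ j, 0 < lam j) : ContinuousOn (hsQ X y lam) (Set.Ioi 0) := by
  have hc : Continuous fun t : ℝ => (1 + t • (X * diagonal lam * Xᵀ)) := by fun_prop
  have hd : ContinuousOn (fun t : ℝ => ((1 + t • (X * diagonal lam * Xᵀ)).det)⁻¹ *
      (y ⬝ᵥ ((1 + t • (X * diagonal lam * Xᵀ)).adjugate.mulVec y))) (Set.Ioi 0) := by
    apply ContinuousOn.mul
    · apply ContinuousOn.inv₀ hc.matrix_det.continuousOn
      intro t ht
      have := hs_one_le_det _ (hs_psd X lam hl) (le_of_lt ht)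
      linarith
    · apply Continuous.continuousOn
      exact continuous_const.dotProduct (hc.matrix_adjugate.matrix_mulVec continuous_const)
  refine hd.congr ?_
  intro t ht
  rw [hsQ, hs_woodbury X lam hl ht, inv_def, smul_mulVec, dotProduct_smul]
  simp

/-- Under a finite prior `δ/2`-th moment for `τ²`, the
conditional posterior `δ/2`-th moment of `τ²` given the local shrinkage
parameters is bounded uniformly in `Λ`, with explicit constant
`C₁ = ε^{δ/2} + (1 + yᵀy/b)^{a+n/2} (∫₀^ε π_τ)⁻¹ ∫₀^∞ t^{δ/2} π_τ(t) dt`. -/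
theorem stmt6 (n p : ℕ) (X : Matrix (Fin n) (Fin p) ℝ) (y : Fin n → ℝ)
    (a b δ : ℝ) (ha : 0 < a) (hb : 0 < b) (hδ : 0 < δ)
    (πτ : ℝ → ℝ) (hπ_nonneg : ∀ t, 0 ≤ πτ t)
    (hπ_prob : ∫ t in Set.Ioi (0 : ℝ), πτ t = 1)
    (hπ_mom : IntegrableOn (fun t => t ^ (δ / 2) * πτ t) (Set.Ioi 0))
    (ε : ℝ) (hε : 0 < ε) (hεπ : 0 < ∫ t in Set.Ioo (0 : ℝ) ε, πτ t) :
    ∃ C₁ : ℝ,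
      C₁ = ε ^ (δ / 2) + (1 + y ⬝ᵥ y / b) ^ (a + (n : ℝ) / 2) *
        (∫ t in Set.Ioo (0 : ℝ) ε, πτ t)⁻¹ *
        (∫ t in Set.Ioi (0 : ℝ), t ^ (δ / 2) * πτ t) ∧
      ∀ lam : Fin p → ℝ, (∀ j, 0 < lam j) →
        (∫ t in Set.Ioi (0 : ℝ), t ^ (δ / 2) * hsTauDens n p X y a b πτ lam t) ≤
          C₁ * ∫ t in Set.Ioi (0 : ℝ), hsTauDens n p X y a b πτ lam t := by
  refine ⟨_, rfl, ?_⟩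
  intro lam hl
  set k : ℝ := a + (n : ℝ) / 2 with hk
  have hk0 : 0 < k := by positivity
  set S := X * diagonal lam * Xᵀ with hSdef
  have hS : S.PosSemidef := hs_psd X lam hl
  set D : ℝ → ℝ := fun t => (1 + t • S).det ^ (-(1 / 2 : ℝ)) with hD
  have hf : ∀ t, hsTauDens n p X y a b πτ lam t
      = (hsQ X y lam t / 2 + b) ^ (-k) * D t * πτ t := by
    intro t
    simp only [hsTauDens, hsQ, hD, hs_det_swap, hSdef, hk]
  have hyy : 0 ≤ y ⬝ᵥ y := by simpa using dotProduct_star_self_nonneg y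
  have hDpos : ∀ t, 0 ≤ t → 0 < D t := fun t ht =>
    Real.rpow_pos_of_pos (lt_of_lt_of_le one_pos (hs_one_le_det S hS ht)) _
  have hDanti : ∀ s t, 0 ≤ s → s ≤ t → D t ≤ D s := fun s t hs hst =>
    Real.rpow_le_rpow_of_nonpos (lt_of_lt_of_le one_pos (hs_one_le_det S hS hs))
      (hs_det_mono S hS hs hst) (by norm_num)
  have hDle : ∀ t, 0 ≤ t → D t ≤ 1 := by
    intro t ht
    simpa [hD] using hDanti 0 t le_rfl ht
  have hQle : ∀ t, 0 < t → (hsQ X y lam t / 2 + b) ^ (-k) ≤ b ^ (-k) := by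
    intro t ht
    have := hsQ_nonneg X y lam hl ht
    exact Real.rpow_le_rpow_of_nonpos hb (by linarith) (by linarith)
  have hQge : ∀ t, 0 < t → (y ⬝ᵥ y + b) ^ (-k) ≤ (hsQ X y lam t / 2 + b) ^ (-k) := by
    intro t ht
    have h0 := hsQ_nonneg X y lam hl ht
    have h1 := hsQ_le X y lam hl ht
    exact Real.rpow_le_rpow_of_nonpos (by linarith) (by linarith) (by linarith)
  have hQpos : ∀ t, 0 < t → 0 < (hsQ X y lam t / 2 + b) ^ (-k) := fun t ht =>
    lt_of_lt_of_le (Real.rpow_pos_of_pos (by linarith) _) (hQge t ht)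
  have hπi : IntegrableOn πτ (Set.Ioi 0) := by
    by_contra h
    rw [integral_undef h] at hπ_prob
    exact zero_ne_one hπ_prob
  have hb0 : 0 < b ^ (-k) := Real.rpow_pos_of_pos hb _
  have hfi : IntegrableOn (fun t => hsTauDens n p X y a b πτ lam t) (Set.Ioi 0) := by
    simp only [hf]
    have hcont : ContinuousOn (fun t => (hsQ X y lam t / 2 + b) ^ (-k) * D t) (Set.Ioi 0) := by
      apply ContinuousOn.mul
      · apply ContinuousOn.rpow_const
        · exact ((hsQ_cont X y lam hl).div_const _).add continuousOn_const
        · intro t ht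
          left
          have := hsQ_nonneg X y lam hl ht
          linarith
      · apply ContinuousOn.rpow_const
        · have hc : Continuous fun t : ℝ => (1 + t • S) := by fun_prop
          exact hc.matrix_det.continuousOn
        · intro t ht
          left
          have := hs_one_le_det S hS (le_of_lt ht)
          linarith
    refine Integrable.bdd_mul (c := b ^ (-k)) hπi
      (hcont.aestronglyMeasurable measurableSet_Ioi) ?_
    filter_upwards [ae_restrict_mem measurableSet_Ioi] with t ht
    have ht' : 0 < t := ht
    rw [Real.norm_of_nonneg (mul_nonneg (hQpos t ht').le (hDpos t ht'.le).le)]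
    calc _ ≤ b ^ (-k) * 1 := mul_le_mul (hQle t ht') (hDle t ht'.le) (hDpos t ht'.le).le hb0.le
      _ = _ := mul_one _
  have hfnn : ∀ t, 0 < t → 0 ≤ hsTauDens n p X y a b πτ lam t := by
    intro t ht
    rw [hf]
    exact mul_nonneg (mul_nonneg (hQpos t ht).le (hDpos t ht.le).le) (hπ_nonneg t)
  set M := ∫ t in Set.Ioi (0 : ℝ), t ^ (δ / 2) * πτ t with hM
  set P := ∫ t in Set.Ioo (0 : ℝ) ε, πτ t with hP
  set F := ∫ t in Set.Ioi (0 : ℝ), hsTauDens n p X y a b πτ lam t with hF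
  have hM0 : 0 ≤ M := setIntegral_nonneg measurableSet_Ioi fun t ht =>
    mul_nonneg (Real.rpow_nonneg (le_of_lt ht) _) (hπ_nonneg t)
  have hup : (∫ t in Set.Ioi (0 : ℝ), t ^ (δ / 2) * hsTauDens n p X y a b πτ lam t) ≤
      ε ^ (δ / 2) * F + b ^ (-k) * D ε * M := by
    rw [hF, hM, ← integral_const_mul, ← integral_const_mul,
      ← integral_add (hfi.const_mul _) (hπ_mom.const_mul _)]
    apply integral_mono_of_nonneg
    · filter_upwards [ae_restrict_mem measurableSet_Ioi] with t ht
      exact mul_nonneg (Real.rpow_nonneg (le_of_lt ht) _) (hfnn t ht)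
    · exact (hfi.const_mul _).add (hπ_mom.const_mul _)
    · filter_upwards [ae_restrict_mem measurableSet_Ioi] with t ht
      have ht' : 0 < t := ht
      have htp : 0 ≤ t ^ (δ / 2) := Real.rpow_nonneg ht'.le _
      have hεp : 0 ≤ ε ^ (δ / 2) := Real.rpow_nonneg hε.le _
      have hDε := (hDpos ε hε.le).le
      have hπt := hπ_nonneg t
      rcases le_total t ε with h | h
      · have h1 : t ^ (δ / 2) * hsTauDens n p X y a b πτ lam t ≤
            ε ^ (δ / 2) * hsTauDens n p X y a b πτ lam t :=
          mul_le_mul_of_nonneg_right (Real.rpow_le_rpow ht'.le h (by linarith)) (hfnn t ht')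
        have h2 : 0 ≤ b ^ (-k) * D ε * (t ^ (δ / 2) * πτ t) := by positivity
        linarith
      · have h1 : (hsQ X y lam t / 2 + b) ^ (-k) * D t ≤ b ^ (-k) * D ε :=
          mul_le_mul (hQle t ht') (hDanti ε t hε.le h) (hDpos t ht'.le).le hb0.le
        have h2 : t ^ (δ / 2) * hsTauDens n p X y a b πτ lam t ≤
            b ^ (-k) * D ε * (t ^ (δ / 2) * πτ t) := by
          rw [hf]
          calc _ = ((hsQ X y lam t / 2 + b) ^ (-k) * D t) * (t ^ (δ / 2) * πτ t) := by ring
            _ ≤ _ := mul_le_mul_of_nonneg_right h1 (by positivity)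
        have h3 := mul_nonneg hεp (hfnn t ht')
        linarith
  have hlow : (y ⬝ᵥ y + b) ^ (-k) * D ε * P ≤ F := by
    have hsub : Set.Ioo (0 : ℝ) ε ⊆ Set.Ioi 0 := fun t ht => ht.1
    calc (y ⬝ᵥ y + b) ^ (-k) * D ε * P
        = ∫ t in Set.Ioo (0 : ℝ) ε, (y ⬝ᵥ y + b) ^ (-k) * D ε * πτ t := by
          rw [hP, integral_const_mul]
      _ ≤ ∫ t in Set.Ioo (0 : ℝ) ε, hsTauDens n p X y a b πτ lam t := by
          apply setIntegral_mono_on ((hπi.mono_set hsub).const_mul _) (hfi.mono_set hsub)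
            measurableSet_Ioo
          intro t ht
          rw [hf]
          exact mul_le_mul_of_nonneg_right (mul_le_mul (hQge t ht.1)
            (hDanti t ε ht.1.le ht.2.le) (hDpos ε hε.le).le (hQpos t ht.1).le) (hπ_nonneg t)
      _ ≤ F := by
          apply setIntegral_mono_set hfi
          · filter_upwards [ae_restrict_mem measurableSet_Ioi] with t ht
            exact hfnn t ht
          · exact Filter.Eventually.of_forall hsub
  have hR : (1 + y ⬝ᵥ y / b) ^ k * (y ⬝ᵥ y + b) ^ (-k) = b ^ (-k) := by
    have h1 : 1 + y ⬝ᵥ y / b = (y ⬝ᵥ y + b) / b := by field_simp; ring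
    have hpos : 0 < y ⬝ᵥ y + b := by linarith
    have := (Real.rpow_pos_of_pos hpos k).ne'
    rw [h1, Real.div_rpow hpos.le hb.le, Real.rpow_neg hpos.le, Real.rpow_neg hb.le]
    field_simp
  have hR0 : 0 ≤ (1 + y ⬝ᵥ y / b) ^ k := Real.rpow_nonneg (by positivity) _
  have hfin : b ^ (-k) * D ε * M ≤ (1 + y ⬝ᵥ y / b) ^ k * P⁻¹ * M * F := by
    calc b ^ (-k) * D ε * M
        = (1 + y ⬝ᵥ y / b) ^ k * P⁻¹ * M * ((y ⬝ᵥ y + b) ^ (-k) * D ε * P) := by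
          rw [← hR]
          field_simp
      _ ≤ _ := mul_le_mul_of_nonneg_left hlow
          (mul_nonneg (mul_nonneg hR0 (inv_nonneg.mpr hεπ.le)) hM0)
  rw [add_mul]
  linarith
end

section
/- Let X ∈ ℝ^{n×p}, y ∈ ℝⁿ, a > 0, b > 0 and δ > 0. Let π_τ be a probability density on (0,∞) with ∫₀^∞ t^{−(p+δ)/2} π_τ(t) dt < ∞, and let ε > 0 satisfy ∫_ε^∞ t^{−p/2} π_τ(t) dt > 0. For a diagonal matrix Λ ∈ ℝ^{p×p} with positive diagonal entries and t > 0, set A(t,Λ) = XᵀX + (tΛ)⁻¹ and f_Λ(t) = (yᵀ(I_n − X A(t,Λ)⁻¹ Xᵀ)y/2 + b)^{−(a+n/2)} · det(I_p + t XᵀX Λ)^{−1/2} · π_τ(t). Then there exists a finite constant C̃₁, not depending on Λ, such that for every diagonal Λ with positive diagonal entries, ∫₀^∞ t^{−δ/2} f_Λ(t) dt ≤ C̃₁ ∫₀^∞ f_Λ(t) dt. In fact one may take C̃₁ = ε^{−δ/2} + (1 + yᵀy/b)^{a+n/2} · (∫_ε^∞ t^{−p/2} π_τ(t) dt)⁻¹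 · ∫₀^ε t^{−(p+δ)/2} π_τ(t) dt. -/
open Matrix MeasureTheory

lemma aux_det_prod {p : ℕ} (G : Matrix (Fin p) (Fin p) ℝ) (hG : G.PosSemidef) :
    ∃ μ : Fin p → ℝ, (∀ i, 0 ≤ μ i) ∧ ∀ t : ℝ, (1 + t • G).det = ∏ i, (1 + t * μ i) := by
  refine ⟨hG.isHermitian.eigenvalues, hG.eigenvalues_nonneg, fun t => ?_⟩
  have h := hG.isHermitian.spectral_theorem
  rw [Unitary.conjStarAlgAut_apply] at h
  conv_lhs => rw [h]
  rw [← Matrix.smul_mul, Matrix.det_one_add_mul_comm, Matrix.mul_smul, ← Matrix.mul_assoc,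
    Unitary.coe_star_mul_self, Matrix.one_mul, ← Matrix.diagonal_smul, ← Matrix.diagonal_one,
    Matrix.diagonal_add, Matrix.det_diagonal]
  simp

lemma aux_det {n p : ℕ} (X : Matrix (Fin n) (Fin p) ℝ) (lam : Fin p → ℝ) (hl : ∀ j, 0 < lam j) :
    ∃ μ : Fin p → ℝ, (∀ i, 0 ≤ μ i) ∧
      ∀ t : ℝ, (1 + t • (X.transpose * X * Matrix.diagonal lam)).det = ∏ i, (1 + t * μ i) := by
  set S : Matrix (Fin p) (Fin p) ℝ := Matrix.diagonal (fun j => Real.sqrt (lam j)) with hS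
  have hSS : Matrix.diagonal lam = S * S := by
    rw [hS, Matrix.diagonal_mul_diagonal]
    congr 1; ext j; exact (Real.mul_self_sqrt (hl j).le).symm
  have hpsd : ((X * S)ᴴ * (X * S)).PosSemidef := Matrix.posSemidef_conjTranspose_mul_self _
  obtain ⟨μ, h0, h⟩ := aux_det_prod _ hpsd
  refine ⟨μ, h0, fun t => ?_⟩
  rw [← h t, hSS]
  have e1 : t • (Xᵀ * X * (S * S)) = (t • (Xᵀ * X * S)) * S := by
    simp [Matrix.mul_assoc]
  have e2 : t • ((X * S)ᴴ * (X * S)) = S * (t • (Xᵀ * X * S)) := by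
    have : Sᴴ = S := by simp [hS]
    rw [Matrix.conjTranspose_mul, this, Matrix.conjTranspose_eq_transpose_of_trivial]
    simp [Matrix.mul_assoc]
  rw [e1, e2, Matrix.det_one_add_mul_comm]

lemma aux_smul_inv {p : ℕ} (lam : Fin p → ℝ) (hl : ∀ j, 0 < lam j) (t : ℝ) (ht : 0 < t) :
    (t • Matrix.diagonal lam)⁻¹ = t⁻¹ • Matrix.diagonal (fun j => (lam j)⁻¹) := by
  apply Matrix.inv_eq_right_inv
  rw [Matrix.smul_mul, Matrix.mul_smul, smul_smul, mul_inv_cancel₀ ht.ne', one_smul,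
    Matrix.diagonal_mul_diagonal]
  ext i j
  by_cases h : i = j
  · subst h; simp [(hl i).ne']
  · simp [h]

lemma aux_posDef {n p : ℕ} (X : Matrix (Fin n) (Fin p) ℝ) (lam : Fin p → ℝ)
    (hl : ∀ j, 0 < lam j) (t : ℝ) (ht : 0 < t) :
    (t⁻¹ • Matrix.diagonal (fun j => (lam j)⁻¹)).PosDef ∧
    (X.transpose * X + t⁻¹ • Matrix.diagonal (fun j => (lam j)⁻¹)).PosDef := by
  have h1 : (t⁻¹ • Matrix.diagonal (fun j => (lam j)⁻¹)).PosDef := by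
    rw [← Matrix.diagonal_smul]
    apply Matrix.PosDef.diagonal
    intro j
    have := hl j
    simp only [Pi.smul_apply, smul_eq_mul]
    positivity
  refine ⟨h1, ?_⟩
  have h2 := Matrix.posSemidef_conjTranspose_mul_self X
  rw [Matrix.conjTranspose_eq_transpose_of_trivial] at h2
  exact Matrix.PosDef.posSemidef_add h2 h1

lemma aux_q {n p : ℕ} (X : Matrix (Fin n) (Fin p) ℝ) (y : Fin n → ℝ) (lam : Fin p → ℝ)
    (hl : ∀ j, 0 < lam j) (t : ℝ) (ht : 0 < t) :
    0 ≤ y ⬝ᵥ ((1 - X * (X.transpose * X + (t • Matrix.diagonal lam)⁻¹)⁻¹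
      * X.transpose).mulVec y) ∧
    y ⬝ᵥ ((1 - X * (X.transpose * X + (t • Matrix.diagonal lam)⁻¹)⁻¹
      * X.transpose).mulVec y) ≤ y ⬝ᵥ y := by
  rw [aux_smul_inv lam hl t ht]
  obtain ⟨hB, hA⟩ := aux_posDef X lam hl t ht
  set B := t⁻¹ • Matrix.diagonal (fun j => (lam j)⁻¹)
  set A := Xᵀ * X + B with hAdef
  set w := A⁻¹ *ᵥ (Xᵀ *ᵥ y) with hw
  have hAw : A *ᵥ w = Xᵀ *ᵥ y := by
    rw [hw, Matrix.mulVec_mulVec, Matrix.mul_nonsing_inv _ ((Matrix.isUnit_iff_isUnit_det _).1 hA.isUnit),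
      Matrix.one_mulVec]
  have hq : y ⬝ᵥ ((1 - X * A⁻¹ * Xᵀ) *ᵥ y) = y ⬝ᵥ y - y ⬝ᵥ (X *ᵥ w) := by
    rw [Matrix.sub_mulVec, Matrix.one_mulVec, dotProduct_sub, hw, Matrix.mulVec_mulVec,
      Matrix.mulVec_mulVec, Matrix.mul_assoc]
  have h1 : y ⬝ᵥ (X *ᵥ w) = w ⬝ᵥ (A *ᵥ w) := by
    rw [hAw, Matrix.dotProduct_mulVec, ← Matrix.mulVec_transpose, dotProduct_comm]
  have h2 : w ⬝ᵥ (A *ᵥ w) = (X *ᵥ w) ⬝ᵥ (X *ᵥ w) + w ⬝ᵥ (B *ᵥ w) := by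
    rw [hAdef, Matrix.add_mulVec, dotProduct_add, ← Matrix.mulVec_mulVec,
      Matrix.dotProduct_mulVec w, Matrix.vecMul_transpose]
  have h3 : 0 ≤ w ⬝ᵥ (B *ᵥ w) := by simpa using hB.posSemidef.dotProduct_mulVec_nonneg w
  have h4 : 0 ≤ (X *ᵥ w) ⬝ᵥ (X *ᵥ w) := by
    simpa using dotProduct_star_self_nonneg (X *ᵥ w)
  have h5 : 0 ≤ (y - X *ᵥ w) ⬝ᵥ (y - X *ᵥ w) := by
    simpa using dotProduct_star_self_nonneg (y - X *ᵥ w)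
  rw [sub_dotProduct, dotProduct_sub, dotProduct_sub, dotProduct_comm (X *ᵥ w) y] at h5
  rw [hq]
  constructor <;> linarith

lemma aux_cont {n p : ℕ} (X : Matrix (Fin n) (Fin p) ℝ) (y : Fin n → ℝ) (lam : Fin p → ℝ)
    (hl : ∀ j, 0 < lam j) :
    ContinuousOn (fun t : ℝ => y ⬝ᵥ ((1 - X * (X.transpose * X + (t • Matrix.diagonal lam)⁻¹)⁻¹
      * X.transpose).mulVec y)) (Set.Ioi 0) := by
  have hA : ContinuousOn (fun t : ℝ => X.transpose * X + t⁻¹ • Matrix.diagonal (fun j => (lam j)⁻¹))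
      (Set.Ioi 0) := by
    have hs : ContinuousOn (fun t : ℝ => t⁻¹) (Set.Ioi 0) :=
      continuousOn_inv₀.mono (fun t ht => ne_of_gt ht)
    have hc : Continuous (fun s : ℝ => X.transpose * X + s • Matrix.diagonal (fun j => (lam j)⁻¹)) := by
      fun_prop
    exact hc.comp_continuousOn hs
  have hdet : ContinuousOn (fun t : ℝ =>
      (X.transpose * X + t⁻¹ • Matrix.diagonal (fun j => (lam j)⁻¹)).det) (Set.Ioi 0) :=
    (continuous_id.matrix_det).comp_continuousOn hA
  have hadj : ContinuousOn (fun t : ℝ =>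
      (X.transpose * X + t⁻¹ • Matrix.diagonal (fun j => (lam j)⁻¹)).adjugate) (Set.Ioi 0) :=
    (continuous_id.matrix_adjugate).comp_continuousOn hA
  have hdi := hdet.inv₀ (fun t ht => (aux_posDef X lam hl t ht).2.det_pos.ne')
  have hinv := hdi.smul hadj
  have hF : Continuous (fun M : Matrix (Fin p) (Fin p) ℝ =>
      y ⬝ᵥ ((1 - X * M * X.transpose).mulVec y)) := by fun_prop
  refine (hF.comp_continuousOn hinv).congr (fun t ht => ?_)
  simp only [Function.comp]
  rw [aux_smul_inv lam hl t ht, Matrix.inv_def, Ring.inverse_eq_inv']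
  rfl

lemma aux_mono {p : ℕ} (μ : Fin p → ℝ) (h0 : ∀ i, 0 ≤ μ i) (s t : ℝ) (hs : 0 < s) (hst : s ≤ t) :
    s ^ ((p : ℝ) / 2) * (∏ i, (1 + s * μ i)) ^ (-(1 / 2 : ℝ)) ≤
      t ^ ((p : ℝ) / 2) * (∏ i, (1 + t * μ i)) ^ (-(1 / 2 : ℝ)) := by
  have key : ∀ u : ℝ, 0 < u → 0 < ∏ i, (u⁻¹ + μ i) ∧
      u ^ ((p : ℝ) / 2) * (∏ i, (1 + u * μ i)) ^ (-(1 / 2 : ℝ)) =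
        (∏ i, (u⁻¹ + μ i)) ^ (-(1 / 2 : ℝ)) := by
    intro u hu
    have hpos : 0 < ∏ i, (u⁻¹ + μ i) :=
      Finset.prod_pos fun i _ => add_pos_of_pos_of_nonneg (inv_pos.2 hu) (h0 i)
    refine ⟨hpos, ?_⟩
    have e : ∏ i, (1 + u * μ i) = u ^ (p : ℝ) * ∏ i, (u⁻¹ + μ i) := by
      rw [Real.rpow_natCast]
      have : u ^ p = ∏ _i : Fin p, u := by simp
      rw [this, ← Finset.prod_mul_distrib]
      refine Finset.prod_congr rfl fun i _ => ?_
      field_simp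
    rw [e, Real.mul_rpow (by positivity) hpos.le, ← Real.rpow_mul hu.le, ← mul_assoc,
      ← Real.rpow_add hu]
    have : (p : ℝ) / 2 + p * -(1 / 2) = 0 := by ring
    rw [this, Real.rpow_zero, one_mul]
  have ht := hs.trans_le hst
  rw [(key s hs).2, (key t ht).2]
  apply Real.rpow_le_rpow_of_nonpos (key t ht).1 _ (by norm_num)
  refine Finset.prod_le_prod (fun i _ => add_nonneg (inv_nonneg.2 ht.le) (h0 i)) fun i _ => ?_
  have := inv_anti₀ hs hst
  linarith

/-- Under a finite prior negative `(p+δ)/2`-th moment for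
`τ²`, the conditional posterior negative `δ/2`-th moment of `τ²` given the
local shrinkage parameters is bounded uniformly in `Λ`, with explicit constant
`C̃₁ = ε^{−δ/2} + (1 + yᵀy/b)^{a+n/2} (∫_ε^∞ t^{−p/2} π_τ)⁻¹ ∫₀^ε t^{−(p+δ)/2} π_τ(t) dt`. -/
theorem stmt7 (n p : ℕ) (X : Matrix (Fin n) (Fin p) ℝ) (y : Fin n → ℝ)
    (a b δ : ℝ) (ha : 0 < a) (hb : 0 < b) (hδ : 0 < δ)
    (πτ : ℝ → ℝ) (hπ_nonneg : ∀ t, 0 ≤ πτ t)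
    (hπ_prob : ∫ t in Set.Ioi (0 : ℝ), πτ t = 1)
    (hπ_mom : IntegrableOn (fun t => t ^ (-((p : ℝ) + δ) / 2) * πτ t) (Set.Ioi 0))
    (ε : ℝ) (hε : 0 < ε)
    (hεπ : 0 < ∫ t in Set.Ioi ε, t ^ (-(p : ℝ) / 2) * πτ t) :
    ∃ C₁ : ℝ,
      C₁ = ε ^ (-δ / 2) + (1 + y ⬝ᵥ y / b) ^ (a + (n : ℝ) / 2) *
        (∫ t in Set.Ioi ε, t ^ (-(p : ℝ) / 2) * πτ t)⁻¹ *
        (∫ t in Set.Ioo (0 : ℝ) ε, t ^ (-((p : ℝ) + δ) / 2) * πτ t) ∧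
      ∀ lam : Fin p → ℝ, (∀ j, 0 < lam j) →
        (∫ t in Set.Ioi (0 : ℝ), t ^ (-δ / 2) * hsTauDens n p X y a b πτ lam t) ≤
          C₁ * ∫ t in Set.Ioi (0 : ℝ), hsTauDens n p X y a b πτ lam t := by
  refine ⟨_, rfl, fun lam hl => ?_⟩
  obtain ⟨μ, hμ, hdet⟩ := aux_det X lam hl
  set k : ℝ := a + (n : ℝ) / 2 with hk
  have hk0 : 0 < k := by positivity
  have hyy : 0 ≤ y ⬝ᵥ y := by simpa using dotProduct_star_self_nonneg y
  set f := hsTauDens n p X y a b πτ lam with hf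
  set q : ℝ → ℝ := fun t => y ⬝ᵥ ((1 - X * (X.transpose * X + (t • Matrix.diagonal lam)⁻¹)⁻¹
      * X.transpose).mulVec y) with hqdef
  set d : ℝ → ℝ := fun t => (∏ i, (1 + t * μ i)) ^ (-(1 / 2 : ℝ)) with hd
  have hfe : ∀ t, f t = (q t / 2 + b) ^ (-k) * d t * πτ t := by
    intro t
    simp only [hf, hsTauDens, hdet, hqdef, hd, hk]
  have hD1 : ∀ t, 0 < t → 1 ≤ ∏ i, (1 + t * μ i) := by
    intro t ht
    have h1 : (1 : ℝ) = ∏ _i : Fin p, (1 : ℝ) := by simp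
    refine h1.le.trans (Finset.prod_le_prod (fun _ _ => zero_le_one) fun i _ => ?_)
    have := mul_nonneg ht.le (hμ i)
    linarith
  have hd0 : ∀ t, 0 < t → 0 < d t := fun t ht =>
    Real.rpow_pos_of_pos (zero_lt_one.trans_le (hD1 t ht)) _
  have hd1 : ∀ t, 0 < t → d t ≤ 1 := fun t ht =>
    Real.rpow_le_one_of_one_le_of_nonpos (hD1 t ht) (by norm_num)
  have hgu : ∀ t, 0 < t → (q t / 2 + b) ^ (-k) ≤ b ^ (-k) := fun t ht => by
    have := (aux_q X y lam hl t ht).1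
    exact Real.rpow_le_rpow_of_nonpos hb (by simp only [hqdef]; linarith) (by linarith)
  have hgl : ∀ t, 0 < t → (y ⬝ᵥ y + b) ^ (-k) ≤ (q t / 2 + b) ^ (-k) := fun t ht => by
    have h1 := (aux_q X y lam hl t ht).1
    have h2 := (aux_q X y lam hl t ht).2
    exact Real.rpow_le_rpow_of_nonpos (by simp only [hqdef]; linarith)
      (by simp only [hqdef]; linarith) (by linarith)
  have hL0 : 0 < (y ⬝ᵥ y + b) ^ (-k) := Real.rpow_pos_of_pos (by linarith) _
  have hB0 : 0 < b ^ (-k) := Real.rpow_pos_of_pos hb _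
  have hg0 : ∀ t, 0 < t → 0 < (q t / 2 + b) ^ (-k) := fun t ht => hL0.trans_le (hgl t ht)
  have hf0 : ∀ t, 0 < t → 0 ≤ f t := fun t ht => by
    rw [hfe]
    exact mul_nonneg (mul_nonneg (hg0 t ht).le (hd0 t ht).le) (hπ_nonneg t)
  have hπint : IntegrableOn πτ (Set.Ioi 0) := by
    by_contra h
    rw [integral_undef h] at hπ_prob
    exact zero_ne_one hπ_prob
  have hfint : IntegrableOn f (Set.Ioi 0) := by
    have hqc : ContinuousOn q (Set.Ioi 0) := aux_cont X y lam hl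
    have hgc : ContinuousOn (fun t => (q t / 2 + b) ^ (-k)) (Set.Ioi 0) := by
      refine ContinuousOn.rpow_const ((hqc.div_const 2).add continuousOn_const) fun t ht => ?_
      have := (aux_q X y lam hl t ht).1
      left
      simp only [hqdef]
      show _ / 2 + b ≠ 0
      linarith
    have hdc : ContinuousOn d (Set.Ioi 0) := by
      refine ContinuousOn.rpow_const (Continuous.continuousOn (by fun_prop)) fun t ht => ?_
      exact Or.inl (zero_lt_one.trans_le (hD1 t ht)).ne'
    have hmeas : AEStronglyMeasurable f (volume.restrict (Set.Ioi 0)) := by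
      have := ((hgc.mul hdc).aestronglyMeasurable (μ := volume) measurableSet_Ioi).mul hπint.1
      refine this.congr (Filter.Eventually.of_forall fun t => ?_)
      rw [hfe]; rfl
    refine (hπint.const_mul (b ^ (-k))).mono' hmeas ?_
    refine (ae_restrict_mem measurableSet_Ioi).mono fun t (ht : 0 < t) => ?_
    rw [Real.norm_of_nonneg (hf0 t ht), hfe]
    refine mul_le_mul_of_nonneg_right ?_ (hπ_nonneg t)
    calc _ ≤ b ^ (-k) * 1 := mul_le_mul (hgu t ht) (hd1 t ht) (hd0 t ht).le hB0.le
      _ = _ := mul_one _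
  set H : ℝ := ε ^ ((p : ℝ) / 2) * d ε with hH
  have hH0 : 0 < H := mul_pos (Real.rpow_pos_of_pos hε _) (hd0 ε hε)
  have hdH : ∀ t, 0 < t → d t = t ^ (-(p : ℝ) / 2) * (t ^ ((p : ℝ) / 2) * d t) := fun t ht => by
    rw [← mul_assoc, ← Real.rpow_add ht]
    have : -(p : ℝ) / 2 + p / 2 = 0 := by ring
    rw [this, Real.rpow_zero, one_mul]
  set I := ∫ t in Set.Ioi ε, t ^ (-(p : ℝ) / 2) * πτ t with hI
  set M := ∫ t in Set.Ioo (0 : ℝ) ε, t ^ (-((p : ℝ) + δ) / 2) * πτ t with hM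
  set F := ∫ t in Set.Ioi (0 : ℝ), f t with hF
  have hM0 : 0 ≤ M := setIntegral_nonneg measurableSet_Ioo fun t ht =>
    mul_nonneg (Real.rpow_nonneg ht.1.le _) (hπ_nonneg t)
  -- lower bound of the normalizing integral
  have hlow : (y ⬝ᵥ y + b) ^ (-k) * H * I ≤ F := by
    have hsub : Set.Ioi ε ⊆ Set.Ioi 0 := fun t ht => hε.trans ht
    have h1 : (y ⬝ᵥ y + b) ^ (-k) * H * I ≤ ∫ t in Set.Ioi ε, f t := by
      rw [hI, ← integral_const_mul]
      refine integral_mono_of_nonneg ?_ (hfint.mono_set hsub) ?_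
      · refine (ae_restrict_mem measurableSet_Ioi).mono fun t ht => ?_
        have ht0 : 0 < t := hε.trans ht
        exact mul_nonneg (mul_pos hL0 hH0).le
          (mul_nonneg (Real.rpow_nonneg ht0.le _) (hπ_nonneg t))
      · refine (ae_restrict_mem measurableSet_Ioi).mono fun t ht => ?_
        have ht0 : 0 < t := hε.trans ht
        have hm : H ≤ t ^ ((p : ℝ) / 2) * d t := aux_mono μ hμ ε t hε (le_of_lt ht)
        have h2 : H * t ^ (-(p : ℝ) / 2) ≤ d t := by
          rw [hdH t ht0, mul_comm]
          exact mul_le_mul_of_nonneg_left hm (Real.rpow_nonneg ht0.le _)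
        have h3 := mul_le_mul (hgl t ht0) h2
          (mul_nonneg hH0.le (Real.rpow_nonneg ht0.le _)) (hg0 t ht0).le
        have h4 := mul_le_mul_of_nonneg_right h3 (hπ_nonneg t)
        show (y ⬝ᵥ y + b) ^ (-k) * H * (t ^ (-(p : ℝ) / 2) * πτ t) ≤ f t
        rw [hfe]
        calc _ = (y ⬝ᵥ y + b) ^ (-k) * (H * t ^ (-(p : ℝ) / 2)) * πτ t := by ring
          _ ≤ _ := h4
    refine h1.trans (setIntegral_mono_set hfint ?_ hsub.eventuallyLE)
    exact (ae_restrict_mem measurableSet_Ioi).mono fun t ht => hf0 t ht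
  -- upper bound of the numerator
  set m : ℝ → ℝ := fun t => t ^ (-((p : ℝ) + δ) / 2) * πτ t with hm
  have hmint : IntegrableOn ((Set.Ioo 0 ε).indicator m) (Set.Ioi 0) :=
    Integrable.indicator hπ_mom measurableSet_Ioo
  have hup : (∫ t in Set.Ioi (0 : ℝ), t ^ (-δ / 2) * f t) ≤
      ε ^ (-δ / 2) * F + b ^ (-k) * H * M := by
    have e1 : ε ^ (-δ / 2) * F + b ^ (-k) * H * M = ∫ t in Set.Ioi (0 : ℝ),
        (ε ^ (-δ / 2) * f t + b ^ (-k) * H * (Set.Ioo 0 ε).indicator m t) := by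
      rw [integral_add (hfint.const_mul _) (hmint.const_mul _), integral_const_mul,
        integral_const_mul, setIntegral_indicator measurableSet_Ioo,
        Set.inter_eq_right.2 (show Set.Ioo 0 ε ⊆ Set.Ioi 0 from fun t ht => ht.1)]
    rw [e1]
    refine integral_mono_of_nonneg ?_ ((hfint.const_mul _).add (hmint.const_mul _)) ?_
    · exact (ae_restrict_mem measurableSet_Ioi).mono fun t (ht : 0 < t) =>
        mul_nonneg (Real.rpow_nonneg ht.le _) (hf0 t ht)
    · refine (ae_restrict_mem measurableSet_Ioi).mono fun t (ht : 0 < t) => ?_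
      show t ^ (-δ / 2) * f t ≤ ε ^ (-δ / 2) * f t + b ^ (-k) * H * (Set.Ioo 0 ε).indicator m t
      by_cases hte : t < ε
      · rw [Set.indicator_of_mem (show t ∈ Set.Ioo 0 ε from ⟨ht, hte⟩)]
        have h1 : 0 ≤ ε ^ (-δ / 2) * f t := mul_nonneg (Real.rpow_nonneg hε.le _) (hf0 t ht)
        have hmo : t ^ ((p : ℝ) / 2) * d t ≤ H := aux_mono μ hμ t ε ht hte.le
        have h2 : d t ≤ t ^ (-(p : ℝ) / 2) * H := by
          rw [hdH t ht]
          exact mul_le_mul_of_nonneg_left hmo (Real.rpow_nonneg ht.le _)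
        have h3 := mul_le_mul (hgu t ht) h2 (hd0 t ht).le hB0.le
        have h4 := mul_le_mul_of_nonneg_left (mul_le_mul_of_nonneg_right h3 (hπ_nonneg t))
          (Real.rpow_nonneg ht.le (-δ / 2))
        rw [← hfe] at h4
        have e2 : t ^ (-((p : ℝ) + δ) / 2) = t ^ (-δ / 2) * t ^ (-(p : ℝ) / 2) := by
          rw [← Real.rpow_add ht]
          congr 1; ring
        have e3 : b ^ (-k) * H * m t =
            t ^ (-δ / 2) * (b ^ (-k) * (t ^ (-(p : ℝ) / 2) * H) * πτ t) := by
          simp only [hm]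
          rw [e2]; ring
        rw [e3]
        linarith
      · have : t ∉ Set.Ioo 0 ε := fun h => hte h.2
        rw [Set.indicator_of_notMem this, mul_zero, add_zero]
        exact mul_le_mul_of_nonneg_right
          (Real.rpow_le_rpow_of_nonpos hε (not_lt.1 hte) (by linarith)) (hf0 t ht)
  refine hup.trans ?_
  rw [add_mul]
  refine add_le_add le_rfl ?_
  have hratio : b ^ (-k) = (1 + y ⬝ᵥ y / b) ^ k * (y ⬝ᵥ y + b) ^ (-k) := by
    have hyb : 0 < y ⬝ᵥ y + b := by linarith
    have : 1 + y ⬝ᵥ y / b = (y ⬝ᵥ y + b) / b := by field_simp; ring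
    rw [this, Real.div_rpow hyb.le hb.le, Real.rpow_neg hb.le, Real.rpow_neg hyb.le]
    have := (Real.rpow_pos_of_pos hyb k).ne'
    have := (Real.rpow_pos_of_pos hb k).ne'
    field_simp
  have hR0 : 0 ≤ (1 + y ⬝ᵥ y / b) ^ k := by positivity
  have hc : 0 ≤ (1 + y ⬝ᵥ y / b) ^ k * I⁻¹ * M :=
    mul_nonneg (mul_nonneg hR0 (inv_pos.2 hεπ).le) hM0
  calc b ^ (-k) * H * M
      = (1 + y ⬝ᵥ y / b) ^ k * I⁻¹ * M * ((y ⬝ᵥ y + b) ^ (-k) * H * I) := by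
        rw [hratio]
        have := hεπ.ne'
        field_simp
    _ ≤ _ := mul_le_mul_of_nonneg_left hlow hc
end

section
/- Let X ∈ ℝ^{n×p}, y ∈ ℝⁿ, a > 0, b > 0, δ > 0 and c ≠ 0. Let π_τ be a probability density on (0,∞) with ∫₀^∞ t^{δ/2} π_τ(t) dt < ∞, and let ε > 0 satisfy ∫₀^ε π_τ(t) dt > 0. For a diagonal matrix Λ ∈ ℝ^{p×p} with positive diagonal entries and t > 0, set A_c(t,Λ) = XᵀX + c⁻²I_p + (tΛ)⁻¹ and f_Λ(t) = (yᵀ(I_n − X A_c(t,Λ)⁻¹ Xᵀ)y/2 + b)^{−(a+n/2)} · det(c⁻²I_p + (tΛ)⁻¹)^{1/2} · det(XᵀX + c⁻²I_p + (tΛ)⁻¹)^{−1/2} · π_τ(t). Then there exists a finite constant C₂, not depending on Λ, such that for every diagonal Λ with positive diagonal entries, ∫₀^∞ t^{δ/2} f_Λ(t) dt ≤ C₂ ∫₀^∞ f_Λ(t) dt. In fact one may take C₂ = ε^{δ/2} + (1 + yᵀy/b)^{a+n/2} · (∫₀^ε π_τ(t) dt)⁻¹ · ∫₀^∞ t^{δ/2}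 π_τ(t) dt. -/
open Matrix MeasureTheory

/-- The unnormalized conditional posterior density of the global shrinkage
parameter `τ² = t` given the squared local shrinkage parameters `lam` in the
regularized Horseshoe model of Piironen and Vehtari:
`f_Λ(t) = (yᵀ(I − X A_c(t,Λ)⁻¹ Xᵀ)y/2 + b)^{−(a+n/2)}
  det(c⁻²I + (tΛ)⁻¹)^{1/2} det(XᵀX + c⁻²I + (tΛ)⁻¹)^{−1/2} π_τ(t)`
with `A_c(t,Λ) = XᵀX + c⁻²I + (tΛ)⁻¹`. -/
noncomputable def regTauDens (n p : ℕ) (X : Matrix (Fin n) (Fin p) ℝ)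
    (y : Fin n → ℝ) (a b c : ℝ) (πτ : ℝ → ℝ) (lam : Fin p → ℝ) (t : ℝ) : ℝ :=
  (y ⬝ᵥ ((1 - X * (X.transpose * X + (c ^ 2)⁻¹ • (1 : Matrix (Fin p) (Fin p) ℝ)
        + (t • Matrix.diagonal lam)⁻¹)⁻¹ * X.transpose).mulVec y) / 2 + b)
      ^ (-(a + (n : ℝ) / 2)) *
    (((c ^ 2)⁻¹ • (1 : Matrix (Fin p) (Fin p) ℝ)
        + (t • Matrix.diagonal lam)⁻¹).det) ^ ((1 : ℝ) / 2) *
    ((X.transpose * X + (c ^ 2)⁻¹ • (1 : Matrix (Fin p) (Fin p) ℝ)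
        + (t • Matrix.diagonal lam)⁻¹).det) ^ (-(1 / 2 : ℝ)) *
    πτ t

lemma one_le_det_one_add {n : ℕ} {P : Matrix (Fin n) (Fin n) ℝ} (hP : P.PosSemidef) :
    1 ≤ (1 + P).det := by
  have hH : (1 + P).IsHermitian := (Matrix.PosSemidef.one.add hP).1
  rw [hH.det_eq_prod_eigenvalues]
  have h1 : ∀ i, 1 ≤ hH.eigenvalues i := by
    intro i
    rw [hH.eigenvalues_eq]
    have hn := hH.eigenvectorBasis.orthonormal.1 i
    have h2 := hP.dotProduct_mulVec_nonneg (⇑(hH.eigenvectorBasis i))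
    have h3 : (star ⇑(hH.eigenvectorBasis i)) ⬝ᵥ ⇑(hH.eigenvectorBasis i) = (1 : ℝ) := by
      have := EuclideanSpace.real_norm_sq_eq (hH.eigenvectorBasis i)
      rw [hn] at this
      simp only [dotProduct, Pi.star_apply, star_trivial]
      rw [one_pow] at this
      rw [this]
      exact Finset.sum_congr rfl fun j _ => (sq _).symm
    rw [Matrix.add_mulVec, Matrix.one_mulVec, dotProduct_add, h3]
    simpa using h2
  have := Finset.prod_le_prod (s := Finset.univ) (f := fun _ : Fin n => (1:ℝ))
    (g := hH.eigenvalues) (fun _ _ => zero_le_one) (fun i _ => h1 i)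
  simpa using this

lemma XdX_psd {n p : ℕ} (X : Matrix (Fin n) (Fin p) ℝ) {e : Fin p → ℝ} (he : ∀ j, 0 ≤ e j) :
    (X * diagonal e * X.transpose).PosSemidef := by
  have := (Matrix.PosSemidef.diagonal (d := e) he).mul_mul_conjTranspose_same X
  simpa using this

lemma det_mono {n p : ℕ} (X : Matrix (Fin n) (Fin p) ℝ) {e e' : Fin p → ℝ}
    (he : ∀ j, 0 ≤ e j) (hee : ∀ j, e j ≤ e' j) :
    (1 + X * diagonal e * X.transpose).det ≤ (1 + X * diagonal e' * X.transpose).det := by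
  set M := 1 + X * diagonal e * X.transpose with hM
  have hMp : M.PosDef := Matrix.PosDef.one.add_posSemidef (XdX_psd X he)
  set s : Fin p → ℝ := fun j => Real.sqrt (e' j - e j) with hs
  set Z := X * diagonal s with hZ
  have hZZ : 1 + X * diagonal e' * X.transpose = M + Z * Z.transpose := by
    have : diagonal e' = diagonal e + diagonal s * diagonal s := by
      rw [diagonal_mul_diagonal, diagonal_add]
      congr 1; funext j
      simp only [hs]
      rw [Real.mul_self_sqrt (by linarith [hee j])]; ring
    rw [this, hM, hZ, transpose_mul, diagonal_transpose, Matrix.mul_add, Matrix.add_mul, add_assoc]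
    simp only [Matrix.mul_assoc]
  have hu : IsUnit M.det := hMp.det_pos.ne'.isUnit
  have hfac : M + Z * Z.transpose = M * (1 + M⁻¹ * Z * Z.transpose) := by
    rw [Matrix.mul_add, Matrix.mul_one, Matrix.mul_assoc M⁻¹, Matrix.mul_nonsing_inv_cancel_left _ _ hu]
  rw [hZZ, hfac, det_mul, Matrix.det_one_add_mul_comm (M⁻¹ * Z), ← Matrix.mul_assoc Z.transpose]
  have h1 : 1 ≤ (1 + Z.transpose * M⁻¹ * Z).det := by
    apply one_le_det_one_add
    have := hMp.posSemidef.inv.conjTranspose_mul_mul_same Z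
    simpa using this
  exact le_mul_of_one_le_right hMp.det_pos.le h1

lemma det_fac {n p : ℕ} (X : Matrix (Fin n) (Fin p) ℝ) {d : Fin p → ℝ} (hd : ∀ j, 0 < d j) :
    (X.transpose * X + diagonal d).det =
      (diagonal d).det * (1 + X * diagonal (fun j => (d j)⁻¹) * X.transpose).det := by
  have h1 : X.transpose * X + diagonal d =
      diagonal d * (1 + diagonal (fun j => (d j)⁻¹) * X.transpose * X) := by
    rw [Matrix.mul_add, Matrix.mul_one, Matrix.mul_assoc (diagonal _) X.transpose, ← Matrix.mul_assoc,
      diagonal_mul_diagonal]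
    have : (fun i => d i * (d i)⁻¹) = fun _ => (1:ℝ) := by
      funext i; exact mul_inv_cancel₀ (hd i).ne'
    rw [this, diagonal_one, Matrix.one_mul, add_comm]
  rw [h1, det_mul, Matrix.det_one_add_mul_comm, Matrix.mul_assoc X]

lemma A_pd {n p : ℕ} (X : Matrix (Fin n) (Fin p) ℝ) {d : Fin p → ℝ} (hd : ∀ j, 0 < d j) :
    (X.transpose * X + diagonal d).PosDef := by
  have h := Matrix.posSemidef_conjTranspose_mul_self X
  rw [conjTranspose_eq_transpose_of_trivial] at h
  exact Matrix.PosDef.posSemidef_add h (Matrix.PosDef.diagonal hd)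

lemma Q_bounds {n p : ℕ} (X : Matrix (Fin n) (Fin p) ℝ) (y : Fin n → ℝ) {d : Fin p → ℝ}
    (hd : ∀ j, 0 < d j) :
    0 ≤ y ⬝ᵥ ((1 - X * (X.transpose * X + diagonal d)⁻¹ * X.transpose).mulVec y) ∧
    y ⬝ᵥ ((1 - X * (X.transpose * X + diagonal d)⁻¹ * X.transpose).mulVec y) ≤ y ⬝ᵥ y := by
  have hA := A_pd X hd
  set A := X.transpose * X + diagonal d with hAdef
  have hu : IsUnit A.det := hA.det_pos.ne'.isUnit
  rw [Matrix.sub_mulVec, Matrix.one_mulVec, dotProduct_sub]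
  constructor
  · set z := A⁻¹ *ᵥ (X.transpose *ᵥ y) with hz
    have h1 : (X * A⁻¹ * X.transpose) *ᵥ y = X *ᵥ z := by
      rw [hz]; simp only [Matrix.mulVec_mulVec, Matrix.mul_assoc]
    have h2 : A *ᵥ z = X.transpose *ᵥ y := by
      rw [hz, Matrix.mulVec_mulVec, Matrix.mul_nonsing_inv _ hu, Matrix.one_mulVec]
    have h3 : z ⬝ᵥ (A *ᵥ z) = y ⬝ᵥ (X *ᵥ z) := by
      rw [h2, Matrix.dotProduct_mulVec, Matrix.vecMul_transpose, dotProduct_comm]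
    have h4 : z ⬝ᵥ (A *ᵥ z) = (X *ᵥ z) ⬝ᵥ (X *ᵥ z) + z ⬝ᵥ (diagonal d *ᵥ z) := by
      rw [hAdef, Matrix.add_mulVec, dotProduct_add, ← Matrix.mulVec_mulVec, 
        Matrix.dotProduct_mulVec z X.transpose, Matrix.vecMul_transpose]
    have h5 : 0 ≤ z ⬝ᵥ (diagonal d *ᵥ z) := by
      have := (Matrix.PosDef.diagonal hd).posSemidef.dotProduct_mulVec_nonneg z
      simpa using this
    have h6 : 0 ≤ (y - X *ᵥ z) ⬝ᵥ (y - X *ᵥ z) :=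
      Finset.sum_nonneg fun i _ => mul_self_nonneg _
    rw [sub_dotProduct, dotProduct_sub, dotProduct_sub, dotProduct_comm (X *ᵥ z) y] at h6
    rw [h1]
    linarith
  · have := (hA.posSemidef.inv.mul_mul_conjTranspose_same X).dotProduct_mulVec_nonneg y
    simp only [conjTranspose_eq_transpose_of_trivial, star_trivial] at this
    linarith

lemma D_eq {p : ℕ} (c : ℝ) {lam : Fin p → ℝ} (hlam : ∀ j, 0 < lam j) {t : ℝ} (ht : 0 < t) :
    (c ^ 2)⁻¹ • (1 : Matrix (Fin p) (Fin p) ℝ) + (t • Matrix.diagonal lam)⁻¹ =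
      diagonal (fun j => (c ^ 2)⁻¹ + (t * lam j)⁻¹) := by
  have h : (t • Matrix.diagonal lam)⁻¹ = diagonal (fun j => (t * lam j)⁻¹) := by
    apply Matrix.inv_eq_right_inv
    rw [← diagonal_smul, diagonal_mul_diagonal, ← diagonal_one]
    congr 1; funext j
    exact mul_inv_cancel₀ (mul_pos ht (hlam j)).ne'
  rw [h, ← diagonal_one, ← diagonal_smul, diagonal_add]
  congr 1; funext j; simp

/-- The abstract integral comparison. -/
lemma integral_cmp (π g h : ℝ → ℝ) (q m M ε K : ℝ) (hq : 0 < q) (hm : 0 < m) (hM : 0 < M)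
    (hmM : M ≤ K * m) (hπ : ∀ t, 0 ≤ π t) (hπi : IntegrableOn π (Set.Ioi 0))
    (hmom : IntegrableOn (fun t => t ^ q * π t) (Set.Ioi 0)) (hε : 0 < ε)
    (hεπ : 0 < ∫ t in Set.Ioo (0 : ℝ) ε, π t)
    (hg : ∀ t, 0 < t → m ≤ g t ∧ g t ≤ M) (hh : ∀ t, 0 < t → 0 < h t ∧ h t ≤ 1)
    (hanti : ∀ s t, 0 < s → s ≤ t → h t ≤ h s)
    (hcont : ContinuousOn (fun t => g t * h t) (Set.Ioi 0)) :
    (∫ t in Set.Ioi (0 : ℝ), t ^ q * (g t * h t * π t)) ≤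
      (ε ^ q + K * (∫ t in Set.Ioo (0 : ℝ) ε, π t)⁻¹ * ∫ t in Set.Ioi (0 : ℝ), t ^ q * π t) *
        ∫ t in Set.Ioi (0 : ℝ), g t * h t * π t := by
  have hmeas : AEStronglyMeasurable (fun t => g t * h t) (volume.restrict (Set.Ioi 0)) :=
    hcont.aestronglyMeasurable measurableSet_Ioi
  have hbd : ∀ᵐ t ∂(volume.restrict (Set.Ioi (0:ℝ))), ‖g t * h t‖ ≤ M := by
    filter_upwards [ae_restrict_mem measurableSet_Ioi] with t ht
    obtain ⟨h1, h2⟩ := hg t ht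
    obtain ⟨h3, h4⟩ := hh t ht
    rw [Real.norm_of_nonneg (mul_nonneg (by linarith) h3.le)]
    nlinarith
  have hfi : IntegrableOn (fun t => g t * h t * π t) (Set.Ioi 0) := hπi.bdd_mul hmeas hbd
  have hfnn : ∀ t, 0 < t → 0 ≤ g t * h t * π t := fun t ht =>
    mul_nonneg (mul_nonneg (by linarith [(hg t ht).1]) (hh t ht).1.le) (hπ t)
  have hmomnn : 0 ≤ ∫ t in Set.Ioi (0 : ℝ), t ^ q * π t :=
    setIntegral_nonneg measurableSet_Ioi fun t ht => mul_nonneg (Real.rpow_nonneg (le_of_lt ht) _) (hπ t)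
  have hsub : Set.Ioo (0:ℝ) ε ⊆ Set.Ioi 0 := fun t ht => ht.1
  -- pointwise bound
  have h1 : (∫ t in Set.Ioi (0 : ℝ), t ^ q * (g t * h t * π t)) ≤
      ∫ t in Set.Ioi (0 : ℝ), (ε ^ q * (g t * h t * π t) + M * h ε * (t ^ q * π t)) := by
    apply integral_mono_of_nonneg
    · filter_upwards [ae_restrict_mem measurableSet_Ioi] with t ht
      exact mul_nonneg (Real.rpow_nonneg (le_of_lt ht) _) (hfnn t ht)
    · exact (hfi.const_mul _).add (hmom.const_mul _)
    · filter_upwards [ae_restrict_mem measurableSet_Ioi] with t ht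
      have ht0 : (0:ℝ) < t := ht
      have htq : 0 ≤ t ^ q := Real.rpow_nonneg ht0.le _
      have hc : 0 ≤ M * h ε * (t ^ q * π t) :=
        mul_nonneg (mul_nonneg hM.le (hh ε hε).1.le) (mul_nonneg htq (hπ t))
      rcases le_total t ε with hte | hte
      · have : t ^ q ≤ ε ^ q := Real.rpow_le_rpow ht0.le hte hq.le
        have := mul_le_mul_of_nonneg_right this (hfnn t ht0)
        linarith
      · have h2 : g t * h t ≤ M * h ε :=
          mul_le_mul (hg t ht0).2 (hanti ε t hε hte) (hh t ht0).1.le hM.le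
        have h3 := mul_le_mul_of_nonneg_right h2 (mul_nonneg htq (hπ t))
        have h4 : 0 ≤ ε ^ q * (g t * h t * π t) :=
          mul_nonneg (Real.rpow_nonneg hε.le _) (hfnn t ht0)
        have h5 : t ^ q * (g t * h t * π t) = g t * h t * (t ^ q * π t) := by ring
        linarith
  rw [integral_add (hfi.const_mul _) (hmom.const_mul _), integral_const_mul, integral_const_mul] at h1
  have h2 : m * h ε * (∫ t in Set.Ioo (0 : ℝ) ε, π t) ≤ ∫ t in Set.Ioi (0 : ℝ), g t * h t * π t := by
    calc m * h ε * (∫ t in Set.Ioo (0 : ℝ) ε, π t) = ∫ t in Set.Ioo (0 : ℝ) ε, m * h ε * π t :=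
          (integral_const_mul _ _).symm
      _ ≤ ∫ t in Set.Ioo (0 : ℝ) ε, g t * h t * π t := by
          apply setIntegral_mono_on ((hπi.mono_set hsub).const_mul _) (hfi.mono_set hsub) measurableSet_Ioo
          intro t ht
          apply mul_le_mul_of_nonneg_right _ (hπ t)
          exact mul_le_mul (hg t ht.1).1 (hanti t ε ht.1 ht.2.le) (hh ε hε).1.le
            (by linarith [(hg t ht.1).1])
      _ ≤ _ := by
          apply setIntegral_mono_set hfi
          · filter_upwards [ae_restrict_mem measurableSet_Ioi] with t ht
            exact hfnn t ht
          · exact hsub.eventuallyLE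
  set I := ∫ t in Set.Ioo (0 : ℝ) ε, π t
  set J := ∫ t in Set.Ioi (0 : ℝ), t ^ q * π t
  set F := ∫ t in Set.Ioi (0 : ℝ), g t * h t * π t
  have hK : 0 < K := by
    by_contra hK
    nlinarith
  have h3 : M * h ε ≤ K * I⁻¹ * F := by
    calc M * h ε ≤ K * m * h ε := mul_le_mul_of_nonneg_right hmM (hh ε hε).1.le
      _ = K * I⁻¹ * (m * h ε * I) := by field_simp
      _ ≤ _ := mul_le_mul_of_nonneg_left h2 (by positivity)
  have h4 := mul_le_mul_of_nonneg_right h3 hmomnn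
  linarith [h1, h4]

/-- In the regularized Horseshoe model, under a finite prior
`δ/2`-th moment for `τ²`, the conditional posterior `δ/2`-th moment of `τ²`
given the local shrinkage parameters is bounded uniformly in `Λ`, with
explicit constant
`C₂ = ε^{δ/2} + (1 + yᵀy/b)^{a+n/2} (∫₀^ε π_τ)⁻¹ ∫₀^∞ t^{δ/2} π_τ(t) dt`. -/
theorem stmt8 (n p : ℕ) (X : Matrix (Fin n) (Fin p) ℝ) (y : Fin n → ℝ)
    (a b δ c : ℝ) (ha : 0 < a) (hb : 0 < b) (hδ : 0 < δ) (hc : c ≠ 0)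
    (πτ : ℝ → ℝ) (hπ_nonneg : ∀ t, 0 ≤ πτ t)
    (hπ_prob : ∫ t in Set.Ioi (0 : ℝ), πτ t = 1)
    (hπ_mom : IntegrableOn (fun t => t ^ (δ / 2) * πτ t) (Set.Ioi 0))
    (ε : ℝ) (hε : 0 < ε) (hεπ : 0 < ∫ t in Set.Ioo (0 : ℝ) ε, πτ t) :
    ∃ C₂ : ℝ,
      C₂ = ε ^ (δ / 2) + (1 + y ⬝ᵥ y / b) ^ (a + (n : ℝ) / 2) *
        (∫ t in Set.Ioo (0 : ℝ) ε, πτ t)⁻¹ *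
        (∫ t in Set.Ioi (0 : ℝ), t ^ (δ / 2) * πτ t) ∧
      ∀ lam : Fin p → ℝ, (∀ j, 0 < lam j) →
        (∫ t in Set.Ioi (0 : ℝ), t ^ (δ / 2) * regTauDens n p X y a b c πτ lam t) ≤
          C₂ * ∫ t in Set.Ioi (0 : ℝ), regTauDens n p X y a b c πτ lam t := by
  refine ⟨_, rfl, ?_⟩
  intro lam hlam
  have hyy : 0 ≤ y ⬝ᵥ y := Finset.sum_nonneg fun i _ => mul_self_nonneg _
  have hc2 : 0 < (c ^ 2)⁻¹ := by positivity
  have hs : 0 < a + (n : ℝ) / 2 := by positivity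
  set s : ℝ := a + (n : ℝ) / 2 with hsdef
  set d : ℝ → Fin p → ℝ := fun t j => (c ^ 2)⁻¹ + (t * lam j)⁻¹ with hd
  have hdpos : ∀ t, 0 < t → ∀ j, 0 < d t j := by
    intro t ht j
    have := mul_pos ht (hlam j)
    simp only [hd]; positivity
  set g : ℝ → ℝ := fun t => (y ⬝ᵥ ((1 - X * (X.transpose * X + diagonal (d t))⁻¹ *
    X.transpose).mulVec y) / 2 + b) ^ (-s) with hg
  set R : ℝ → ℝ := fun t => (1 + X * diagonal (fun j => (d t j)⁻¹) * X.transpose).det with hR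
  set h : ℝ → ℝ := fun t => R t ^ (-(1 / 2 : ℝ)) with hh
  have hR1 : ∀ t, 0 < t → 1 ≤ R t := fun t ht =>
    one_le_det_one_add (XdX_psd X fun j => (inv_pos.2 (hdpos t ht j)).le)
  have hRmono : ∀ u t, 0 < u → u ≤ t → R u ≤ R t := by
    intro u t hu hut
    apply det_mono X (fun j => (inv_pos.2 (hdpos u hu j)).le)
    intro j
    apply inv_anti₀ (hdpos t (hu.trans_le hut) j)
    have := hlam j
    simp only [hd]
    gcongr
  have hdens : ∀ t, 0 < t → regTauDens n p X y a b c πτ lam t = g t * h t * πτ t := by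
    intro t ht
    unfold regTauDens
    rw [add_assoc (X.transpose * X), D_eq c hlam ht]
    change g t * (diagonal (d t)).det ^ ((1:ℝ) / 2) *
      (X.transpose * X + diagonal (d t)).det ^ (-(1 / 2 : ℝ)) * πτ t = _
    have hD : 0 < (diagonal (d t)).det := (Matrix.PosDef.diagonal (hdpos t ht)).det_pos
    rw [det_fac X (hdpos t ht), Real.mul_rpow hD.le (zero_le_one.trans (hR1 t ht))]
    have h1 : (diagonal (d t)).det ^ ((1:ℝ) / 2) * (diagonal (d t)).det ^ (-(1 / 2 : ℝ)) = 1 := by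
      rw [← Real.rpow_add hD]; simp
    calc _ = g t * ((diagonal (d t)).det ^ ((1:ℝ) / 2) * (diagonal (d t)).det ^ (-(1 / 2 : ℝ))) *
          h t * πτ t := by simp only [hh, hR]; ring
      _ = _ := by rw [h1, mul_one]
  have e1 : (∫ t in Set.Ioi (0 : ℝ), t ^ (δ / 2) * regTauDens n p X y a b c πτ lam t) =
      ∫ t in Set.Ioi (0 : ℝ), t ^ (δ / 2) * (g t * h t * πτ t) :=
    setIntegral_congr_fun measurableSet_Ioi fun t ht => by
      simp only [hdens t ht]
  have e2 : (∫ t in Set.Ioi (0 : ℝ), regTauDens n p X y a b c πτ lam t) =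
      ∫ t in Set.Ioi (0 : ℝ), g t * h t * πτ t :=
    setIntegral_congr_fun measurableSet_Ioi fun t ht => hdens t ht
  rw [e1, e2]
  have hπi : IntegrableOn πτ (Set.Ioi 0) := by
    by_contra hni
    rw [integral_undef hni] at hπ_prob
    exact zero_ne_one hπ_prob
  have hdc : ContinuousOn d (Set.Ioi 0) := by
    rw [continuousOn_pi]
    intro j
    apply continuousOn_const.add
    apply ContinuousOn.inv₀ (continuousOn_id.mul continuousOn_const)
    intro t ht
    exact (mul_pos ht (hlam j)).ne'
  have hdic : ContinuousOn (fun t j => (d t j)⁻¹) (Set.Ioi 0) := by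
    rw [continuousOn_pi]
    intro j
    exact ContinuousOn.inv₀ (continuousOn_pi.1 hdc j) fun t ht => (hdpos t ht j).ne'
  have hRc : ContinuousOn R (Set.Ioi 0) := by
    have : Continuous fun e : Fin p → ℝ => (1 + X * diagonal e * X.transpose).det := by
      fun_prop
    exact this.comp_continuousOn hdic
  have hQc : ContinuousOn (fun t => y ⬝ᵥ ((1 - X * (X.transpose * X + diagonal (d t))⁻¹ *
      X.transpose).mulVec y)) (Set.Ioi 0) := by
    have hdet : Continuous fun e : Fin p → ℝ => (X.transpose * X + diagonal e).det := by
      fun_prop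
    have hadj : Continuous fun e : Fin p → ℝ => (X.transpose * X + diagonal e).adjugate := by
      fun_prop
    have hinv : ContinuousOn (fun t => (X.transpose * X + diagonal (d t))⁻¹) (Set.Ioi 0) := by
      simp only [Matrix.inv_def, Ring.inverse_eq_inv']
      exact ((hdet.comp_continuousOn hdc).inv₀ fun t ht => (A_pd X (hdpos t ht)).det_pos.ne').smul
        (hadj.comp_continuousOn hdc)
    have : Continuous fun B : Matrix (Fin p) (Fin p) ℝ =>
        y ⬝ᵥ ((1 - X * B * X.transpose).mulVec y) := by
      fun_prop
    exact this.comp_continuousOn hinv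
  have hbase : ∀ t, 0 < t → 0 < y ⬝ᵥ ((1 - X * (X.transpose * X + diagonal (d t))⁻¹ *
      X.transpose).mulVec y) / 2 + b := fun t ht => by
    linarith [(Q_bounds X y (hdpos t ht)).1]
  apply integral_cmp πτ g h (δ / 2) ((y ⬝ᵥ y / 2 + b) ^ (-s)) (b ^ (-s)) ε _ (by positivity)
    (by positivity) (by positivity) _ hπ_nonneg hπi hπ_mom hε hεπ
  · intro t ht
    obtain ⟨q1, q2⟩ := Q_bounds X y (hdpos t ht)
    constructor
    · exact Real.rpow_le_rpow_of_nonpos (hbase t ht) (by linarith) (by linarith)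
    · exact Real.rpow_le_rpow_of_nonpos hb (by linarith) (by linarith)
  · intro t ht
    exact ⟨Real.rpow_pos_of_pos (zero_lt_one.trans_le (hR1 t ht)) _,
      Real.rpow_le_one_of_one_le_of_nonpos (hR1 t ht) (by norm_num)⟩
  · intro u t hu hut
    exact Real.rpow_le_rpow_of_nonpos (zero_lt_one.trans_le (hR1 u hu)) (hRmono u t hu hut)
      (by norm_num)
  · apply ContinuousOn.mul
    · exact ((hQc.div_const 2).add continuousOn_const).rpow_const
        fun t ht => Or.inl (hbase t ht).ne'
    · exact hRc.rpow_const fun t ht => Or.inl (zero_lt_one.trans_le (hR1 t ht)).ne'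
  · have hB : 0 < y ⬝ᵥ y / 2 + b := by positivity
    rw [Real.rpow_neg hb.le, Real.rpow_neg hB.le, ← div_eq_mul_inv, le_div_iff₀ (by positivity),
      inv_mul_eq_div, ← Real.div_rpow hB.le hb.le]
    apply Real.rpow_le_rpow (by positivity) _ hs.le
    rw [div_le_iff₀ hb, add_mul, div_mul_cancel₀ _ hb.ne']
    linarith
end

section
/- Let X ∈ ℝ^{n×p}, y ∈ ℝⁿ, a > 0, b > 0, δ > 0 and c ≠ 0. For t ≥ 0 define c(t) by c(t)⁻¹ = ∫₀^∞ (1 + t λ²/c²)^{−1/2} · (2/(π(1+λ²))) dλ. Let T > 0 and let π_τ be a probability density on (0,∞) vanishing on (0,T) and satisfying ∫_T^∞ t^{δ/2}(1+t)^{p/2} π_τ(t) dt < ∞, and let ε > T satisfy ∫_T^ε π_τ(t) dt > 0. For a diagonal matrix Λ ∈ ℝ^{p×p} with positive diagonal entries and t > 0, set A_c(t,Λ) = XᵀX + c⁻²I_p + (tΛ)⁻¹ and f_Λ(t) = (yᵀ(I_n − X A_c(t,Λ)⁻¹ Xᵀ)y/2 + b)^{−(a+n/2)} · det(t(XᵀX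 + c⁻²I_p) + Λ⁻¹)^{−1/2} · c(t)^p · π_τ(t). Then there exists a finite constant C₃, not depending on Λ, such that for every diagonal Λ with positive diagonal entries, ∫₀^∞ t^{δ/2} f_Λ(t) dt ≤ C₃ ∫₀^∞ f_Λ(t) dt. -/
open Matrix MeasureTheory

/-- The normalizing constant `c(t)` of the conditional prior of a local
shrinkage parameter given the global shrinkage parameter `t = τ²` in the
regularized Horseshoe variant of Nishimura and Suchard:
`c(t)⁻¹ = ∫₀^∞ (1 + t λ²/c²)^{−1/2} (2/(π(1+λ²))) dλ`. -/
noncomputable def nsNormConst (c t : ℝ) : ℝ :=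
  (∫ l in Set.Ioi (0 : ℝ),
    (1 + t * l ^ 2 / c ^ 2) ^ (-(1 / 2 : ℝ)) * (2 / (Real.pi * (1 + l ^ 2))))⁻¹

/-- The unnormalized conditional posterior density of the global shrinkage
parameter `τ² = t` given the squared local shrinkage parameters `lam` in the
regularized Horseshoe variant of Nishimura and Suchard:
`f_Λ(t) = (yᵀ(I − X A_c(t,Λ)⁻¹ Xᵀ)y/2 + b)^{−(a+n/2)}
  det(t(XᵀX + c⁻²I) + Λ⁻¹)^{−1/2} c(t)^p π_τ(t)`
with `A_c(t,Λ) = XᵀX + c⁻²I + (tΛ)⁻¹`. -/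
noncomputable def nsTauDens (n p : ℕ) (X : Matrix (Fin n) (Fin p) ℝ)
    (y : Fin n → ℝ) (a b c : ℝ) (πτ : ℝ → ℝ) (lam : Fin p → ℝ) (t : ℝ) : ℝ :=
  (y ⬝ᵥ ((1 - X * (X.transpose * X + (c ^ 2)⁻¹ • (1 : Matrix (Fin p) (Fin p) ℝ)
        + (t • Matrix.diagonal lam)⁻¹)⁻¹ * X.transpose).mulVec y) / 2 + b)
      ^ (-(a + (n : ℝ) / 2)) *
    ((t • (X.transpose * X + (c ^ 2)⁻¹ • (1 : Matrix (Fin p) (Fin p) ℝ))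
        + (Matrix.diagonal lam)⁻¹).det) ^ (-(1 / 2 : ℝ)) *
    nsNormConst c t ^ p *
    πτ t

lemma ns_one_le_det_one_add {p : ℕ} (P : Matrix (Fin p) (Fin p) ℝ) (hP : P.PosSemidef) :
    1 ≤ (1 + P).det := by
  have h := hP.1.charpoly_eq
  have h2 := Matrix.eval_charpoly P (-1)
  rw [h, Polynomial.eval_prod] at h2
  have h3 : (scalar (Fin p) (-1 : ℝ)) - P = -(1 + P) := by
    rw [map_neg, map_one]; abel
  rw [h3, Matrix.det_neg] at h2
  have h4 : (1 + P).det = ∏ i, (1 + hP.1.eigenvalues i) := by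
    have : ∏ i, Polynomial.eval (-1) (Polynomial.X - Polynomial.C ((hP.1.eigenvalues i : ℝ))) = (-1) ^ Fintype.card (Fin p) * ∏ i, (1 + hP.1.eigenvalues i) := by
      rw [← Finset.card_univ, ← Finset.prod_const, ← Finset.prod_mul_distrib]
      refine Finset.prod_congr rfl fun i _ => ?_
      simp; ring
    erw [this] at h2
    exact (mul_left_cancel₀ (pow_ne_zero _ (by norm_num)) h2).symm
  rw [h4]
  have h5 : ∏ i : Fin p, (1 : ℝ) ≤ ∏ i, (1 + hP.1.eigenvalues i) :=
    Finset.prod_le_prod (fun _ _ => zero_le_one) fun i _ => by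
      linarith [hP.eigenvalues_nonneg i]
  simpa using h5

open scoped MatrixOrder in
lemma ns_exists_factor {p : ℕ} (B : Matrix (Fin p) (Fin p) ℝ) (hB : B.PosSemidef) :
    ∃ N : Matrix (Fin p) (Fin p) ℝ, B = Nᴴ * N :=
  CStarAlgebra.nonneg_iff_eq_star_mul_self.mp hB.nonneg

lemma ns_det_mono {p : ℕ} (A B : Matrix (Fin p) (Fin p) ℝ) (hA : A.PosDef)
    (hB : B.PosSemidef) : A.det ≤ (A + B).det := by
  obtain ⟨N, rfl⟩ := ns_exists_factor B hB
  rw [Matrix.det_add_mul _ _ ((Matrix.isUnit_iff_isUnit_det A).1 hA.isUnit)]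
  exact le_mul_of_one_le_right hA.det_pos.le
    (ns_one_le_det_one_add _ (hA.inv.posSemidef.mul_mul_conjTranspose_same N))

lemma ns_quad_nonneg {n p : ℕ} (X : Matrix (Fin n) (Fin p) ℝ) (y : Fin n → ℝ)
    (R : Matrix (Fin p) (Fin p) ℝ) (hR : R.PosDef) :
    0 ≤ y ⬝ᵥ ((1 - X * (Xᵀ * X + R)⁻¹ * Xᵀ).mulVec y) := by
  have hA : (Xᵀ * X + R).PosDef :=
    PosDef.posSemidef_add (by simpa using posSemidef_conjTranspose_mul_self X) hR
  set A := Xᵀ * X + R with hAdef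
  have hu : IsUnit A.det := (Matrix.isUnit_iff_isUnit_det A).1 hA.isUnit
  set v := A⁻¹ *ᵥ (Xᵀ *ᵥ y) with hv
  have hAv : A *ᵥ v = Xᵀ *ᵥ y := by
    rw [hv, mulVec_mulVec, Matrix.mul_nonsing_inv _ hu, one_mulVec]
  have e1 : y ⬝ᵥ ((1 - X * A⁻¹ * Xᵀ).mulVec y) = y ⬝ᵥ y - y ⬝ᵥ (X *ᵥ v) := by
    rw [sub_mulVec, one_mulVec, dotProduct_sub, hv, mulVec_mulVec, mulVec_mulVec, Matrix.mul_assoc]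
  have e2 : y ⬝ᵥ (X *ᵥ v) = v ⬝ᵥ (A *ᵥ v) := by
    rw [hAv, dotProduct_mulVec, ← mulVec_transpose, dotProduct_comm]
  have e3 : v ⬝ᵥ (A *ᵥ v) = (X *ᵥ v) ⬝ᵥ (X *ᵥ v) + v ⬝ᵥ (R *ᵥ v) := by
    rw [hAdef, add_mulVec, dotProduct_add, ← mulVec_mulVec, dotProduct_mulVec v Xᵀ, vecMul_transpose]
  have e4 : 0 ≤ v ⬝ᵥ (R *ᵥ v) := by simpa using hR.posSemidef.dotProduct_mulVec_nonneg v
  have e5 : 0 ≤ (y - X *ᵥ v) ⬝ᵥ (y - X *ᵥ v) := by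
    simpa using dotProduct_star_self_nonneg (y - X *ᵥ v)
  rw [sub_dotProduct, dotProduct_sub, dotProduct_sub, dotProduct_comm (X *ᵥ v) y] at e5
  rw [e1]; linarith

lemma ns_quad_le {n p : ℕ} (X : Matrix (Fin n) (Fin p) ℝ) (y : Fin n → ℝ)
    (A : Matrix (Fin p) (Fin p) ℝ) (hA : A.PosDef) :
    y ⬝ᵥ ((1 - X * A⁻¹ * Xᵀ).mulVec y) ≤ y ⬝ᵥ y := by
  have h := (hA.inv.posSemidef.mul_mul_conjTranspose_same X).dotProduct_mulVec_nonneg y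
  rw [sub_mulVec, one_mulVec, dotProduct_sub]
  simpa using h

lemma ns_int (c t : ℝ) (ht : 0 ≤ t) : IntegrableOn (fun l : ℝ => 
    (1 + t * l ^ 2 / c ^ 2) ^ (-(1 / 2 : ℝ)) * (2 / (Real.pi * (1 + l ^ 2)))) (Set.Ioi 0) := by
  have h0 : IntegrableOn (fun l : ℝ => (2 / (Real.pi * (1 + l ^ 2)))) (Set.Ioi 0) := by
    have := (integrable_inv_one_add_sq.const_mul (2 / Real.pi)).integrableOn (s := Set.Ioi 0)
    refine this.congr_fun (fun x _ => ?_) measurableSet_Ioi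
    have := Real.pi_pos
    simp only
    field_simp
  refine h0.mono' ?_ ?_
  · apply Measurable.aestronglyMeasurable
    fun_prop
  · filter_upwards with l
    have h1 : 0 ≤ t * l ^ 2 / c ^ 2 := by positivity
    rw [Real.norm_of_nonneg (by have := Real.pi_pos; positivity)]
    apply mul_le_of_le_one_left (by have := Real.pi_pos; positivity)
    exact Real.rpow_le_one_of_one_le_of_nonpos (by linarith) (by norm_num)

lemma ns_integral_pos (c t : ℝ) (ht : 0 ≤ t) : 0 < ∫ l in Set.Ioi (0 : ℝ), 
    (1 + t * l ^ 2 / c ^ 2) ^ (-(1 / 2 : ℝ)) * (2 / (Real.pi * (1 + l ^ 2))) := by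
  have hp : ∀ l : ℝ, 0 < (1 + t * l ^ 2 / c ^ 2) ^ (-(1 / 2 : ℝ)) * (2 / (Real.pi * (1 + l ^ 2))) := by
    intro l
    have := Real.pi_pos
    positivity
  rw [setIntegral_pos_iff_support_of_nonneg_ae (ae_of_all _ fun l => (hp l).le) (ns_int c t ht)]
  have : Function.support (fun l : ℝ => (1 + t * l ^ 2 / c ^ 2) ^ (-(1 / 2 : ℝ)) * (2 / (Real.pi * (1 + l ^ 2)))) = Set.univ := by
    ext l; simpa using (hp l).ne'
  rw [this]; simp

lemma ns_anti (c s t : ℝ) (hs : 0 ≤ s) (hst : s ≤ t) : nsNormConst c s ≤ nsNormConst c t := by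
  unfold nsNormConst
  apply inv_anti₀ (ns_integral_pos c t (hs.trans hst))
  refine setIntegral_mono_on (ns_int c t (hs.trans hst)) (ns_int c s hs) measurableSet_Ioi fun l _ => ?_
  have := Real.pi_pos
  gcongr ?_ * _
  apply Real.rpow_le_rpow_of_nonpos (by positivity) _ (by norm_num)
  gcongr

lemma ns_pos (c t : ℝ) (ht : 0 ≤ t) : 0 < nsNormConst c t :=
  inv_pos.2 (ns_integral_pos c t ht)

lemma ns_upper (c t : ℝ) (ht : 0 ≤ t) :
    nsNormConst c t ≤ nsNormConst c 1 * (1 + t) ^ (1 / 2 : ℝ) := by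
  have key : (1 + t) ^ (-(1 / 2 : ℝ)) * (∫ l in Set.Ioi (0 : ℝ), 
    (1 + 1 * l ^ 2 / c ^ 2) ^ (-(1 / 2 : ℝ)) * (2 / (Real.pi * (1 + l ^ 2)))) ≤ 
    ∫ l in Set.Ioi (0 : ℝ), 
    (1 + t * l ^ 2 / c ^ 2) ^ (-(1 / 2 : ℝ)) * (2 / (Real.pi * (1 + l ^ 2))) := by
    rw [← integral_const_mul]
    refine setIntegral_mono_on ((ns_int c 1 zero_le_one).const_mul _) (ns_int c t ht) measurableSet_Ioi fun l _ => ?_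
    have := Real.pi_pos
    rw [← mul_assoc, ← Real.mul_rpow (by positivity) (by positivity)]
    gcongr ?_ * _
    apply Real.rpow_le_rpow_of_nonpos (by positivity) _ (by norm_num)
    have : 0 ≤ l ^ 2 / c ^ 2 := by positivity
    rw [mul_div_assoc, mul_div_assoc]
    nlinarith
  have h1 := ns_integral_pos c 1 zero_le_one
  have h2 : 0 < (1 + t) ^ (-(1 / 2 : ℝ)) := by positivity
  have := inv_anti₀ (mul_pos h2 h1) key
  unfold nsNormConst
  refine this.trans (le_of_eq ?_)
  rw [mul_inv, Real.rpow_neg (by positivity), inv_inv, mul_comm]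

lemma ns_M_posDef {n p : ℕ} (X : Matrix (Fin n) (Fin p) ℝ) (c : ℝ) (hc : c ≠ 0) :
    (Xᵀ * X + (c ^ 2)⁻¹ • (1 : Matrix (Fin p) (Fin p) ℝ)).PosDef :=
  PosDef.posSemidef_add (by simpa using posSemidef_conjTranspose_mul_self X)
    (PosDef.one.smul (by positivity))

lemma ns_diag_posDef {p : ℕ} (lam : Fin p → ℝ) (hl : ∀ j, 0 < lam j) :
    (Matrix.diagonal lam).PosDef := Matrix.PosDef.diagonal hl

/-- quadratic factor bounds -/
lemma ns_quad_bounds {n p : ℕ} (X : Matrix (Fin n) (Fin p) ℝ) (y : Fin n → ℝ)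
    (c : ℝ) (hc : c ≠ 0) (lam : Fin p → ℝ) (hl : ∀ j, 0 < lam j) (t : ℝ) (ht : 0 < t) :
    0 ≤ y ⬝ᵥ ((1 - X * (X.transpose * X + (c ^ 2)⁻¹ • (1 : Matrix (Fin p) (Fin p) ℝ)
        + (t • Matrix.diagonal lam)⁻¹)⁻¹ * X.transpose).mulVec y) ∧
    y ⬝ᵥ ((1 - X * (X.transpose * X + (c ^ 2)⁻¹ • (1 : Matrix (Fin p) (Fin p) ℝ)
        + (t • Matrix.diagonal lam)⁻¹)⁻¹ * X.transpose).mulVec y) ≤ y ⬝ᵥ y := by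
  have h1 : ((t • Matrix.diagonal lam)⁻¹).PosDef := ((ns_diag_posDef lam hl).smul ht).inv
  constructor
  · rw [add_assoc]
    exact ns_quad_nonneg X y _ ((PosDef.one.smul (by positivity)).add h1)
  · exact ns_quad_le X y _ ((ns_M_posDef X c hc).add h1)

lemma ns_factor_bounds {n p : ℕ} (X : Matrix (Fin n) (Fin p) ℝ) (y : Fin n → ℝ)
    (a b c : ℝ) (ha : 0 < a) (hb : 0 < b)
    (hc : c ≠ 0) (lam : Fin p → ℝ) (hl : ∀ j, 0 < lam j) (t : ℝ) (ht : 0 < t) :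
    (y ⬝ᵥ y / 2 + b) ^ (-(a + (n : ℝ) / 2)) ≤
    (y ⬝ᵥ ((1 - X * (X.transpose * X + (c ^ 2)⁻¹ • (1 : Matrix (Fin p) (Fin p) ℝ)
        + (t • Matrix.diagonal lam)⁻¹)⁻¹ * X.transpose).mulVec y) / 2 + b)
      ^ (-(a + (n : ℝ) / 2)) ∧
    (y ⬝ᵥ ((1 - X * (X.transpose * X + (c ^ 2)⁻¹ • (1 : Matrix (Fin p) (Fin p) ℝ)
        + (t • Matrix.diagonal lam)⁻¹)⁻¹ * X.transpose).mulVec y) / 2 + b)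
      ^ (-(a + (n : ℝ) / 2)) ≤ b ^ (-(a + (n : ℝ) / 2)) := by
  obtain ⟨h1, h2⟩ := ns_quad_bounds X y c hc lam hl t ht
  have hneg : -(a + (n : ℝ) / 2) ≤ 0 := by
    have : (0 : ℝ) ≤ n := Nat.cast_nonneg n
    linarith
  exact ⟨Real.rpow_le_rpow_of_nonpos (by linarith) (by linarith) hneg,
    Real.rpow_le_rpow_of_nonpos hb (by linarith) hneg⟩

lemma ns_D_posDef {n p : ℕ} (X : Matrix (Fin n) (Fin p) ℝ) 
    (c : ℝ) (hc : c ≠ 0) (lam : Fin p → ℝ) (hl : ∀ j, 0 < lam j) (t : ℝ) (ht : 0 < t) :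
    (t • (X.transpose * X + (c ^ 2)⁻¹ • (1 : Matrix (Fin p) (Fin p) ℝ))
        + (Matrix.diagonal lam)⁻¹).PosDef :=
  ((ns_M_posDef X c hc).smul ht).add (ns_diag_posDef lam hl).inv

lemma ns_D_mono {n p : ℕ} (X : Matrix (Fin n) (Fin p) ℝ) 
    (c : ℝ) (hc : c ≠ 0) (lam : Fin p → ℝ) (hl : ∀ j, 0 < lam j) (s t : ℝ) (hs : 0 < s)
    (hst : s ≤ t) :
    (s • (X.transpose * X + (c ^ 2)⁻¹ • (1 : Matrix (Fin p) (Fin p) ℝ))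
        + (Matrix.diagonal lam)⁻¹).det ≤ 
    (t • (X.transpose * X + (c ^ 2)⁻¹ • (1 : Matrix (Fin p) (Fin p) ℝ))
        + (Matrix.diagonal lam)⁻¹).det := by
  have h := ns_det_mono _ _ (ns_D_posDef X c hc lam hl s hs)
    ((ns_M_posDef X c hc).posSemidef.smul (sub_nonneg.2 hst))
  refine h.trans (le_of_eq (congrArg _ ?_))
  rw [sub_smul]; abel

lemma ns_D_scale {n p : ℕ} (X : Matrix (Fin n) (Fin p) ℝ) 
    (c : ℝ) (hc : c ≠ 0) (lam : Fin p → ℝ) (hl : ∀ j, 0 < lam j) (s t : ℝ) (hs : 0 < s)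
    (hst : s ≤ t) :
    (s / t) ^ p * (t • (X.transpose * X + (c ^ 2)⁻¹ • (1 : Matrix (Fin p) (Fin p) ℝ))
        + (Matrix.diagonal lam)⁻¹).det ≤ 
    (s • (X.transpose * X + (c ^ 2)⁻¹ • (1 : Matrix (Fin p) (Fin p) ℝ))
        + (Matrix.diagonal lam)⁻¹).det := by
  have ht : 0 < t := hs.trans_le hst
  have h := ns_det_mono _ _ ((ns_D_posDef X c hc lam hl t ht).smul (div_pos hs ht))
    ((ns_diag_posDef lam hl).inv.posSemidef.smul (sub_nonneg.2 ((div_le_one ht).2 hst)))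
  rw [Matrix.det_smul, Fintype.card_fin] at h
  refine h.trans (le_of_eq (congrArg _ ?_))
  rw [sub_smul, smul_add, smul_smul, div_mul_cancel₀ _ ht.ne', one_smul]; abel

lemma ns_cont_inv {p : ℕ} {α : Type*} [TopologicalSpace α] (A : α → Matrix (Fin p) (Fin p) ℝ)
    (hA : Continuous A) (h : ∀ x, (A x).PosDef) : Continuous fun x => (A x)⁻¹ := by
  simp only [Matrix.inv_def, Ring.inverse_eq_inv']
  exact (hA.matrix_det.inv₀ fun x => (h x).det_pos.ne').smul hA.matrix_adjugate

lemma ns_cont_factors {n p : ℕ} (X : Matrix (Fin n) (Fin p) ℝ) (y : Fin n → ℝ)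
    (a b c : ℝ) (hb : 0 < b)
    (hc : c ≠ 0) (lam : Fin p → ℝ) (hl : ∀ j, 0 < lam j) :
    ContinuousOn (fun t : ℝ => 
    (y ⬝ᵥ ((1 - X * (X.transpose * X + (c ^ 2)⁻¹ • (1 : Matrix (Fin p) (Fin p) ℝ)
        + (t • Matrix.diagonal lam)⁻¹)⁻¹ * X.transpose).mulVec y) / 2 + b)
      ^ (-(a + (n : ℝ) / 2)) *
    ((t • (X.transpose * X + (c ^ 2)⁻¹ • (1 : Matrix (Fin p) (Fin p) ℝ))
        + (Matrix.diagonal lam)⁻¹).det) ^ (-(1 / 2 : ℝ))) (Set.Ioi 0) := by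
  rw [continuousOn_iff_continuous_restrict]
  simp only [Set.restrict_def]
  have hpd : ∀ x : Set.Ioi (0 : ℝ), ((x : ℝ) • Matrix.diagonal lam).PosDef := fun x =>
    (ns_diag_posDef lam hl).smul x.2
  have h1 : Continuous fun x : Set.Ioi (0 : ℝ) => ((x : ℝ) • Matrix.diagonal lam)⁻¹ :=
    ns_cont_inv _ (continuous_subtype_val.smul continuous_const) hpd
  have h2 := ns_cont_inv _ ((continuous_const (y := X.transpose * X +
    (c ^ 2)⁻¹ • (1 : Matrix (Fin p) (Fin p) ℝ))).add h1)
    (fun x => (ns_M_posDef X c hc).add (hpd x).inv)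
  refine Continuous.mul ?_ ?_
  · refine Continuous.rpow_const ?_ ?_
    · refine ((Continuous.dotProduct continuous_const ?_).div_const _).add continuous_const
      refine Continuous.matrix_mulVec ?_ continuous_const
      exact continuous_const.sub ((continuous_const.matrix_mul h2).matrix_mul continuous_const)
    · intro x
      left
      have := (ns_quad_bounds X y c hc lam hl x x.2).1
      exact (by linarith : (0 : ℝ) < _).ne'
  · refine Continuous.rpow_const ?_ ?_
    · exact ((continuous_subtype_val.smul continuous_const).add continuous_const).matrix_det
    · intro x
      exact Or.inl (ns_D_posDef X c hc lam hl x x.2).det_pos.ne'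

lemma ns_aesm {n p : ℕ} (X : Matrix (Fin n) (Fin p) ℝ) (y : Fin n → ℝ)
    (a b c : ℝ) (hb : 0 < b)
    (hc : c ≠ 0) (lam : Fin p → ℝ) (hl : ∀ j, 0 < lam j) (πτ : ℝ → ℝ)
    (hπ : AEStronglyMeasurable πτ (volume.restrict (Set.Ioi 0))) :
    AEStronglyMeasurable (nsTauDens n p X y a b c πτ lam) (volume.restrict (Set.Ioi 0)) := by
  unfold nsTauDens
  refine (((ns_cont_factors X y a b c hb hc lam hl).aestronglyMeasurable
    measurableSet_Ioi).mul ?_).mul hπ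
  have : AEMeasurable (nsNormConst c) (volume.restrict (Set.Ioi 0)) :=
    aemeasurable_restrict_of_monotoneOn measurableSet_Ioi
      fun s hs t _ hst => ns_anti c s t (le_of_lt hs) hst
  exact (this.pow_const p).aestronglyMeasurable

lemma ns_dens_nonneg {n p : ℕ} (X : Matrix (Fin n) (Fin p) ℝ) (y : Fin n → ℝ)
    (a b c : ℝ) (hb : 0 < b)
    (hc : c ≠ 0) (lam : Fin p → ℝ) (hl : ∀ j, 0 < lam j) (πτ : ℝ → ℝ)
    (hπ : ∀ t, 0 ≤ πτ t) (t : ℝ) (ht : 0 < t) : 0 ≤ nsTauDens n p X y a b c πτ lam t := by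
  unfold nsTauDens
  have h1 := (ns_quad_bounds X y c hc lam hl t ht).1
  have h2 := (ns_D_posDef X c hc lam hl t ht).det_pos
  have h3 := ns_pos c t ht.le
  have h4 := hπ t
  refine mul_nonneg (mul_nonneg (mul_nonneg (Real.rpow_nonneg (by linarith) _)
    (Real.rpow_nonneg h2.le _)) (pow_nonneg h3.le _)) h4

lemma ns_dens_upper {n p : ℕ} (X : Matrix (Fin n) (Fin p) ℝ) (y : Fin n → ℝ)
    (a b c : ℝ) (ha : 0 < a) (hb : 0 < b)
    (hc : c ≠ 0) (lam : Fin p → ℝ) (hl : ∀ j, 0 < lam j) (πτ : ℝ → ℝ)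
    (hπ : ∀ t, 0 ≤ πτ t) (T t : ℝ) (hT : 0 < T) (ht : T ≤ t) :
    nsTauDens n p X y a b c πτ lam t ≤ b ^ (-(a + (n : ℝ) / 2)) *
    ((T • (X.transpose * X + (c ^ 2)⁻¹ • (1 : Matrix (Fin p) (Fin p) ℝ))
        + (Matrix.diagonal lam)⁻¹).det) ^ (-(1 / 2 : ℝ)) *
    nsNormConst c 1 ^ p * ((1 + t) ^ ((p : ℝ) / 2) * πτ t) := by
  have ht0 := hT.trans_le ht
  unfold nsTauDens
  have h2 := (ns_D_posDef X c hc lam hl t ht0).det_pos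
  have h2' := (ns_D_posDef X c hc lam hl T hT).det_pos
  have h3 := ns_pos c t ht0.le
  have h5 : nsNormConst c t ^ p ≤ nsNormConst c 1 ^ p * (1 + t) ^ ((p : ℝ) / 2) := by
    refine (pow_le_pow_left₀ h3.le (ns_upper c t ht0.le) p).trans (le_of_eq ?_)
    rw [mul_pow, ← Real.rpow_natCast ((1 + t) ^ (1 / 2 : ℝ)), ← Real.rpow_mul (by positivity)]
    congr 2; ring
  rw [← mul_assoc, mul_assoc _ (nsNormConst c 1 ^ p)]
  refine mul_le_mul_of_nonneg_right ?_ (hπ t)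
  refine mul_le_mul (mul_le_mul (ns_factor_bounds X y a b c ha hb hc lam hl t ht0).2 ?_
    (Real.rpow_nonneg h2.le _) (by positivity)) h5 (by positivity) (by positivity)
  exact Real.rpow_le_rpow_of_nonpos h2' (ns_D_mono X c hc lam hl T t hT ht) (by norm_num)

lemma ns_dens_lower {n p : ℕ} (X : Matrix (Fin n) (Fin p) ℝ) (y : Fin n → ℝ)
    (a b c : ℝ) (ha : 0 < a) (hb : 0 < b)
    (hc : c ≠ 0) (lam : Fin p → ℝ) (hl : ∀ j, 0 < lam j) (πτ : ℝ → ℝ)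
    (hπ : ∀ t, 0 ≤ πτ t) (ε t : ℝ) (ht0 : 0 < t) (ht : t ≤ ε) :
    (y ⬝ᵥ y / 2 + b) ^ (-(a + (n : ℝ) / 2)) *
    ((ε • (X.transpose * X + (c ^ 2)⁻¹ • (1 : Matrix (Fin p) (Fin p) ℝ))
        + (Matrix.diagonal lam)⁻¹).det) ^ (-(1 / 2 : ℝ)) *
    nsNormConst c 0 ^ p * πτ t ≤ nsTauDens n p X y a b c πτ lam t := by
  unfold nsTauDens
  have h2 := (ns_D_posDef X c hc lam hl t ht0).det_pos
  have h2' := (ns_D_posDef X c hc lam hl ε (ht0.trans_le ht)).det_pos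
  have h3 := ns_pos c 0 le_rfl
  have hq := (ns_quad_bounds X y c hc lam hl t ht0).1
  refine mul_le_mul_of_nonneg_right ?_ (hπ t)
  refine mul_le_mul (mul_le_mul (ns_factor_bounds X y a b c ha hb hc lam hl t ht0).1 ?_
    (Real.rpow_nonneg h2'.le _) (Real.rpow_nonneg (by linarith) _))
    (pow_le_pow_left₀ h3.le (ns_anti c 0 t le_rfl ht0.le) p) (by positivity)
    (mul_nonneg (Real.rpow_nonneg (by linarith) _) (Real.rpow_nonneg h2.le _))
  exact Real.rpow_le_rpow_of_nonpos h2 (ns_D_mono X c hc lam hl t ε ht0 ht) (by norm_num)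

lemma ns_restrict (T : ℝ) (hT : 0 < T) (g : ℝ → ℝ) (hg : ∀ t ∈ Set.Ioo (0 : ℝ) T, g t = 0) :
    ∫ t in Set.Ioi (0 : ℝ), g t = ∫ t in Set.Ioi T, g t := by
  rw [← integral_Ici_eq_integral_Ioi (x := T)]
  refine setIntegral_eq_of_subset_of_forall_sdiff_eq_zero measurableSet_Ioi
    (fun t ht => hT.trans_le ht) fun t ht => hg t ⟨ht.1, not_le.1 ht.2⟩

/-- In the regularized Horseshoe variant of Nishimura and
Suchard, if the prior for `τ²` is truncated below at `T > 0` and satisfies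
`∫_T^∞ t^{δ/2}(1+t)^{p/2} π_τ(t) dt < ∞`, then the conditional posterior
`δ/2`-th moment of `τ²` given the local shrinkage parameters is bounded
uniformly in `Λ`. -/
theorem stmt9 (n p : ℕ) (X : Matrix (Fin n) (Fin p) ℝ) (y : Fin n → ℝ)
    (a b δ c : ℝ) (ha : 0 < a) (hb : 0 < b) (hδ : 0 < δ) (hc : c ≠ 0)
    (T : ℝ) (hT : 0 < T)
    (πτ : ℝ → ℝ) (hπ_nonneg : ∀ t, 0 ≤ πτ t)
    (hπ_prob : ∫ t in Set.Ioi (0 : ℝ), πτ t = 1)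
    (hvanish : ∀ t ∈ Set.Ioo (0 : ℝ) T, πτ t = 0)
    (hπ_mom : IntegrableOn
      (fun t => t ^ (δ / 2) * (1 + t) ^ ((p : ℝ) / 2) * πτ t) (Set.Ioi T))
    (ε : ℝ) (hε : T < ε) (hεπ : 0 < ∫ t in Set.Ioo T ε, πτ t) :
    ∃ C₃ : ℝ,
      ∀ lam : Fin p → ℝ, (∀ j, 0 < lam j) →
        (∫ t in Set.Ioi (0 : ℝ), t ^ (δ / 2) * nsTauDens n p X y a b c πτ lam t) ≤
          C₃ * ∫ t in Set.Ioi (0 : ℝ), nsTauDens n p X y a b c πτ lam t := by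
  classical
  have hy : 0 ≤ y ⬝ᵥ y := by simpa using dotProduct_star_self_nonneg y
  set K1 := (y ⬝ᵥ y / 2 + b) ^ (-(a + (n : ℝ) / 2)) with hK1
  set K2 := b ^ (-(a + (n : ℝ) / 2)) with hK2
  have hK1p : 0 < K1 := Real.rpow_pos_of_pos (by linarith) _
  have hK2p : 0 < K2 := Real.rpow_pos_of_pos hb _
  have hc0 : 0 < nsNormConst c 0 ^ p := pow_pos (ns_pos c 0 le_rfl) _
  have hc1 : 0 < nsNormConst c 1 ^ p := pow_pos (ns_pos c 1 zero_le_one) _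
  set I := ∫ t in Set.Ioi T, t ^ (δ / 2) * (1 + t) ^ ((p : ℝ) / 2) * πτ t with hI
  set J := ∫ t in Set.Ioo T ε, πτ t with hJ
  have hI0 : 0 ≤ I := by
    refine setIntegral_nonneg measurableSet_Ioi fun t ht => ?_
    have ht0 : 0 < t := hT.trans ht
    have := hπ_nonneg t
    positivity
  have hεp : 0 < ε := hT.trans hε
  have hπint : IntegrableOn πτ (Set.Ioi 0) :=
    Integrable.of_integral_ne_zero (by rw [hπ_prob]; exact one_ne_zero)
  set r := ((T / ε) ^ p) ^ (-(1 / 2 : ℝ)) with hr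
  refine ⟨K2 * r * nsNormConst c 1 ^ p * I / (K1 * nsNormConst c 0 ^ p * J), fun lam hl => ?_⟩
  have hDT := (ns_D_posDef X c hc lam hl T hT).det_pos
  have hDε := (ns_D_posDef X c hc lam hl ε hεp).det_pos
  have hscale := ns_D_scale X c hc lam hl T ε hT hε.le
  have hup := fun t ht => ns_dens_upper X y a b c ha hb hc lam hl πτ hπ_nonneg T t hT ht
  have hlow := fun t ht0 ht => ns_dens_lower X y a b c ha hb hc lam hl πτ hπ_nonneg ε t ht0 ht
  have hnn := fun t ht0 => ns_dens_nonneg X y a b c hb hc lam hl πτ hπ_nonneg t ht0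
  have hmeas := ns_aesm X y a b c hb hc lam hl πτ hπint.aestronglyMeasurable
  have hzero : ∀ t ∈ Set.Ioo (0 : ℝ) T, nsTauDens n p X y a b c πτ lam t = 0 := by
    intro t ht
    unfold nsTauDens
    rw [hvanish t ht, mul_zero]
  set dT := (T • (X.transpose * X + (c ^ 2)⁻¹ • (1 : Matrix (Fin p) (Fin p) ℝ))
        + (Matrix.diagonal lam)⁻¹).det
  set dε := (ε • (X.transpose * X + (c ^ 2)⁻¹ • (1 : Matrix (Fin p) (Fin p) ℝ))
        + (Matrix.diagonal lam)⁻¹).det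
  have hrd : dT ^ (-(1 / 2 : ℝ)) ≤ r * dε ^ (-(1 / 2 : ℝ)) := by
    rw [hr, ← Real.mul_rpow (by positivity) hDε.le]
    exact Real.rpow_le_rpow_of_nonpos (by positivity) hscale (by norm_num)
  rw [ns_restrict T hT _ hzero,
    ns_restrict T hT _ (fun t ht => by rw [hzero t ht, mul_zero])]
  have hf : IntegrableOn (nsTauDens n p X y a b c πτ lam) (Set.Ioi T) := by
    refine Integrable.mono' (hπ_mom.const_mul
      (K2 * dT ^ (-(1 / 2 : ℝ)) * nsNormConst c 1 ^ p * (T ^ (δ / 2))⁻¹))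
      (hmeas.mono_measure (Measure.restrict_mono (Set.Ioi_subset_Ioi hT.le) le_rfl)) ?_
    filter_upwards [ae_restrict_mem measurableSet_Ioi] with t ht
    have ht0 : 0 < t := hT.trans ht
    rw [Real.norm_of_nonneg (hnn t ht0)]
    refine (hup t (le_of_lt ht)).trans ?_
    rw [mul_assoc _ (T ^ (δ / 2))⁻¹]
    refine mul_le_mul_of_nonneg_left ?_ (by positivity)
    have h1 : 1 ≤ (T ^ (δ / 2))⁻¹ * t ^ (δ / 2) := by
      rw [inv_mul_eq_div, one_le_div (by positivity)]
      exact Real.rpow_le_rpow hT.le (le_of_lt ht) (by positivity)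
    have h2 : 0 ≤ (1 + t) ^ ((p : ℝ) / 2) * πτ t := mul_nonneg (by positivity) (hπ_nonneg t)
    calc _ ≤ ((T ^ (δ / 2))⁻¹ * t ^ (δ / 2)) * ((1 + t) ^ ((p : ℝ) / 2) * πτ t) :=
          le_mul_of_one_le_left h2 h1
      _ = _ := by ring
  have hnum : ∫ t in Set.Ioi T, t ^ (δ / 2) * nsTauDens n p X y a b c πτ lam t ≤
      K2 * dT ^ (-(1 / 2 : ℝ)) * nsNormConst c 1 ^ p * I := by
    rw [hI, ← integral_const_mul]
    refine integral_mono_of_nonneg ?_ (hπ_mom.const_mul _) ?_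
    · filter_upwards [ae_restrict_mem measurableSet_Ioi] with t ht
      have ht0 : 0 < t := hT.trans ht
      exact mul_nonneg (by positivity) (hnn t ht0)
    · filter_upwards [ae_restrict_mem measurableSet_Ioi] with t ht
      have ht0 : 0 < t := hT.trans ht
      refine (mul_le_mul_of_nonneg_left (hup t (le_of_lt ht)) (by positivity)).trans
        (le_of_eq ?_)
      ring
  have hden : K1 * dε ^ (-(1 / 2 : ℝ)) * nsNormConst c 0 ^ p * J ≤
      ∫ t in Set.Ioi T, nsTauDens n p X y a b c πτ lam t := by
    calc _ = ∫ t in Set.Ioo T ε, K1 * dε ^ (-(1 / 2 : ℝ)) * nsNormConst c 0 ^ p * πτ t := by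
          rw [integral_const_mul]
      _ ≤ ∫ t in Set.Ioo T ε, nsTauDens n p X y a b c πτ lam t := by
          refine setIntegral_mono_on ((hπint.mono_set fun t ht => hT.trans ht.1).const_mul _)
            (hf.mono_set fun t ht => ht.1) measurableSet_Ioo fun t ht => ?_
          exact hlow t (hT.trans ht.1) ht.2.le
      _ ≤ _ := by
          refine setIntegral_mono_set hf ?_ (Filter.Eventually.of_forall fun t ht => ht.1)
          filter_upwards [ae_restrict_mem measurableSet_Ioi] with t ht
          exact hnn t (hT.trans ht)
  have hr0 : 0 < r := by positivity
  calc _ ≤ K2 * dT ^ (-(1 / 2 : ℝ)) * nsNormConst c 1 ^ p * I := hnum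
    _ ≤ K2 * (r * dε ^ (-(1 / 2 : ℝ))) * nsNormConst c 1 ^ p * I := by gcongr
    _ = K2 * r * nsNormConst c 1 ^ p * I / (K1 * nsNormConst c 0 ^ p * J) *
        (K1 * dε ^ (-(1 / 2 : ℝ)) * nsNormConst c 0 ^ p * J) := by
        have := hK1p.ne'
        have := hc0.ne'
        have := hεπ.ne'
        field_simp
    _ ≤ _ := mul_le_mul_of_nonneg_left hden (by positivity)
end

section
/- For every d > 0 and every δ ∈ (0,1) there exists α > 0 such that for all λ² > 0 and all s > 0, ∫₀^∞ ν^{−2} exp[−(1 + d^{2/δ} + 1/λ²)/ν] / (√ν + s) dν ≥ α · (1 + 1/λ²)^{−2} / (1 + s). -/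
open MeasureTheory

lemma aux_integrable (A s : ℝ) (hA : 0 < A) (hs : 0 < s) :
    IntegrableOn (fun ν : ℝ => ν ^ (-(2 : ℝ)) * Real.exp (-A / ν) / (Real.sqrt ν + s))
      (Set.Ioi 0) := by
  have hm : Measurable (fun ν : ℝ => ν ^ (-(2 : ℝ)) * Real.exp (-A / ν) / (Real.sqrt ν + s)) := by
    fun_prop
  have hpos : ∀ ν : ℝ, 0 < ν → 0 ≤ ν ^ (-(2 : ℝ)) * Real.exp (-A / ν) / (Real.sqrt ν + s) := by
    intro ν hν
    positivity
  have hbd : ∀ ν : ℝ, 0 < ν → ν ^ (-(2 : ℝ)) * Real.exp (-A / ν) / (Real.sqrt ν + s)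
      ≤ ν ^ (-(2 : ℝ)) * Real.exp (-A / ν) / s := by
    intro ν hν
    have := Real.sqrt_nonneg ν
    gcongr
    linarith
  rw [← Set.Ioc_union_Ioi_eq_Ioi (zero_le_one (α := ℝ))]
  apply IntegrableOn.union
  · refine Measure.integrableOn_of_bounded (M := 2 / A ^ 2 / s) (by simp)
      hm.aestronglyMeasurable ?_
    filter_upwards [ae_restrict_mem measurableSet_Ioc] with ν hν
    have h0 := hν.1
    rw [Real.norm_of_nonneg (hpos ν h0)]
    refine (hbd ν h0).trans ?_
    gcongr
    have h1 := Real.quadratic_le_exp_of_nonneg (x := A / ν) (by positivity)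
    have h2 : 0 < A / ν := by positivity
    rw [neg_div, Real.exp_neg, Real.rpow_neg h0.le, Real.rpow_two, ← mul_inv,
      ← inv_div (A ^ 2) 2]
    apply inv_anti₀ (by positivity)
    have h3 : A ^ 2 / 2 = ν ^ 2 * ((A / ν) ^ 2 / 2) := by field_simp
    rw [h3]
    gcongr
    linarith
  · have hi : IntegrableOn (fun ν : ℝ => ν ^ (-(2 : ℝ)) / s) (Set.Ioi 1) :=
      (integrableOn_Ioi_rpow_of_lt (by norm_num) one_pos).div_const s
    refine Integrable.mono' hi hm.aestronglyMeasurable ?_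
    filter_upwards [ae_restrict_mem measurableSet_Ioi] with ν hν
    have h0 : 0 < ν := one_pos.trans hν
    rw [Real.norm_of_nonneg (hpos ν h0)]
    refine (hbd ν h0).trans ?_
    gcongr
    apply mul_le_of_le_one_right (by positivity)
    rw [Real.exp_le_one_iff, neg_div]
    have : 0 < A / ν := by positivity
    linarith

/-- For every `d > 0` and every `δ ∈ (0,1)` there exists
`α > 0` such that for all `λ² > 0` (written `l` below) and all `s > 0`,
`∫₀^∞ ν^{−2} exp[−(1 + d^{2/δ} + 1/λ²)/ν] / (√ν + s) dν
  ≥ α (1 + 1/λ²)^{−2} / (1 + s)`. -/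
theorem stmt11 (d δ : ℝ) (hd : 0 < d) (hδ : δ ∈ Set.Ioo (0 : ℝ) 1) :
    ∃ α : ℝ, 0 < α ∧ ∀ l : ℝ, 0 < l → ∀ s : ℝ, 0 < s →
      α * ((1 + 1 / l) ^ 2)⁻¹ / (1 + s) ≤
        ∫ ν in Set.Ioi (0 : ℝ),
          ν ^ (-(2 : ℝ)) * Real.exp (-(1 + d ^ (2 / δ) + 1 / l) / ν)
            / (Real.sqrt ν + s) := by
  have hD : 0 < d ^ (2 / δ) := by positivity
  generalize d ^ (2 / δ) = D at hD
  refine ⟨Real.exp (-1) / (8 * (1 + D) ^ 2), by positivity, ?_⟩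
  intro l hl s hs
  have hl' : 0 < 1 / l := by positivity
  generalize 1 / l = L at hl'
  have hAle : 1 + D + L ≤ (1 + D) * (1 + L) := by nlinarith [mul_pos hD hl']
  have hA1 : 1 < 1 + D + L := by linarith
  obtain ⟨A, hA⟩ : ∃ A, A = 1 + D + L := ⟨_, rfl⟩
  rw [← hA] at hAle hA1 ⊢
  have hA0 : 0 < A := by linarith
  have hint := aux_integrable A s hA0 hs
  have hsub : Set.Ioc A (2 * A) ⊆ Set.Ioi 0 := fun x hx => hA0.trans hx.1
  have hc : ∀ ν ∈ Set.Ioc A (2 * A), Real.exp (-1) / (8 * A ^ 3 * (1 + s)) ≤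
      ν ^ (-(2 : ℝ)) * Real.exp (-A / ν) / (Real.sqrt ν + s) := by
    intro ν hν
    have h0 : 0 < ν := hsub hν
    have e1 : Real.exp (-1) ≤ Real.exp (-A / ν) := by
      apply Real.exp_le_exp.2
      rw [neg_div]
      have : A / ν ≤ 1 := (div_le_one h0).2 hν.1.le
      linarith
    have e2 : Real.sqrt ν + s ≤ 2 * A * (1 + s) := by
      have : Real.sqrt ν ≤ 2 * A := by
        rw [Real.sqrt_le_left (by positivity)]
        nlinarith [hν.2]
      nlinarith
    have e3 : ((2 * A) ^ 2)⁻¹ ≤ ν ^ (-(2 : ℝ)) := by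
      rw [Real.rpow_neg h0.le, Real.rpow_two]
      apply inv_anti₀ (by positivity)
      have := hν.2
      gcongr
    have e4 : Real.exp (-1) / (8 * A ^ 3 * (1 + s)) =
        ((2 * A) ^ 2)⁻¹ * Real.exp (-1) / (2 * A * (1 + s)) := by
      field_simp
      norm_num
    rw [e4]
    have := Real.sqrt_nonneg ν
    gcongr
  calc Real.exp (-1) / (8 * (1 + D) ^ 2) * ((1 + L) ^ 2)⁻¹ / (1 + s)
      = Real.exp (-1) / (8 * ((1 + D) * (1 + L)) ^ 2 * (1 + s)) := by
        field_simp
    _ ≤ Real.exp (-1) / (8 * A ^ 2 * (1 + s)) := by gcongr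
    _ = ∫ ν in Set.Ioc A (2 * A), Real.exp (-1) / (8 * A ^ 3 * (1 + s)) := by
        rw [setIntegral_const, Real.volume_real_Ioc_of_le (by linarith), smul_eq_mul]
        field_simp
        ring
    _ ≤ ∫ ν in Set.Ioc A (2 * A), ν ^ (-(2 : ℝ)) * Real.exp (-A / ν) / (Real.sqrt ν + s) :=
        setIntegral_mono_on (integrableOn_const (by simp)) (hint.mono_set hsub)
          measurableSet_Ioc hc
    _ ≤ _ := by
        apply setIntegral_mono_set hint _ hsub.eventuallyLE
        filter_upwards [ae_restrict_mem measurableSet_Ioi] with ν hν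
        have h0 : 0 < ν := hν
        simp only [Pi.zero_apply]
        positivity
end

section
/- For every δ ∈ (0.00162, 0.22176), both of the following inequalities hold: (i) Γ(1 − δ/2) · Γ((1 + δ)/2) < √π; (ii) Γ(1 + δ/2) · ( Γ(1 − δ/2)^{−2/δ} + π^{1/δ} · Γ((1 − δ)/2)^{−2/δ} )^{−δ/2} < 1. -/
open Real in
/-- The ratio `Γ(x-s)Γ(x+s)/Γ(x)²`. -/
noncomputable def gammaRatio (s x : ℝ) : ℝ := Gamma (x - s) * Gamma (x + s) / Gamma x ^ 2

open Real in
theorem gammaRatio_step (s x : ℝ) (hs : 0 < s) (hx : s < x) :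
    gammaRatio s x = gammaRatio s (x + 1) * (x ^ 2 / (x ^ 2 - s ^ 2)) := by
  have h1 : Gamma (x + 1 - s) = (x - s) * Gamma (x - s) := by
    rw [← Gamma_add_one (by linarith)]; congr 1; ring
  have h2 : Gamma (x + 1 + s) = (x + s) * Gamma (x + s) := by
    rw [← Gamma_add_one (by linarith)]; congr 1; ring
  have h3 : Gamma (x + 1) = x * Gamma x := Gamma_add_one (by linarith)
  have hG : Gamma x ≠ 0 := (Gamma_pos_of_pos (by linarith)).ne'
  have hx0 : x ≠ 0 := by linarith
  have e1 : x - s ≠ 0 := by linarith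
  have e2 : x + s ≠ 0 := by linarith
  have e3 : x ^ 2 - s ^ 2 = (x - s) * (x + s) := by ring
  unfold gammaRatio
  rw [h1, h2, h3, e3]
  field_simp

open Real in
theorem gammaRatio_crude (s x : ℝ) (hs : 0 < s) (hs1 : s < 1) (hx : 1 < x) :
    gammaRatio s x ≤ x / (x - 1) := by
  have hG : 0 < Gamma x := Gamma_pos_of_pos (by linarith)
  have hG1 : 0 < Gamma (x - 1) := Gamma_pos_of_pos (by linarith)
  have a1 := Gamma_mul_add_mul_le_rpow_Gamma_mul_rpow_Gamma (s := x) (t := x + 1) (a := 1 - s)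
    (b := s) (by linarith) (by linarith) (by linarith) hs (by ring)
  have a2 := Gamma_mul_add_mul_le_rpow_Gamma_mul_rpow_Gamma (s := x) (t := x - 1) (a := 1 - s)
    (b := s) (by linarith) (by linarith) (by linarith) hs (by ring)
  have e1 : (1 - s) * x + s * (x + 1) = x + s := by ring
  have e2 : (1 - s) * x + s * (x - 1) = x - s := by ring
  have h3 : Gamma (x + 1) = x * Gamma x := Gamma_add_one (by linarith)
  have h4 : Gamma x = (x - 1) * Gamma (x - 1) := by
    rw [← Gamma_add_one (by linarith)]; congr 1; ring
  have h5 : Gamma (x - 1) = Gamma x / (x - 1) := by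
    rw [h4]; field_simp [show x - 1 ≠ 0 by linarith]
  rw [e1, h3, mul_rpow (by linarith) hG.le] at a1
  rw [e2, h5, div_rpow hG.le (by linarith)] at a2
  have h6 : Gamma x ^ (1 - s) * Gamma x ^ s = Gamma x := by
    rw [← rpow_add hG]; simp
  have b1 : Gamma (x + s) ≤ Gamma x * x ^ s := by
    calc _ ≤ _ := a1
      _ = (Gamma x ^ (1 - s) * Gamma x ^ s) * x ^ s := by ring
      _ = _ := by rw [h6]
  have b2 : Gamma (x - s) ≤ Gamma x / (x - 1) ^ s := by
    calc _ ≤ _ := a2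
      _ = (Gamma x ^ (1 - s) * Gamma x ^ s) / (x - 1) ^ s := by ring
      _ = _ := by rw [h6]
  have hp : 0 < (x - 1) ^ s := rpow_pos_of_pos (by linarith) _
  unfold gammaRatio
  rw [div_le_iff₀ (by positivity)]
  calc Gamma (x - s) * Gamma (x + s) ≤ Gamma x / (x - 1) ^ s * (Gamma x * x ^ s) := by
        apply mul_le_mul b2 b1 (Gamma_pos_of_pos (by linarith)).le (by positivity)
    _ = (x ^ s / (x - 1) ^ s) * Gamma x ^ 2 := by ring
    _ = (x / (x - 1)) ^ s * Gamma x ^ 2 := by rw [div_rpow (by linarith) (by linarith)]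
    _ ≤ (x / (x - 1)) ^ (1 : ℝ) * Gamma x ^ 2 := by
        gcongr
        · rw [le_div_iff₀ (by linarith)]; linarith
    _ = _ := by rw [rpow_one]

/-- Upper comparison function for `gammaRatio`. -/
noncomputable def gammaCmp (s x : ℝ) : ℝ := (x - 1 / 2 + s ^ 2 / 2) / (x - 1 / 2 - s ^ 2 / 2)

theorem gammaCmp_step (s x : ℝ) (hs : 0 < s) (hs1 : s < 1) (hx : 2 ≤ x) :
    gammaCmp s (x + 1) * (x ^ 2 / (x ^ 2 - s ^ 2)) ≤ gammaCmp s x := by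
  have hs2 : s ^ 2 < 1 := by nlinarith
  have hx2 : 0 < x ^ 2 - s ^ 2 := by nlinarith
  unfold gammaCmp
  rw [div_mul_div_comm, div_le_div_iff₀ (mul_pos (by linarith) hx2) (by linarith)]
  have : (x - 1 / 2 + s ^ 2 / 2) * ((x + 1 - 1 / 2 - s ^ 2 / 2) * (x ^ 2 - s ^ 2))
      - (x + 1 - 1 / 2 + s ^ 2 / 2) * x ^ 2 * (x - 1 / 2 - s ^ 2 / 2)
      = s ^ 2 * (1 / 2 - s ^ 2 / 2) ^ 2 := by ring
  have h2 : 0 ≤ s ^ 2 * (1 / 2 - s ^ 2 / 2) ^ 2 := by positivity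
  linarith

theorem gammaRatio_iter (s : ℝ) (hs : 0 < s) (hs1 : s < 1) (n : ℕ) :
    ∀ x : ℝ, 2 ≤ x → gammaRatio s x * gammaCmp s (x + n) ≤ gammaRatio s (x + n) * gammaCmp s x := by
  have hs2 : s ^ 2 < 1 := by nlinarith
  have gpos : ∀ x : ℝ, 2 ≤ x → 0 < gammaCmp s x := fun x hx =>
    div_pos (by nlinarith) (by nlinarith)
  have fpos : ∀ x : ℝ, 2 ≤ x → 0 < gammaRatio s x := fun x hx =>
    div_pos (mul_pos (Real.Gamma_pos_of_pos (by linarith)) (Real.Gamma_pos_of_pos (by linarith)))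
      (pow_pos (Real.Gamma_pos_of_pos (by linarith)) 2)
  induction n with
  | zero => intro x hx; simp
  | succ k ih =>
    intro x hx
    have h1 := ih (x + 1) (by linarith)
    have e : x + ((k + 1 : ℕ) : ℝ) = x + 1 + k := by push_cast; ring
    rw [e]
    have hc := gammaCmp_step s x hs hs1 hx
    have hx2 : 0 < x ^ 2 - s ^ 2 := by nlinarith
    have hq : 0 ≤ x ^ 2 / (x ^ 2 - s ^ 2) := by positivity
    have hk : (0 : ℝ) ≤ k := Nat.cast_nonneg k
    rw [gammaRatio_step s x hs (by linarith)]
    calc gammaRatio s (x + 1) * (x ^ 2 / (x ^ 2 - s ^ 2)) * gammaCmp s (x + 1 + k)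
        = (gammaRatio s (x + 1) * gammaCmp s (x + 1 + k)) * (x ^ 2 / (x ^ 2 - s ^ 2)) := by ring
      _ ≤ (gammaRatio s (x + 1 + k) * gammaCmp s (x + 1)) * (x ^ 2 / (x ^ 2 - s ^ 2)) := by
          gcongr
      _ = gammaRatio s (x + 1 + k) * (gammaCmp s (x + 1) * (x ^ 2 / (x ^ 2 - s ^ 2))) := by ring
      _ ≤ _ := by
          have := (fpos (x + 1 + k) (by linarith)).le
          gcongr

open Filter Topology in
theorem gammaRatio_le (s x : ℝ) (hs : 0 < s) (hs1 : s < 1) (hx : 2 ≤ x) :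
    gammaRatio s x ≤ gammaCmp s x := by
  have hs2 : s ^ 2 < 1 := by nlinarith
  have gpos : 0 < gammaCmp s x := div_pos (by nlinarith) (by nlinarith)
  have fpos : 0 < gammaRatio s x :=
    div_pos (mul_pos (Real.Gamma_pos_of_pos (by linarith)) (Real.Gamma_pos_of_pos (by linarith)))
      (pow_pos (Real.Gamma_pos_of_pos (by linarith)) 2)
  have key : ∀ n : ℕ, gammaRatio s x ≤ (1 + 1 / ((n : ℝ) + 1)) * gammaCmp s x := by
    intro n
    have hn : (0 : ℝ) ≤ n := Nat.cast_nonneg n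
    have h := gammaRatio_iter s hs hs1 n x hx
    have h1 : 1 ≤ gammaCmp s (x + n) := by
      unfold gammaCmp
      rw [le_div_iff₀ (by nlinarith)]
      nlinarith
    have h2 := gammaRatio_crude s (x + n) hs hs1 (by linarith)
    have h3 : (x + n) / (x + n - 1) ≤ 1 + 1 / ((n : ℝ) + 1) := by
      have : (x + n) / (x + n - 1) = 1 + 1 / (x + n - 1) := by
        field_simp [show x + n - 1 ≠ 0 by linarith]
        ring
      rw [this]
      gcongr
      linarith
    calc gammaRatio s x ≤ gammaRatio s x * gammaCmp s (x + n) := le_mul_of_one_le_right fpos.le h1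
      _ ≤ _ := h
      _ ≤ _ := by
        gcongr
        exact h2.trans h3
  have lim : Tendsto (fun n : ℕ => (1 + 1 / ((n : ℝ) + 1)) * gammaCmp s x) atTop
      (𝓝 ((1 + 0) * gammaCmp s x)) :=
    (tendsto_const_nhds.add tendsto_one_div_add_atTop_nhds_zero_nat).mul_const _
  have := ge_of_tendsto' lim key
  simpa using this

theorem gammaRatio_le_prod (s : ℝ) (hs : 0 < s) (n : ℕ) :
    ∀ x : ℝ, s < x → gammaRatio s x
      = gammaRatio s (x + n) * ∏ k ∈ Finset.range n, ((x + k) ^ 2 / ((x + k) ^ 2 - s ^ 2)) := by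
  induction n with
  | zero => intro x hx; simp
  | succ k ih =>
    intro x hx
    have hk : (0 : ℝ) ≤ k := Nat.cast_nonneg k
    rw [ih x hx, Finset.prod_range_succ, gammaRatio_step s (x + k) hs (by linarith)]
    push_cast
    rw [show x + ((k : ℝ) + 1) = x + k + 1 by ring]
    ring

theorem ratio_bound1 : gammaRatio (693 / 6250) 1 ≤ 10205134714 / 10 ^ 10 := by
  rw [gammaRatio_le_prod (693 / 6250) (by norm_num) 30 1 (by norm_num)]
  have h := gammaRatio_le (693 / 6250) (1 + (30 : ℕ)) (by norm_num) (by norm_num) (by norm_num)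
  refine (mul_le_mul_of_nonneg_right h ?_).trans ?_
  · apply Finset.prod_nonneg
    intro k _
    have hk : (0 : ℝ) ≤ k := Nat.cast_nonneg k
    apply div_nonneg (by positivity)
    nlinarith
  · unfold gammaCmp
    norm_num [Finset.prod_range_succ]

theorem ratio_bound2 : gammaRatio (693 / 6250) (1 - 693 / 6250) ≤ 10244970374 / 10 ^ 10 := by
  rw [gammaRatio_le_prod (693 / 6250) (by norm_num) 30 _ (by norm_num)]
  have h := gammaRatio_le (693 / 6250) (1 - 693 / 6250 + (30 : ℕ)) (by norm_num) (by norm_num)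
    (by norm_num)
  refine (mul_le_mul_of_nonneg_right h ?_).trans ?_
  · apply Finset.prod_nonneg
    intro k _
    have hk : (0 : ℝ) ≤ k := Nat.cast_nonneg k
    apply div_nonneg (by positivity)
    nlinarith
  · unfold gammaCmp
    norm_num [Finset.prod_range_succ]

set_option exponentiation.threshold 10000 in
theorem pow_bound1_nat : 10205134714 ^ 6250 * 10000000 ^ 693
    < 12009762 ^ 693 * 10000000000 ^ 6250 := by
  norm_num

set_option exponentiation.threshold 10000 in
theorem pow_bound2_nat : 10244970374 ^ 6250 * 8039048 ^ 693
    < 10000000 ^ 693 * 10000000000 ^ 6250 := by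
  norm_num

open Real in
theorem log_bound1 : 6250 / 693 * log (10205134714 / 10 ^ 10) < log (12009762 / 10000000) := by
  have h : (6250 : ℕ) * log (10205134714 / 10 ^ 10) < (693 : ℕ) * log (12009762 / 10000000) := by
    rw [← log_pow, ← log_pow]
    apply log_lt_log (by positivity)
    rw [div_pow, div_pow, div_lt_div_iff₀ (by positivity) (by positivity)]
    have := pow_bound1_nat
    have h2 : ((10205134714 ^ 6250 * 10000000 ^ 693 : ℕ) : ℝ)
      < ((12009762 ^ 693 * 10000000000 ^ 6250 : ℕ) : ℝ) := Nat.cast_lt.mpr this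
    have e : (10 : ℝ) ^ 10 = 10000000000 := by norm_num
    rw [e]
    simpa only [Nat.cast_mul, Nat.cast_pow, Nat.cast_ofNat] using h2
  push_cast at h
  linarith

open Real in
theorem log_bound2 : 6250 / 693 * log (10244970374 / 10 ^ 10) < - log (8039048 / 10000000) := by
  have h : (6250 : ℕ) * log (10244970374 / 10 ^ 10) + (693 : ℕ) * log (8039048 / 10000000) < 0 := by
    rw [← log_pow, ← log_pow, ← log_mul (by positivity) (by positivity)]
    apply log_neg (by positivity)
    rw [div_pow, div_pow, div_mul_div_comm, div_lt_one (by positivity)]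
    have := pow_bound2_nat
    have h2 : ((10244970374 ^ 6250 * 8039048 ^ 693 : ℕ) : ℝ)
      < ((10000000 ^ 693 * 10000000000 ^ 6250 : ℕ) : ℝ) := Nat.cast_lt.mpr this
    have e : (10 : ℝ) ^ 10 = 10000000000 := by norm_num
    rw [e, mul_comm (10000000000 ^ 6250 : ℝ)]
    simpa only [Nat.cast_mul, Nat.cast_pow, Nat.cast_ofNat] using h2
  push_cast at h
  linarith

open Real in
/-- The inequality at the right endpoint. -/
theorem endpoint (s p : ℝ) (hs : s = 693 / 6250) (hp : p = 6250 / 693) :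
    exp (p * log (Gamma (1 + s))) < exp (-(p * log (Gamma (1 - s)))) +
      exp (p * (log (Gamma (1 / 2)) - log (Gamma (1 / 2 - s)))) := by
  have hs0 : 0 < s := by rw [hs]; norm_num
  have hs1 : s < 1 / 4 := by rw [hs]; norm_num
  have hp0 : 0 < p := by rw [hp]; norm_num
  have hps : p * s = 1 := by rw [hp, hs]; norm_num
  have g1 : 0 < Gamma (1 + s) := Gamma_pos_of_pos (by linarith)
  have g2 : 0 < Gamma (1 - s) := Gamma_pos_of_pos (by linarith)
  have g3 : 0 < Gamma (1 / 2 - s) := Gamma_pos_of_pos (by linarith)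
  have g4 : 0 < Gamma (1 - 2 * s) := Gamma_pos_of_pos (by linarith)
  have gh : 0 < Gamma (1 / 2) := Gamma_pos_of_pos (by norm_num)
  have f1 : log (Gamma (1 - s)) + log (Gamma (1 + s)) ≤ log (10205134714 / 10 ^ 10) := by
    rw [← log_mul g2.ne' g1.ne']
    apply log_le_log (by positivity)
    have := ratio_bound1
    rw [← hs] at this
    unfold gammaRatio at this
    simpa using this
  have f2 : log (Gamma (1 - 2 * s)) - 2 * log (Gamma (1 - s)) ≤ log (10244970374 / 10 ^ 10) := by
    have e : (2 : ℝ) * log (Gamma (1 - s)) = log (Gamma (1 - s) ^ 2) := by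
      rw [log_pow]; norm_num
    rw [e, ← log_div g4.ne' (by positivity)]
    apply log_le_log (by positivity)
    have := ratio_bound2
    rw [← hs] at this
    unfold gammaRatio at this
    rw [show 1 - s + s = 1 by ring, show 1 - s - s = 1 - 2 * s by ring, Gamma_one, mul_one] at this
    exact this
  have dup : log (Gamma (1 / 2 - s)) + log (Gamma (1 - s))
      = log (Gamma (1 - 2 * s)) + 2 * s * log 2 + log (Gamma (1 / 2)) := by
    have h := Gamma_mul_Gamma_add_half (1 / 2 - s)
    rw [show 1 / 2 - s + 1 / 2 = 1 - s by ring, show 2 * (1 / 2 - s) = 1 - 2 * s by ring,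
      show 1 - (1 - 2 * s) = 2 * s by ring, ← Gamma_one_half_eq] at h
    have h' := congrArg log h
    rw [log_mul g3.ne' g2.ne', log_mul (by positivity) gh.ne', log_mul g4.ne' (by positivity),
      log_rpow (by norm_num)] at h'
    exact h'
  have k1 : p * (log (Gamma (1 - s)) + log (Gamma (1 + s))) < log (12009762 / 10000000) := by
    refine (mul_le_mul_of_nonneg_left f1 hp0.le).trans_lt ?_
    rw [hp]; exact log_bound1
  have k2 : p * (log (Gamma (1 - 2 * s)) - 2 * log (Gamma (1 - s)))
      < - log (8039048 / 10000000) := by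
    refine (mul_le_mul_of_nonneg_left f2 hp0.le).trans_lt ?_
    rw [hp]; exact log_bound2
  have K1 : exp (p * (log (Gamma (1 - s)) + log (Gamma (1 + s)))) < 12009762 / 10000000 := by
    rw [← lt_log_iff_exp_lt (by norm_num)]; exact k1
  have K2 : 2009762 / 10000000 <
      exp (p * (log (Gamma (1 / 2)) - log (Gamma (1 / 2 - s)) + log (Gamma (1 - s)))) := by
    rw [← log_lt_iff_lt_exp (by norm_num)]
    have e : log ((8039048 : ℝ) / 10000000) = log (2009762 / 10000000) + 2 * log 2 := by
      rw [show (2 : ℝ) * log 2 = log (2 ^ 2) by rw [log_pow]; norm_num,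
        ← log_mul (by norm_num) (by norm_num)]
      norm_num
    have e2 : log (Gamma (1 / 2)) - log (Gamma (1 / 2 - s)) + log (Gamma (1 - s))
      = -(log (Gamma (1 - 2 * s)) - 2 * log (Gamma (1 - s))) - 2 * s * log 2 := by linarith
    have e3 : p * (2 * s * log 2) = 2 * log 2 := by
      calc p * (2 * s * log 2) = 2 * (p * s) * log 2 := by ring
        _ = _ := by rw [hps]; ring
    rw [e2, mul_sub, e3]
    linarith
  set E := exp (-(p * log (Gamma (1 - s)))) with hE
  have E0 : 0 < E := exp_pos _
  have r1 : exp (p * log (Gamma (1 + s)))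
      = E * exp (p * (log (Gamma (1 - s)) + log (Gamma (1 + s)))) := by
    rw [hE, ← exp_add]; congr 1; ring
  have r2 : exp (p * (log (Gamma (1 / 2)) - log (Gamma (1 / 2 - s))))
      = E * exp (p * (log (Gamma (1 / 2)) - log (Gamma (1 / 2 - s)) + log (Gamma (1 - s)))) := by
    rw [hE, ← exp_add]; congr 1; ring
  rw [r1, r2]
  nlinarith

open Real in
theorem part_one (t : ℝ) (h0 : 0 < t) (h1 : t < 1 / 4) :
    Gamma (1 - t) * Gamma (1 / 2 + t) < √π := by
  have a1 := Gamma_mul_add_mul_le_rpow_Gamma_mul_rpow_Gamma (s := 2) (t := 3 / 2) (a := 1 - 2 * t)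
    (b := 2 * t) (by norm_num) (by norm_num) (by linarith) (by linarith) (by ring)
  have a2 := Gamma_mul_add_mul_le_rpow_Gamma_mul_rpow_Gamma (s := 3 / 2) (t := 2) (a := 1 - 2 * t)
    (b := 2 * t) (by norm_num) (by norm_num) (by linarith) (by linarith) (by ring)
  have h32 : Gamma (3 / 2) = 1 / 2 * √π := by
    rw [show (3 / 2 : ℝ) = 1 / 2 + 1 by norm_num, Gamma_add_one (by norm_num), Gamma_one_half_eq]
  have hpos : 0 < Gamma (3 / 2) := Gamma_pos_of_pos (by norm_num)
  have sp : 0 < √π := by positivity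
  rw [Gamma_two, one_rpow, one_mul, show (1 - 2 * t) * 2 + 2 * t * (3 / 2) = (1 - t) + 1 by ring,
    Gamma_add_one (by linarith)] at a1
  rw [Gamma_two, one_rpow, mul_one, show (1 - 2 * t) * (3 / 2) + 2 * t * 2 = (1 / 2 + t) + 1 by ring,
    Gamma_add_one (by linarith)] at a2
  have g1 : 0 < Gamma (1 - t) := Gamma_pos_of_pos (by linarith)
  have g2 : 0 < Gamma (1 / 2 + t) := Gamma_pos_of_pos (by linarith)
  have h := mul_le_mul a1 a2 (mul_nonneg (by linarith) g2.le) (by positivity)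
  rw [← rpow_add hpos, show 2 * t + (1 - 2 * t) = 1 by ring, rpow_one, h32] at h
  have h3 : 1 / 2 < (1 - t) * (1 / 2 + t) := by nlinarith
  have h4 := mul_pos g1 g2
  nlinarith [mul_lt_mul_of_pos_right h3 h4]

open Real in
theorem stmt17_aux (t s : ℝ) (h0 : 0 < t) (hts : t < s) (hs : s = 693 / 6250) :
    exp (1 / t * log (Gamma (1 + t))) < exp (-(1 / t * log (Gamma (1 - t)))) +
      exp (1 / t * (log (Gamma (1 / 2)) - log (Gamma (1 / 2 - t)))) := by
  have hs1 : s < 1 / 4 := by rw [hs]; norm_num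
  have hc := convexOn_log_Gamma
  have m1 := hc.secant_mono (a := 1) (x := 1 + t) (y := 1 + s) (by simp)
    (Set.mem_Ioi.2 (by linarith)) (Set.mem_Ioi.2 (by linarith)) (by linarith) (by linarith)
    (by linarith)
  have m2 := hc.secant_mono (a := 1) (x := 1 - s) (y := 1 - t) (by simp)
    (Set.mem_Ioi.2 (by linarith)) (Set.mem_Ioi.2 (by linarith)) (by linarith) (by linarith)
    (by linarith)
  have m3 := hc.secant_mono (a := 1 / 2) (x := 1 / 2 - s) (y := 1 / 2 - t) (by simp)
    (Set.mem_Ioi.2 (by linarith)) (Set.mem_Ioi.2 (by linarith)) (by linarith) (by linarith)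
    (by linarith)
  simp only [Function.comp_apply, Gamma_one, log_one, sub_zero] at m1 m2 m3
  rw [show 1 + t - 1 = t by ring, show 1 + s - 1 = s by ring] at m1
  rw [show 1 - t - 1 = -t by ring, show 1 - s - 1 = -s by ring, div_neg, div_neg] at m2
  rw [show 1 / 2 - t - 1 / 2 = -t by ring, show 1 / 2 - s - 1 / 2 = -s by ring,
    div_neg, div_neg] at m3
  have e := endpoint s (1 / s) hs (by rw [hs]; norm_num)
  have n1 : exp (1 / t * log (Gamma (1 + t))) ≤ exp (1 / s * log (Gamma (1 + s))) := by
    apply exp_le_exp.2; rw [one_div_mul_eq_div, one_div_mul_eq_div]; exact m1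
  have n2 : exp (-(1 / s * log (Gamma (1 - s)))) ≤ exp (-(1 / t * log (Gamma (1 - t)))) := by
    apply exp_le_exp.2; rw [one_div_mul_eq_div, one_div_mul_eq_div]; exact m2
  have n3 : exp (1 / s * (log (Gamma (1 / 2)) - log (Gamma (1 / 2 - s))))
      ≤ exp (1 / t * (log (Gamma (1 / 2)) - log (Gamma (1 / 2 - t)))) := by
    apply exp_le_exp.2
    rw [one_div_mul_eq_div, one_div_mul_eq_div, ← neg_sub, ← neg_sub (log (Gamma (1 / 2 - t))),
      neg_div, neg_div]
    exact m3
  linarith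

/-- For every `δ ∈ (0.00162, 0.22176)`:
(i) `Γ(1 − δ/2) Γ((1 + δ)/2) < √π`, and
(ii) `Γ(1 + δ/2) (Γ(1 − δ/2)^{−2/δ} + π^{1/δ} Γ((1 − δ)/2)^{−2/δ})^{−δ/2} < 1`.
These are the drift rates `γ(δ₀)` (divided by `√π`) and `γ(δ₁)` in the
geometric drift condition for the Horseshoe Gibbs sampler. -/
theorem stmt17 (δ : ℝ) (hδ : δ ∈ Set.Ioo (0.00162 : ℝ) 0.22176) :
    Real.Gamma (1 - δ / 2) * Real.Gamma ((1 + δ) / 2) < Real.sqrt Real.pi ∧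
    Real.Gamma (1 + δ / 2) *
      (Real.Gamma (1 - δ / 2) ^ (-(2 / δ)) +
        Real.pi ^ (1 / δ) * Real.Gamma ((1 - δ) / 2) ^ (-(2 / δ))) ^ (-(δ / 2))
      < 1 := by
  obtain ⟨hl, hu⟩ := hδ
  norm_num at hl hu
  obtain ⟨t, rfl⟩ : ∃ t, δ = 2 * t := ⟨δ / 2, by ring⟩
  have ht0 : 0 < t := by linarith
  have hts : t < 693 / 6250 := by linarith
  have e1 : 2 * t / 2 = t := by ring
  have e2 : 2 / (2 * t) = 1 / t := by field_simp
  have e3 : (1 + 2 * t) / 2 = 1 / 2 + t := by ring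
  have e4 : (1 - 2 * t) / 2 = 1 / 2 - t := by ring
  rw [e1, e2, e3, e4]
  refine ⟨part_one t ht0 (by linarith), ?_⟩
  have aux := stmt17_aux t _ ht0 hts rfl
  have g1 : 0 < Real.Gamma (1 + t) := Real.Gamma_pos_of_pos (by linarith)
  have g2 : 0 < Real.Gamma (1 - t) := Real.Gamma_pos_of_pos (by linarith)
  have g3 : 0 < Real.Gamma (1 / 2 - t) := Real.Gamma_pos_of_pos (by linarith)
  have r2 : Real.Gamma (1 - t) ^ (-(1 / t)) = Real.exp (-(1 / t * Real.log (Real.Gamma (1 - t)))) := by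
    rw [Real.rpow_def_of_pos g2]; congr 1; ring
  have r3 : Real.pi ^ (1 / (2 * t)) * Real.Gamma (1 / 2 - t) ^ (-(1 / t)) =
      Real.exp (1 / t * (Real.log (Real.Gamma (1 / 2)) - Real.log (Real.Gamma (1 / 2 - t)))) := by
    rw [Real.rpow_def_of_pos g3, Real.rpow_def_of_pos Real.pi_pos, ← Real.exp_add,
      Real.Gamma_one_half_eq, Real.log_sqrt Real.pi_pos.le]
    congr 1
    field_simp
    ring
  rw [r2, r3]
  set S := Real.exp (-(1 / t * Real.log (Real.Gamma (1 - t)))) +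
    Real.exp (1 / t * (Real.log (Real.Gamma (1 / 2)) - Real.log (Real.Gamma (1 / 2 - t)))) with hS
  have S0 : 0 < S := by positivity
  have hlog : 1 / t * Real.log (Real.Gamma (1 + t)) < Real.log S :=
    (Real.lt_log_iff_exp_lt S0).2 aux
  have hlog2 : Real.log (Real.Gamma (1 + t)) < t * Real.log S := by
    have := mul_lt_mul_of_pos_left hlog ht0
    rwa [← mul_assoc, mul_one_div_cancel ht0.ne', one_mul] at this
  have fin : Real.Gamma (1 + t) * S ^ (-t)
      = Real.exp (Real.log (Real.Gamma (1 + t)) - t * Real.log S) := by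
    rw [Real.rpow_def_of_pos S0, sub_eq_add_neg, Real.exp_add, Real.exp_log g1]
    congr 2; ring
  rw [fin]
  rw [Real.exp_lt_one_iff]
  linarith
end

section
/- For every c > 0 and every δ ∈ (0,1), the function y ↦ (c + y^{−2/δ})^{−δ/2} is concave on the interval (0,∞). -/
/-- For every `c > 0` and every `δ ∈ (0,1)`, the function
`y ↦ (c + y^{−2/δ})^{−δ/2}` is concave on `(0, ∞)`. -/
theorem stmt18 (c δ : ℝ) (hc : 0 < c) (hδ : δ ∈ Set.Ioo (0 : ℝ) 1) :
    ConcaveOn ℝ (Set.Ioi (0 : ℝ))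
      (fun y : ℝ => (c + y ^ (-(2 / δ))) ^ (-(δ / 2))) := by
  have hd : 0 < δ := hδ.1
  have key : ∀ y : ℝ, 0 < y → HasDerivAt (fun y : ℝ => (c + y ^ (-(2 / δ))) ^ (-(δ / 2)))
      ((c * y ^ (2 / δ) + 1) ^ (-(δ / 2) - 1)) y := by
    intro y hy
    have hp : 0 < y ^ (-(2 / δ)) := Real.rpow_pos_of_pos hy _
    have hq : 0 < y ^ (2 / δ) := Real.rpow_pos_of_pos hy _
    have h1 := ((Real.hasDerivAt_rpow_const (x := y) (p := -(2 / δ))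
      (Or.inl hy.ne')).const_add c).rpow_const (p := -(δ / 2)) (Or.inl (by positivity))
    convert h1 using 1
    have e1 : c * y ^ (2 / δ) + 1 = (c + y ^ (-(2 / δ))) * y ^ (2 / δ) := by
      rw [add_mul, ← Real.rpow_add hy]; simp
    have e2 : (y ^ (2 / δ)) ^ (-(δ / 2) - 1) = y ^ (-(2 / δ) - 1) := by
      rw [← Real.rpow_mul hy.le]; congr 1; field_simp; ring
    rw [e1, Real.mul_rpow (by positivity) hq.le, e2]
    field_simp
  apply AntitoneOn.concaveOn_of_deriv (convex_Ioi 0)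
  · exact fun y hy => (key y hy).continuousAt.continuousWithinAt
  · rw [interior_Ioi]
    exact fun y hy => (key y hy).differentiableAt.differentiableWithinAt
  · rw [interior_Ioi]
    intro x hx y hy hxy
    rw [(key x hx).deriv, (key y hy).deriv]
    have hx0 : 0 < x := hx
    apply Real.rpow_le_rpow_of_nonpos
    · positivity
    · gcongr
    · have : 0 < δ / 2 := by positivity
      linarith
end

section
/- Let B₁ and B₂ be p×p real symmetric positive semidefinite matrices. Then the function t ↦ det(B₁ + t⁻¹ I_p) / det(B₁ + B₂ + t⁻¹ I_p) is nonincreasing on (0,∞). -/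
open Matrix

lemma aux_one {n : ℕ} {R : Matrix (Fin n) (Fin n) ℝ} (h : R.PosSemidef) : 1 ≤ (1 + R).det := by
  have e := h.1.spectral_theorem
  rw [Unitary.conjStarAlgAut_apply] at e
  rw [e, Matrix.mul_assoc, Matrix.det_one_add_mul_comm, Matrix.mul_assoc,
    Unitary.coe_star_mul_self, Matrix.mul_one, ← Matrix.diagonal_one, Matrix.diagonal_add,
    Matrix.det_diagonal]
  rw [← Finset.prod_const_one (s := (Finset.univ : Finset (Fin n)))]
  refine Finset.prod_le_prod (fun _ _ => zero_le_one) fun i _ => ?_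
  have := h.eigenvalues_nonneg i
  simpa using this

lemma aux_sqrt {n : ℕ} {R : Matrix (Fin n) (Fin n) ℝ} (h : R.PosSemidef) :
    ∃ M : Matrix (Fin n) (Fin n) ℝ, R = Mᴴ * M := by
  open scoped MatrixOrder in
  exact CStarAlgebra.nonneg_iff_eq_star_mul_self.mp h.nonneg

lemma aux_mono_s19 {n : ℕ} {P Q : Matrix (Fin n) (Fin n) ℝ} (hP : P.PosDef) (hQ : Q.PosSemidef) :
    P.det ≤ (P + Q).det := by
  obtain ⟨M, rfl⟩ := aux_sqrt hQ
  rw [Matrix.det_add_mul _ _ hP.det_pos.ne'.isUnit]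
  exact le_mul_of_one_le_right hP.det_pos.le
    (aux_one (hP.inv.posSemidef.mul_mul_conjTranspose_same M))

lemma aux_inv {n : ℕ} {X D : Matrix (Fin n) (Fin n) ℝ} (hX : X.PosDef) (hD : D.PosSemidef) :
    (X⁻¹ - (X + D)⁻¹).PosSemidef := by
  have hY : (X + D).PosDef := hX.add_posSemidef hD
  have uX : IsUnit X.det := hX.det_pos.ne'.isUnit
  have uY : IsUnit (X + D).det := hY.det_pos.ne'.isUnit
  have h1 : (D + D * X⁻¹ * D).PosSemidef := by
    have := hX.inv.posSemidef.mul_mul_conjTranspose_same D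
    rw [hD.1.eq] at this
    exact hD.add this
  have h2 := h1.mul_mul_conjTranspose_same (X + D)⁻¹
  rw [hY.inv.1.eq] at h2
  convert h2 using 1
  have e1 : D + D * X⁻¹ * D = D * X⁻¹ * (X + D) := by
    rw [Matrix.mul_add, Matrix.mul_assoc D X⁻¹ X, Matrix.nonsing_inv_mul _ uX, Matrix.mul_one]
  have e2 : (X + D)⁻¹ * D = 1 - (X + D)⁻¹ * X := by
    rw [← Matrix.nonsing_inv_mul _ uY, Matrix.mul_add]; abel
  rw [e1, Matrix.mul_assoc, Matrix.mul_assoc (D * X⁻¹), Matrix.mul_nonsing_inv _ uY,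
    Matrix.mul_one, ← Matrix.mul_assoc, e2, Matrix.sub_mul, Matrix.one_mul, Matrix.mul_assoc,
    Matrix.mul_nonsing_inv _ uX, Matrix.mul_one]

lemma aux_main {n : ℕ} {A B C : Matrix (Fin n) (Fin n) ℝ} (hA : A.PosDef) (hB : B.PosSemidef)
    (hC : C.PosSemidef) : A.det * (A + C + B).det ≤ (A + C).det * (A + B).det := by
  have hY : (A + C).PosDef := hA.add_posSemidef hC
  obtain ⟨M, rfl⟩ := aux_sqrt hB
  rw [Matrix.det_add_mul _ _ hA.det_pos.ne'.isUnit, Matrix.det_add_mul _ _ hY.det_pos.ne'.isUnit]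
  have h1 : (1 + M * (A + C)⁻¹ * Mᴴ).PosDef :=
    Matrix.PosDef.one.add_posSemidef (hY.inv.posSemidef.mul_mul_conjTranspose_same M)
  have h2 := aux_mono_s19 h1 ((aux_inv hA hC).mul_mul_conjTranspose_same M)
  have e : 1 + M * (A + C)⁻¹ * Mᴴ + M * (A⁻¹ - (A + C)⁻¹) * Mᴴ = 1 + M * A⁻¹ * Mᴴ := by
    rw [Matrix.mul_sub, Matrix.sub_mul]; abel
  rw [e] at h2
  have := mul_le_mul_of_nonneg_left h2 (mul_pos hA.det_pos hY.det_pos).le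
  linarith

/-- For `p×p` real symmetric positive semidefinite matrices
`B₁` and `B₂`, the function `t ↦ det(B₁ + t⁻¹ I) / det(B₁ + B₂ + t⁻¹ I)` is
nonincreasing on `(0, ∞)`. -/
theorem stmt19 (p : ℕ) (B1 B2 : Matrix (Fin p) (Fin p) ℝ)
    (h1 : B1.PosSemidef) (h2 : B2.PosSemidef) :
    AntitoneOn
      (fun t : ℝ =>
        (B1 + t⁻¹ • (1 : Matrix (Fin p) (Fin p) ℝ)).det /
          (B1 + B2 + t⁻¹ • (1 : Matrix (Fin p) (Fin p) ℝ)).det)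
      (Set.Ioi (0 : ℝ)) := by
  intro s hs t ht hst
  have hs' : 0 < s := hs
  have ht' : 0 < t := ht
  have pd : ∀ u : ℝ, 0 < u → (u⁻¹ • (1 : Matrix (Fin p) (Fin p) ℝ)).PosDef :=
    fun u hu => Matrix.PosDef.one.smul (inv_pos.2 hu)
  have hA : (B1 + t⁻¹ • (1 : Matrix (Fin p) (Fin p) ℝ)).PosDef := (pd t ht').posSemidef_add h1
  have hC : ((s⁻¹ - t⁻¹) • (1 : Matrix (Fin p) (Fin p) ℝ)).PosSemidef :=
    Matrix.PosSemidef.one.smul (sub_nonneg.2 (inv_anti₀ hs' hst))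
  have key := aux_main hA h2 hC
  have d1 := ((pd t ht').posSemidef_add (h1.add h2)).det_pos
  have d2 := ((pd s hs').posSemidef_add (h1.add h2)).det_pos
  have e1 : B1 + t⁻¹ • (1 : Matrix (Fin p) (Fin p) ℝ) + (s⁻¹ - t⁻¹) • 1 = B1 + s⁻¹ • 1 := by
    rw [sub_smul]; abel
  rw [e1, add_right_comm B1 _ B2, add_right_comm B1 _ B2] at key
  exact (div_le_div_iff₀ d1 d2).2 key
end
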